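/- For every δ ∈ (0,1) and every R > 2M there is a constant C = C(M, δ, R) > 0 such that: for every spherically symmetric solution φ of the wave equation on the exterior of the Schwarzschild spacetime of mass M with E₂(φ) < ∞ and E₂(∂_tφ) < ∞, and for all t ≥ 1 and all s ∈ ℝ with r(s) ≤ R, one has |∂_tφ(t,s)| + |∂_sφ(t,s)| ≤ C · (max{(t+s)/2, 1})^{−3/2+δ} · (E₂(φ)^{1/2} + E₂(∂_tφ)^{1/2}). -/

import Mathlib

open Real MeasureTheory

noncomputable section

/-- partial derivative in the first (time) variable -/
def pd_t (φ : ℝ → ℝ → ℝ) : ℝ → ℝ → ℝ := fun t s => deriv (fun t' => φ t' s) t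

/-- partial derivative in the second (tortoise) variable -/
def pd_s (φ : ℝ → ℝ → ℝ) : ℝ → ℝ → ℝ := fun t s => deriv (fun s' => φ t s') s

/-- the scaling vector field `S ξ = t ∂_t ξ + s ∂_s ξ` -/
def Svf (φ : ℝ → ℝ → ℝ) : ℝ → ℝ → ℝ := fun t s => t * pd_t φ t s + s * pd_s φ t s

/-- `r` is the Schwarzschild area-radius of mass `M` in the Regge-Wheeler tortoise
coordinate: `r(s) > 2M`, `r' = 1 - 2M/r`, `r(0) = 3M`. -/
def IsTortoise (M : ℝ) (r : ℝ → ℝ) : Prop :=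
  (∀ s, 2 * M < r s) ∧ (∀ s, HasDerivAt r (1 - 2 * M / r s) s) ∧ r 0 = 3 * M

/-- `μ(s) = 2M / r(s)` -/
def muS (M : ℝ) (r : ℝ → ℝ) (s : ℝ) : ℝ := 2 * M / r s

/-- a spherically symmetric solution of the wave equation on the exterior of the
Schwarzschild spacetime: smooth, satisfying `∂_t²φ = r⁻² ∂_s(r² ∂_s φ)`, and supported
away from spatial infinity. -/
def IsWaveSol (r : ℝ → ℝ) (φ : ℝ → ℝ → ℝ) : Prop :=
  ContDiff ℝ (⊤ : ℕ∞) (Function.uncurry φ) ∧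
  (∀ t s, pd_t (pd_t φ) t s = ((r s) ^ 2)⁻¹ * deriv (fun x => (r x) ^ 2 * pd_s φ t x) s) ∧
  ∃ S₀ : ℝ, ∀ t s, S₀ + |t - 1| ≤ s → φ t s = 0

/-- the integrand of the initial energy `E₀(ξ)`, evaluated on the slice `t = 1`. -/
def E0Integrand (M : ℝ) (r : ℝ → ℝ) (ξ : ℝ → ℝ → ℝ) (s : ℝ) : ℝ :=
  ((1 - muS M r s)⁻¹ * (pd_t ξ 1 s - pd_s ξ 1 s) ^ 2
    + (pd_t ξ 1 s + pd_s ξ 1 s) ^ 2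
    + ((1 - s) / 2) ^ 2 * (pd_t ξ 1 s - pd_s ξ 1 s) ^ 2
    + ((1 + s) / 2) ^ 2 * (pd_t ξ 1 s + pd_s ξ 1 s) ^ 2
    + (1 - muS M r s) * ((1 + s ^ 2) / (r s) ^ 2) * (ξ 1 s) ^ 2) * (r s) ^ 2

/-- the initial energy `E₀(ξ)` -/
def E0 (M : ℝ) (r : ℝ → ℝ) (ξ : ℝ → ℝ → ℝ) : ℝ := ∫ s, E0Integrand M r ξ s

/-- `E₀(ξ) < ∞` : the (nonnegative) integrand of `E₀(ξ)` is integrable -/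
def FinE0 (M : ℝ) (r : ℝ → ℝ) (ξ : ℝ → ℝ → ℝ) : Prop := Integrable (E0Integrand M r ξ)

/-- `E₁(ξ) = E₀(Sξ) + E₀(ξ) + E₀(∂_t ξ)` -/
def E1 (M : ℝ) (r : ℝ → ℝ) (ξ : ℝ → ℝ → ℝ) : ℝ :=
  E0 M r (Svf ξ) + E0 M r ξ + E0 M r (pd_t ξ)

/-- `E₁(ξ) < ∞` -/
def FinE1 (M : ℝ) (r : ℝ → ℝ) (ξ : ℝ → ℝ → ℝ) : Prop :=
  FinE0 M r (Svf ξ) ∧ FinE0 M r ξ ∧ FinE0 M r (pd_t ξ)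

/-- `E₂(ξ) = E₁(ξ) + E₁(∂_t ξ) + E₁(∂_t² ξ)` -/
def E2 (M : ℝ) (r : ℝ → ℝ) (ξ : ℝ → ℝ → ℝ) : ℝ :=
  E1 M r ξ + E1 M r (pd_t ξ) + E1 M r (pd_t (pd_t ξ))

/-- `E₂(ξ) < ∞` -/
def FinE2 (M : ℝ) (r : ℝ → ℝ) (ξ : ℝ → ℝ → ℝ) : Prop :=
  FinE1 M r ξ ∧ FinE1 M r (pd_t ξ) ∧ FinE1 M r (pd_t (pd_t ξ))


lemma two_le_smooth : (2 : WithTop ℕ∞) ≤ ((⊤ : ℕ∞) : WithTop ℕ∞) := by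
  have : ((2 : ℕ∞) : WithTop ℕ∞) ≤ ((⊤ : ℕ∞) : WithTop ℕ∞) := WithTop.coe_le_coe.2 le_top
  exact this

def Sm (f : ℝ → ℝ → ℝ) : Prop := ContDiff ℝ (⊤ : ℕ∞) (Function.uncurry f)

/-- local C^2 regularity on `t > 0` -/
def Sp (f : ℝ → ℝ → ℝ) : Prop :=
  ∀ t s, 0 < t → ContDiffAt ℝ 2 (Function.uncurry f) (t, s)

lemma Sm.sp {f : ℝ → ℝ → ℝ} (h : Sm f) : Sp f := fun t s _ =>
  ((ContDiff.of_le h two_le_smooth).contDiffAt)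

lemma line_aux {f : ℝ → ℝ → ℝ} {γ₁ γ₂ : ℝ → ℝ} {a b τ : ℝ}
    (hf : DifferentiableAt ℝ (Function.uncurry f) (γ₁ τ, γ₂ τ))
    (h1 : HasDerivAt γ₁ a τ) (h2 : HasDerivAt γ₂ b τ) :
    HasDerivAt (fun τ => f (γ₁ τ) (γ₂ τ))
      (fderiv ℝ (Function.uncurry f) (γ₁ τ, γ₂ τ) (a, b)) τ := by
  have := hf.hasFDerivAt.comp_hasDerivAt τ (h1.prodMk h2)
  simpa [Function.uncurry, Function.comp_def] using this

lemma pd_t_eq {f : ℝ → ℝ → ℝ} {t s : ℝ}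
    (hf : DifferentiableAt ℝ (Function.uncurry f) (t, s)) :
    pd_t f t s = fderiv ℝ (Function.uncurry f) (t, s) (1, 0) := by
  have := line_aux (γ₁ := fun τ => τ) (γ₂ := fun _ => s) (τ := t) hf (hasDerivAt_id t)
    (hasDerivAt_const t s)
  exact this.deriv

lemma pd_s_eq {f : ℝ → ℝ → ℝ} {t s : ℝ}
    (hf : DifferentiableAt ℝ (Function.uncurry f) (t, s)) :
    pd_s f t s = fderiv ℝ (Function.uncurry f) (t, s) (0, 1) := by
  have := line_aux (γ₁ := fun _ => t) (γ₂ := fun τ => τ) (τ := s) hf (hasDerivAt_const s t)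
    (hasDerivAt_id s)
  exact this.deriv

lemma hasDeriv_t {f : ℝ → ℝ → ℝ} {t s : ℝ}
    (hf : DifferentiableAt ℝ (Function.uncurry f) (t, s)) :
    HasDerivAt (fun τ => f τ s) (pd_t f t s) t := by
  rw [pd_t_eq hf]
  exact line_aux (γ₁ := fun τ => τ) (γ₂ := fun _ => s) (τ := t) hf (hasDerivAt_id t)
    (hasDerivAt_const t s)

lemma hasDeriv_s {f : ℝ → ℝ → ℝ} {t s : ℝ}
    (hf : DifferentiableAt ℝ (Function.uncurry f) (t, s)) :
    HasDerivAt (fun τ => f t τ) (pd_s f t s) s := by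
  rw [pd_s_eq hf]
  exact line_aux (γ₁ := fun _ => t) (γ₂ := fun τ => τ) (τ := s) hf (hasDerivAt_const s t)
    (hasDerivAt_id s)

lemma hasDeriv_line {f : ℝ → ℝ → ℝ} {γ₁ γ₂ : ℝ → ℝ} {a b τ : ℝ}
    (hf : DifferentiableAt ℝ (Function.uncurry f) (γ₁ τ, γ₂ τ))
    (h1 : HasDerivAt γ₁ a τ) (h2 : HasDerivAt γ₂ b τ) :
    HasDerivAt (fun τ => f (γ₁ τ) (γ₂ τ))
      (a * pd_t f (γ₁ τ) (γ₂ τ) + b * pd_s f (γ₁ τ) (γ₂ τ)) τ := by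
  have := line_aux hf h1 h2
  rw [pd_t_eq hf, pd_s_eq hf]
  convert this using 1
  have e : ((a, b) : ℝ × ℝ) = a • ((1:ℝ), (0:ℝ)) + b • ((0:ℝ), (1:ℝ)) := by
    simp
  rw [e, map_add, map_smul, map_smul]; simp

lemma Sp.diff {f : ℝ → ℝ → ℝ} (h : Sp f) {t s : ℝ} (ht : 0 < t) :
    DifferentiableAt ℝ (Function.uncurry f) (t, s) :=
  (h t s ht).differentiableAt (by norm_num)

lemma Sm.diff {f : ℝ → ℝ → ℝ} (h : Sm f) (t s : ℝ) :
    DifferentiableAt ℝ (Function.uncurry f) (t, s) :=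
  (ContDiff.differentiable h (by simp)).differentiableAt

lemma Sm.t {f : ℝ → ℝ → ℝ} (h : Sm f) (t s : ℝ) :
    HasDerivAt (fun τ => f τ s) (pd_t f t s) t := hasDeriv_t (h.diff t s)

lemma Sm.s {f : ℝ → ℝ → ℝ} (h : Sm f) (t s : ℝ) :
    HasDerivAt (fun σ => f t σ) (pd_s f t s) s := hasDeriv_s (h.diff t s)

lemma Sm.dt {f : ℝ → ℝ → ℝ} (h : Sm f) : Sm (pd_t f) := by
  have e : Function.uncurry (pd_t f) = fun p => fderiv ℝ (Function.uncurry f) p (1, 0) := by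
    ext ⟨t, s⟩
    exact pd_t_eq (h.diff t s)
  unfold Sm at *
  rw [e]
  exact (h.fderiv_right (m := ((⊤ : ℕ∞) : WithTop ℕ∞)) (by simp)).clm_apply contDiff_const

lemma Sm.ds {f : ℝ → ℝ → ℝ} (h : Sm f) : Sm (pd_s f) := by
  have e : Function.uncurry (pd_s f) = fun p => fderiv ℝ (Function.uncurry f) p (0, 1) := by
    ext ⟨t, s⟩
    exact pd_s_eq (h.diff t s)
  unfold Sm at *
  rw [e]
  exact (h.fderiv_right (m := ((⊤ : ℕ∞) : WithTop ℕ∞)) (by simp)).clm_apply contDiff_const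

lemma Sm.comm {f : ℝ → ℝ → ℝ} (h : Sm f) : pd_t (pd_s f) = pd_s (pd_t f) := by
  ext t s
  have e1 : Function.uncurry (pd_t f) = fun p => fderiv ℝ (Function.uncurry f) p (1, 0) := by
    ext ⟨t, s⟩
    exact pd_t_eq (h.diff t s)
  have e2 : Function.uncurry (pd_s f) = fun p => fderiv ℝ (Function.uncurry f) p (0, 1) := by
    ext ⟨t, s⟩
    exact pd_s_eq (h.diff t s)
  have hd : DifferentiableAt ℝ (fderiv ℝ (Function.uncurry f)) (t, s) :=
    ((ContDiff.fderiv_right (m := ((⊤ : ℕ∞) : WithTop ℕ∞)) h (by simp)).differentiable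
      (by simp)).differentiableAt
  rw [pd_t_eq (h.ds.diff t s), pd_s_eq (h.dt.diff t s), e1, e2]
  rw [fderiv_clm_apply hd (by fun_prop), fderiv_clm_apply hd (by fun_prop)]
  simp
  have := (ContDiff.contDiffAt (x := (t, s)) h).isSymmSndFDerivAt (by simpa using two_le_smooth)
  exact this _ _

lemma Sm.add {f g : ℝ → ℝ → ℝ} (hf : Sm f) (hg : Sm g) : Sm (fun t s => f t s + g t s) :=
  ContDiff.add hf hg
lemma Sm.mul {f g : ℝ → ℝ → ℝ} (hf : Sm f) (hg : Sm g) : Sm (fun t s => f t s * g t s) :=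
  ContDiff.mul hf hg
lemma Sm.ofs {g : ℝ → ℝ} (hg : ContDiff ℝ (⊤ : ℕ∞) g) : Sm (fun _ s => g s) :=
  ContDiff.comp hg contDiff_snd
lemma Sm.oft {g : ℝ → ℝ} (hg : ContDiff ℝ (⊤ : ℕ∞) g) : Sm (fun t _ => g t) :=
  ContDiff.comp hg contDiff_fst
lemma Sm.svf {f : ℝ → ℝ → ℝ} (hf : Sm f) : Sm (Svf f) :=
  ((Sm.oft contDiff_id).mul hf.dt).add ((Sm.ofs contDiff_id).mul hf.ds)

lemma Sp.add {f g : ℝ → ℝ → ℝ} (hf : Sp f) (hg : Sp g) : Sp (fun t s => f t s + g t s) :=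
  fun t s h => ContDiffAt.add (hf t s h) (hg t s h)
lemma Sp.mul {f g : ℝ → ℝ → ℝ} (hf : Sp f) (hg : Sp g) : Sp (fun t s => f t s * g t s) :=
  fun t s h => ContDiffAt.mul (hf t s h) (hg t s h)

lemma Sp.cont_t {f : ℝ → ℝ → ℝ} (h : Sp f) :
    ContinuousOn (Function.uncurry (pd_t f)) {p | 0 < p.1} := by
  rintro ⟨t, s⟩ ht
  have hc : ContinuousAt (fun p => fderiv ℝ (Function.uncurry f) p (1, 0)) (t, s) := by
    have := ((h t s ht).fderiv_right (m := 1) (by norm_num)).continuousAt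
    exact this.clm_apply continuousAt_const
  refine ContinuousAt.continuousWithinAt (hc.congr ?_)
  have : {p : ℝ × ℝ | 0 < p.1} ∈ nhds (t, s) :=
    (isOpen_lt continuous_const continuous_fst).mem_nhds ht
  filter_upwards [this] with p hp
  exact (pd_t_eq (h.diff hp)).symm

lemma Sp.cont_s {f : ℝ → ℝ → ℝ} (h : Sp f) :
    ContinuousOn (Function.uncurry (pd_s f)) {p | 0 < p.1} := by
  rintro ⟨t, s⟩ ht
  have hc : ContinuousAt (fun p => fderiv ℝ (Function.uncurry f) p (0, 1)) (t, s) := by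
    have := ((h t s ht).fderiv_right (m := 1) (by norm_num)).continuousAt
    exact this.clm_apply continuousAt_const
  refine ContinuousAt.continuousWithinAt (hc.congr ?_)
  have : {p : ℝ × ℝ | 0 < p.1} ∈ nhds (t, s) :=
    (isOpen_lt continuous_const continuous_fst).mem_nhds ht
  filter_upwards [this] with p hp
  exact (pd_s_eq (h.diff hp)).symm

lemma Sp.cont {f : ℝ → ℝ → ℝ} (h : Sp f) :
    ContinuousOn (Function.uncurry f) {p | 0 < p.1} := by
  rintro ⟨t, s⟩ ht
  exact (h t s ht).continuousAt.continuousWithinAt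

lemma sub_cont {f : ℝ → ℝ → ℝ} (h : ContinuousOn (Function.uncurry f) {p | 0 < p.1})
    (a T X : ℝ) :
    ContinuousOn (fun p : ℝ × ℝ => f p.1 (a + p.1 + p.2)) (Set.Icc 1 T ×ˢ Set.Icc 0 X) := by
  have : ContinuousOn (fun p : ℝ × ℝ => (p.1, a + p.1 + p.2)) (Set.Icc 1 T ×ˢ Set.Icc 0 X) := by
    fun_prop
  refine h.comp this ?_
  rintro ⟨t, y⟩ ⟨ht, _⟩
  simp at ht ⊢
  linarith [ht.1]

lemma energy_mono {ρ K : ℝ → ℝ → ℝ} (hρ : Sp ρ) (hK : Sp K) {a X T : ℝ} (hT : 1 ≤ T) (hX : 0 ≤ X)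
    (hle : ∀ t s, 1 ≤ t → t ≤ T → pd_t ρ t s ≤ pd_s K t s)
    (hL : ∀ t, 1 ≤ t → t ≤ T → 0 ≤ ρ t (a + t) + K t (a + t))
    (hR : ∀ t, 1 ≤ t → t ≤ T → ρ t (a + t + X) + K t (a + t + X) = 0) :
    ∫ y in (0:ℝ)..X, ρ T (a + T + y) ≤ ∫ y in (0:ℝ)..X, ρ 1 (a + 1 + y) := by
  have cρ := sub_cont hρ.cont a T X
  have cρt := sub_cont hρ.cont_t a T X
  have cρs := sub_cont hρ.cont_s a T X
  have cKs := sub_cont hK.cont_s a T X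
  have slice_y : ∀ {f : ℝ → ℝ → ℝ}, ContinuousOn (fun p : ℝ × ℝ => f p.1 (a + p.1 + p.2))
      (Set.Icc 1 T ×ˢ Set.Icc 0 X) → ∀ t, 1 ≤ t → t ≤ T →
      IntervalIntegrable (fun y => f t (a + t + y)) volume 0 X := by
    intro f hf t h1 h2
    apply ContinuousOn.intervalIntegrable
    rw [Set.uIcc_of_le hX]
    exact hf.comp (f := fun y => (t, y)) (by fun_prop) (fun y hy => ⟨⟨h1, h2⟩, hy⟩)
  have slice_t : ∀ {f : ℝ → ℝ → ℝ}, ContinuousOn (fun p : ℝ × ℝ => f p.1 (a + p.1 + p.2))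
      (Set.Icc 1 T ×ˢ Set.Icc 0 X) → ∀ y, 0 ≤ y → y ≤ X →
      IntervalIntegrable (fun t => f t (a + t + y)) volume 1 T := by
    intro f hf y h1 h2
    apply ContinuousOn.intervalIntegrable
    rw [Set.uIcc_of_le hT]
    exact hf.comp (f := fun t => (t, y)) (by fun_prop) (fun t ht => ⟨ht, ⟨h1, h2⟩⟩)
  let G : ℝ → ℝ → ℝ := fun t y => pd_s K t (a + t + y) + pd_s ρ t (a + t + y)
  have cG : ContinuousOn (fun p : ℝ × ℝ => G p.1 p.2) (Set.Icc 1 T ×ˢ Set.Icc 0 X) := cKs.add cρs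
  have step1 : ∀ y, 0 ≤ y → y ≤ X → ρ T (a + T + y) - ρ 1 (a + 1 + y) ≤ ∫ t in (1:ℝ)..T, G t y := by
    intro y h0 h1
    have e : ∫ t in (1:ℝ)..T, (1 * pd_t ρ t (a + t + y) + 1 * pd_s ρ t (a + t + y))
        = ρ T (a + T + y) - ρ 1 (a + 1 + y) := by
      apply intervalIntegral.integral_eq_sub_of_hasDerivAt (f := fun t => ρ t (a + t + y))
      · intro t ht
        rw [Set.uIcc_of_le hT] at ht
        exact hasDeriv_line (γ₁ := fun t => t) (γ₂ := fun t => a + t + y)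
          (hρ.diff (by linarith [ht.1])) (hasDerivAt_id t)
          (by simpa using ((hasDerivAt_id t).const_add a).add_const y)
      · simp only [one_mul]
        exact (slice_t cρt y h0 h1).add (slice_t cρs y h0 h1)
    rw [← e]
    apply intervalIntegral.integral_mono_on hT
    · simp only [one_mul]
      exact (slice_t cρt y h0 h1).add (slice_t cρs y h0 h1)
    · exact (slice_t cKs y h0 h1).add (slice_t cρs y h0 h1)
    · intro t ht
      simp only [one_mul, G]
      linarith [hle t (a + t + y) ht.1 ht.2]
  have hintg : IntegrableOn (Function.uncurry G) (Set.Icc 1 T ×ˢ Set.Icc 0 X) :=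
    ContinuousOn.integrableOn_compact (isCompact_Icc.prod isCompact_Icc) cG
  have hGint : IntegrableOn (Function.uncurry G) (Set.uIoc 1 T ×ˢ Set.uIoc 0 X) := by
    refine hintg.mono_set (Set.prod_mono ?_ ?_)
    · rw [Set.uIoc_of_le hT]; exact Set.Ioc_subset_Icc_self
    · rw [Set.uIoc_of_le hX]; exact Set.Ioc_subset_Icc_self
  have swap : ∫ t in (1:ℝ)..T, ∫ y in (0:ℝ)..X, G t y = ∫ y in (0:ℝ)..X, ∫ t in (1:ℝ)..T, G t y := by
    apply MeasureTheory.intervalIntegral_intervalIntegral_swap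
    exact hGint
  have inner : ∀ t, 1 ≤ t → t ≤ T → ∫ y in (0:ℝ)..X, G t y ≤ 0 := by
    intro t h1 h2
    have ht : 0 < t := by linarith
    have : ∫ y in (0:ℝ)..X, G t y = (K t (a + t + X) + ρ t (a + t + X))
        - (K t (a + t + 0) + ρ t (a + t + 0)) := by
      apply intervalIntegral.integral_eq_sub_of_hasDerivAt
        (f := fun y => K t (a + t + y) + ρ t (a + t + y))
      · intro y _
        exact ((hasDeriv_s (hK.diff ht)).comp_const_add (a + t) y).add
          ((hasDeriv_s (hρ.diff ht)).comp_const_add (a + t) y)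
      · exact (slice_y cKs t h1 h2).add (slice_y cρs t h1 h2)
    rw [this, add_zero]
    linarith [hL t h1 h2, hR t h1 h2]
  have iG : IntervalIntegrable (fun y => ∫ t in (1:ℝ)..T, G t y) volume 0 X := by
    have h2 : IntegrableOn (fun p : ℝ × ℝ => G p.2 p.1) (Set.Ioc 0 X ×ˢ Set.Ioc 1 T) := by
      rw [Set.uIoc_of_le hT, Set.uIoc_of_le hX] at hGint
      unfold IntegrableOn at hGint ⊢
      rw [Measure.volume_eq_prod, ← Measure.prod_restrict] at hGint ⊢
      exact hGint.swap
    unfold IntegrableOn at h2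
    rw [Measure.volume_eq_prod, ← Measure.prod_restrict] at h2
    rw [intervalIntegrable_iff_integrableOn_Ioc_of_le hX]
    have := h2.integral_prod_left
    simp only [intervalIntegral.integral_of_le hT]
    exact this
  have fin : ∫ y in (0:ℝ)..X, (ρ T (a + T + y) - ρ 1 (a + 1 + y)) ≤ 0 := by
    calc _ ≤ ∫ y in (0:ℝ)..X, ∫ t in (1:ℝ)..T, G t y := by
          apply intervalIntegral.integral_mono_on hX
          · exact (slice_y cρ T hT le_rfl).sub (slice_y cρ 1 le_rfl hT)
          · exact iG
          · intro y hy; exact step1 y hy.1 hy.2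
      _ = ∫ t in (1:ℝ)..T, ∫ y in (0:ℝ)..X, G t y := swap.symm
      _ ≤ 0 := by
          have := intervalIntegral.integral_nonneg (f := fun t => - ∫ y in (0:ℝ)..X, G t y) (μ := volume) hT
            (fun t ht => by simpa using inner t ht.1 ht.2)
          rw [intervalIntegral.integral_neg] at this
          linarith
  rw [intervalIntegral.integral_sub (slice_y cρ T hT le_rfl) (slice_y cρ 1 le_rfl hT)] at fin
  linarith

/-- A (local) current with density `ρ`, flux `K` and source `b`. -/
structure Cur (ρ K b : ℝ → ℝ → ℝ) : Prop where
  spρ : Sp ρ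
  spK : Sp K
  eq : ∀ t s, 0 < t → pd_t ρ t s = pd_s K t s + b t s

lemma Cur.add {ρ K b ρ' K' b' : ℝ → ℝ → ℝ} (h : Cur ρ K b) (h' : Cur ρ' K' b') :
    Cur (fun t s => ρ t s + ρ' t s) (fun t s => K t s + K' t s) (fun t s => b t s + b' t s) where
  spρ := h.spρ.add h'.spρ
  spK := h.spK.add h'.spK
  eq := by
    intro t s ht
    have e1 := ((hasDeriv_t (h.spρ.diff (s := s) ht)).add (hasDeriv_t (h'.spρ.diff (s := s) ht))).deriv
    have e2 := ((hasDeriv_s (h.spK.diff (s := s) ht)).add (hasDeriv_s (h'.spK.diff (s := s) ht))).deriv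
    have e1' : pd_t (fun t s => ρ t s + ρ' t s) t s = pd_t ρ t s + pd_t ρ' t s := e1
    have e2' : pd_s (fun t s => K t s + K' t s) t s = pd_s K t s + pd_s K' t s := e2
    rw [e1', e2', h.eq t s ht, h'.eq t s ht]; ring

lemma Cur.smul {ρ K b : ℝ → ℝ → ℝ} (h : Cur ρ K b) (c : ℝ) :
    Cur (fun t s => c * ρ t s) (fun t s => c * K t s) (fun t s => c * b t s) where
  spρ := Sp.mul (Sm.sp (contDiff_const (c := c))) h.spρ
  spK := Sp.mul (Sm.sp (contDiff_const (c := c))) h.spK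
  eq := by
    intro t s ht
    have e1 := ((hasDeriv_t (h.spρ.diff (s := s) ht)).const_mul c).deriv
    have e2 := ((hasDeriv_s (h.spK.diff (s := s) ht)).const_mul c).deriv
    have e1' : pd_t (fun t s => c * ρ t s) t s = c * pd_t ρ t s := e1
    have e2' : pd_s (fun t s => c * K t s) t s = c * pd_s K t s := e2
    rw [e1', e2', h.eq t s ht]; ring

lemma Sp.inv_t : Sp (fun t _ => t⁻¹) := by
  intro t s ht
  have : ContDiffAt ℝ 2 (fun p : ℝ × ℝ => (p.1)⁻¹) (t, s) :=
    ContDiffAt.inv (by fun_prop) ht.ne'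
  exact this

lemma Cur.inv_t {ρ K b : ℝ → ℝ → ℝ} (h : Cur ρ K b) :
    Cur (fun t s => t⁻¹ * ρ t s) (fun t s => t⁻¹ * K t s)
      (fun t s => t⁻¹ * b t s - (t ^ 2)⁻¹ * ρ t s) where
  spρ := Sp.inv_t.mul h.spρ
  spK := Sp.inv_t.mul h.spK
  eq := by
    intro t s ht
    have e1 := ((hasDerivAt_inv ht.ne').mul (hasDeriv_t (h.spρ.diff (s := s) ht))).deriv
    have e2 := ((hasDeriv_s (h.spK.diff (s := s) ht)).const_mul t⁻¹).deriv
    have e1' : pd_t (fun t s => t⁻¹ * ρ t s) t s = -(t^2)⁻¹ * ρ t s + t⁻¹ * pd_t ρ t s := e1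
    have e2' : pd_s (fun t s => t⁻¹ * K t s) t s = t⁻¹ * pd_s K t s := e2
    rw [e1', e2', h.eq t s ht]; ring

lemma cur_of {ρ K b : ℝ → ℝ → ℝ} (h1 : Sp ρ) (h2 : Sp K) (ρt Ks : ℝ → ℝ → ℝ)
    (h3 : ∀ t s, 0 < t → HasDerivAt (fun τ => ρ τ s) (ρt t s) t)
    (h4 : ∀ t s, 0 < t → HasDerivAt (fun σ => K t σ) (Ks t s) s)
    (h5 : ∀ t s, 0 < t → ρt t s = Ks t s + b t s) : Cur ρ K b where
  spρ := h1
  spK := h2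
  eq := by
    intro t s ht
    have e1 : pd_t ρ t s = ρt t s := (h3 t s ht).deriv
    have e2 : pd_s K t s = Ks t s := (h4 t s ht).deriv
    rw [e1, e2, h5 t s ht]

/-- background -/
structure Bg where
  V : ℝ → ℝ
  V' : ℝ → ℝ
  W : ℝ → ℝ
  h : ℝ → ℝ
  h' : ℝ → ℝ
  p : ℝ → ℝ
  p' : ℝ → ℝ
  q : ℝ → ℝ
  q' : ℝ → ℝ
  C : ℝ
  smV : ContDiff ℝ (⊤ : ℕ∞) V
  smW : ContDiff ℝ (⊤ : ℕ∞) W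
  smh : ContDiff ℝ (⊤ : ℕ∞) h
  smp : ContDiff ℝ (⊤ : ℕ∞) p
  smq : ContDiff ℝ (⊤ : ℕ∞) q
  dV : ∀ s, HasDerivAt V (V' s) s
  dh : ∀ s, HasDerivAt h (h' s) s
  dp : ∀ s, HasDerivAt p (p' s) s
  dq : ∀ s, HasDerivAt q (q' s) s
  W_eq : ∀ s, W s = -(2 * V s + s * V' s)
  C1 : 1 ≤ C
  Vpos : ∀ s, 0 < V s
  h_le : ∀ s, |h s| ≤ C
  p_le : ∀ s, p s ^ 2 ≤ C * V s
  p_le2 : ∀ s, |p s| ≤ C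
  q_le : ∀ s, |q s| ≤ C * V s
  bulk0 : ∀ s a b c, 0 ≤ (h' s / 2 - p s) * a ^ 2 + (h' s / 2 + p s) * b ^ 2
    + (p s * V s - (h' s * V s + h s * V' s) / 2 + q' s) * c ^ 2 + (p' s + 2 * q s) * c * b
  bulk : ∀ s a b c, |W s| * c ^ 2 ≤ W s * c ^ 2 + C * ((h' s / 2 - p s) * a ^ 2 + (h' s / 2 + p s) * b ^ 2
    + (p s * V s - (h' s * V s + h s * V' s) / 2 + q' s) * c ^ 2 + (p' s + 2 * q s) * c * b)
  W1 : ∀ s, |W s| * (1 + s ^ 2) ≤ C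
  W2 : ∀ s, |W s| ≤ C * (1 + |s|) * V s
  W3 : ∀ s, -1 ≤ s → |W s| ≤ C * V s
  W4 : ∀ s, -1 ≤ s → 1 ≤ C * V s * (1 + s ^ 2) ^ 2
  W5 : ∀ s, s ≤ -1 → |W s| * (1 + s ^ 2) ^ 3 ≤ C * |s|

def Bg.Bulk (B : Bg) (s a b c : ℝ) : ℝ := (B.h' s / 2 - B.p s) * a ^ 2 + (B.h' s / 2 + B.p s) * b ^ 2
    + (B.p s * B.V s - (B.h' s * B.V s + B.h s * B.V' s) / 2 + B.q' s) * c ^ 2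
    + (B.p' s + 2 * B.q s) * c * b

structure Sol (B : Bg) (ψ F : ℝ → ℝ → ℝ) : Prop where
  sm : Sm ψ
  eq : ∀ t s, pd_t (pd_t ψ) t s = pd_s (pd_s ψ) t s - B.V s * ψ t s + F t s

def eK (B : Bg) (ψ : ℝ → ℝ → ℝ) (t s : ℝ) : ℝ :=
  (1 + ((t + s) / 2) ^ 2) * (pd_t ψ t s + pd_s ψ t s) ^ 2
  + (1 + ((t - s) / 2) ^ 2) * (pd_t ψ t s - pd_s ψ t s) ^ 2
  + (2 + (t ^ 2 + s ^ 2) / 2) * B.V s * ψ t s ^ 2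

def kK (B : Bg) (ψ : ℝ → ℝ → ℝ) (t s : ℝ) : ℝ :=
  (1 + ((t + s) / 2) ^ 2) * (pd_t ψ t s + pd_s ψ t s) ^ 2
  - (1 + ((t - s) / 2) ^ 2) * (pd_t ψ t s - pd_s ψ t s) ^ 2
  - t * s * B.V s * ψ t s ^ 2

def e0 (B : Bg) (ψ : ℝ → ℝ → ℝ) (t s : ℝ) : ℝ :=
  (pd_t ψ t s + pd_s ψ t s) ^ 2 + (pd_t ψ t s - pd_s ψ t s) ^ 2 + 2 * B.V s * ψ t s ^ 2

def k0 (ψ : ℝ → ℝ → ℝ) (t s : ℝ) : ℝ :=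
  (pd_t ψ t s + pd_s ψ t s) ^ 2 - (pd_t ψ t s - pd_s ψ t s) ^ 2

def jM (B : Bg) (ψ : ℝ → ℝ → ℝ) (t s : ℝ) : ℝ :=
  pd_t ψ t s * (B.h s * pd_s ψ t s + B.p s * ψ t s)

def kM (B : Bg) (ψ : ℝ → ℝ → ℝ) (t s : ℝ) : ℝ :=
  B.h s * (pd_t ψ t s ^ 2 + pd_s ψ t s ^ 2 - B.V s * ψ t s ^ 2) / 2
    + B.p s * ψ t s * pd_s ψ t s + B.q s * ψ t s ^ 2

lemma Sm.c {f : ℝ → ℝ → ℝ} (h : Sm f) : ContDiff ℝ (⊤ : ℕ∞) (fun p : ℝ × ℝ => f p.1 p.2) := h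

lemma smp_s {g : ℝ → ℝ} (hg : ContDiff ℝ (⊤ : ℕ∞) g) :
    ContDiff ℝ (⊤ : ℕ∞) (fun p : ℝ × ℝ => g p.2) := hg.comp contDiff_snd

section
variable {B : Bg} {ψ F : ℝ → ℝ → ℝ}

lemma sm_eK (h : Sm ψ) : Sm (eK B ψ) := by
  have key : ∀ a b c V : ℝ × ℝ → ℝ, ContDiff ℝ (⊤ : ℕ∞) a → ContDiff ℝ (⊤ : ℕ∞) b →
      ContDiff ℝ (⊤ : ℕ∞) c → ContDiff ℝ (⊤ : ℕ∞) V → ContDiff ℝ (⊤ : ℕ∞) (fun p : ℝ × ℝ =>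
      (1 + ((p.1 + p.2) / 2) ^ 2) * (a p + b p) ^ 2
      + (1 + ((p.1 - p.2) / 2) ^ 2) * (a p - b p) ^ 2
      + (2 + (p.1 ^ 2 + p.2 ^ 2) / 2) * V p * c p ^ 2) := by
    intros; fun_prop
  exact key _ _ _ _ h.dt.c h.ds.c h.c (smp_s B.smV)

lemma sm_kK (h : Sm ψ) : Sm (kK B ψ) := by
  have key : ∀ a b c V : ℝ × ℝ → ℝ, ContDiff ℝ (⊤ : ℕ∞) a → ContDiff ℝ (⊤ : ℕ∞) b →
      ContDiff ℝ (⊤ : ℕ∞) c → ContDiff ℝ (⊤ : ℕ∞) V → ContDiff ℝ (⊤ : ℕ∞) (fun p : ℝ × ℝ =>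
      (1 + ((p.1 + p.2) / 2) ^ 2) * (a p + b p) ^ 2
      - (1 + ((p.1 - p.2) / 2) ^ 2) * (a p - b p) ^ 2
      - p.1 * p.2 * V p * c p ^ 2) := by
    intros; fun_prop
  exact key _ _ _ _ h.dt.c h.ds.c h.c (smp_s B.smV)

lemma sm_e0 (h : Sm ψ) : Sm (e0 B ψ) := by
  have key : ∀ a b c V : ℝ × ℝ → ℝ, ContDiff ℝ (⊤ : ℕ∞) a → ContDiff ℝ (⊤ : ℕ∞) b →
      ContDiff ℝ (⊤ : ℕ∞) c → ContDiff ℝ (⊤ : ℕ∞) V → ContDiff ℝ (⊤ : ℕ∞) (fun p : ℝ × ℝ =>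
      (a p + b p) ^ 2 + (a p - b p) ^ 2 + 2 * V p * c p ^ 2) := by
    intros; fun_prop
  exact key _ _ _ _ h.dt.c h.ds.c h.c (smp_s B.smV)

lemma sm_k0 (h : Sm ψ) : Sm (k0 ψ) := by
  have key : ∀ a b : ℝ × ℝ → ℝ, ContDiff ℝ (⊤ : ℕ∞) a → ContDiff ℝ (⊤ : ℕ∞) b →
      ContDiff ℝ (⊤ : ℕ∞) (fun p : ℝ × ℝ => (a p + b p) ^ 2 - (a p - b p) ^ 2) := by
    intros; fun_prop
  exact key _ _ h.dt.c h.ds.c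

lemma sm_jM (h : Sm ψ) : Sm (jM B ψ) := by
  have key : ∀ a b c H P : ℝ × ℝ → ℝ, ContDiff ℝ (⊤ : ℕ∞) a → ContDiff ℝ (⊤ : ℕ∞) b →
      ContDiff ℝ (⊤ : ℕ∞) c → ContDiff ℝ (⊤ : ℕ∞) H → ContDiff ℝ (⊤ : ℕ∞) P →
      ContDiff ℝ (⊤ : ℕ∞) (fun p : ℝ × ℝ => a p * (H p * b p + P p * c p)) := by
    intros; fun_prop
  exact key _ _ _ _ _ h.dt.c h.ds.c h.c (smp_s B.smh) (smp_s B.smp)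

lemma sm_kM (h : Sm ψ) : Sm (kM B ψ) := by
  have key : ∀ a b c H P Q V : ℝ × ℝ → ℝ, ContDiff ℝ (⊤ : ℕ∞) a → ContDiff ℝ (⊤ : ℕ∞) b →
      ContDiff ℝ (⊤ : ℕ∞) c → ContDiff ℝ (⊤ : ℕ∞) H → ContDiff ℝ (⊤ : ℕ∞) P →
      ContDiff ℝ (⊤ : ℕ∞) Q → ContDiff ℝ (⊤ : ℕ∞) V →
      ContDiff ℝ (⊤ : ℕ∞) (fun p : ℝ × ℝ => H p * (a p ^ 2 + b p ^ 2 - V p * c p ^ 2) / 2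
        + P p * c p * b p + Q p * c p ^ 2) := by
    intros; fun_prop
  exact key _ _ _ _ _ _ _ h.dt.c h.ds.c h.c (smp_s B.smh) (smp_s B.smp) (smp_s B.smq) (smp_s B.smV)

lemma cur_K (h : Sol B ψ F) : Cur (eK B ψ) (kK B ψ) (fun t s => - t * B.W s * ψ t s ^ 2
    + 2 * F t s * ((1 + ((t + s) / 2) ^ 2) * (pd_t ψ t s + pd_s ψ t s)
      + (1 + ((t - s) / 2) ^ 2) * (pd_t ψ t s - pd_s ψ t s))) := by
  have hs := h.sm
  have cm := hs.comm
  refine cur_of (sm_eK hs).sp (sm_kK hs).sp _ _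
    (fun t s _ => by
      have d := ((((hasDerivAt_id t).add_const s).div_const 2).pow 2).const_add 1
      have d' := ((((hasDerivAt_id t).sub_const s).div_const 2).pow 2).const_add 1
      have d'' := ((((hasDerivAt_id t).pow 2).add_const (s ^ 2)).div_const 2).const_add 2
      exact ((d.mul (((hs.dt.t t s).add (hs.ds.t t s)).pow 2)).add
        (d'.mul (((hs.dt.t t s).sub (hs.ds.t t s)).pow 2))).add
        ((d''.mul_const (B.V s)).mul ((hs.t t s).pow 2)))
    (fun t s _ => by
      have d := ((((hasDerivAt_id s).const_add t).div_const 2).pow 2).const_add 1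
      have d' := ((((hasDerivAt_id s).const_sub t).div_const 2).pow 2).const_add 1
      exact ((d.mul (((hs.dt.s t s).add (hs.ds.s t s)).pow 2)).sub
        (d'.mul (((hs.dt.s t s).sub (hs.ds.s t s)).pow 2))).sub
        ((((hasDerivAt_id s).const_mul t).mul (B.dV s)).mul ((hs.s t s).pow 2)))
    ?_
  intro t s _
  simp only [cm, h.eq t s, B.W_eq, id]
  simp
  ring

lemma cur_0 (h : Sol B ψ F) : Cur (e0 B ψ) (k0 ψ) (fun t s => 4 * F t s * pd_t ψ t s) := by
  have hs := h.sm
  have cm := hs.comm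
  refine cur_of (sm_e0 hs).sp (sm_k0 hs).sp _ _
    (fun t s _ => by
      exact (((((hs.dt.t t s).add (hs.ds.t t s)).pow 2)).add
        ((((hs.dt.t t s).sub (hs.ds.t t s)).pow 2))).add
        (((hs.t t s).pow 2).const_mul (2 * B.V s)))
    (fun t s _ => by
      exact (((((hs.dt.s t s).add (hs.ds.s t s)).pow 2)).sub
        ((((hs.dt.s t s).sub (hs.ds.s t s)).pow 2))))
    ?_
  intro t s _
  simp only [cm, h.eq t s]
  simp
  ring

lemma cur_M (h : Sol B ψ F) : Cur (jM B ψ) (kM B ψ) (fun t s =>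
    F t s * (B.h s * pd_s ψ t s + B.p s * ψ t s)
      - B.Bulk s (pd_t ψ t s) (pd_s ψ t s) (ψ t s)) := by
  have hs := h.sm
  have cm := hs.comm
  refine cur_of (sm_jM hs).sp (sm_kM hs).sp _ _
    (fun t s _ => by
      exact (hs.dt.t t s).mul (((hs.ds.t t s).const_mul (B.h s)).add ((hs.t t s).const_mul (B.p s))))
    (fun t s _ => by
      exact ((((B.dh s).mul ((((hs.dt.s t s).pow 2).add ((hs.ds.s t s).pow 2)).sub
        ((B.dV s).mul ((hs.s t s).pow 2)))).div_const 2).add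
        (((B.dp s).mul (hs.s t s)).mul (hs.ds.s t s))).add ((B.dq s).mul ((hs.s t s).pow 2)))
    ?_
  intro t s _
  simp only [cm, h.eq t s, Bg.Bulk]
  simp
  ring
end

def Supp (f : ℝ → ℝ → ℝ) : Prop := ∃ S₀ : ℝ, ∀ t s, S₀ + |t - 1| ≤ s → f t s = 0

lemma Supp.dt {f : ℝ → ℝ → ℝ} (h : Supp f) : Supp (pd_t f) := by
  obtain ⟨S, hS⟩ := h
  refine ⟨S + 1, fun t s hs => ?_⟩
  have : (fun t' => f t' s) =ᶠ[nhds t] fun _ => 0 := by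
    have : {t' | S + |t' - 1| < s} ∈ nhds t :=
      (isOpen_lt (by fun_prop) continuous_const).mem_nhds (by simp; linarith)
    filter_upwards [this] with t' ht'
    exact hS _ _ (le_of_lt ht')
  unfold pd_t
  rw [this.deriv_eq]; simp

lemma Supp.ds {f : ℝ → ℝ → ℝ} (h : Supp f) : Supp (pd_s f) := by
  obtain ⟨S, hS⟩ := h
  refine ⟨S + 1, fun t s hs => ?_⟩
  have : (fun s' => f t s') =ᶠ[nhds s] fun _ => 0 := by
    have : {s' | S + |t - 1| < s'} ∈ nhds s :=
      (isOpen_lt continuous_const continuous_id).mem_nhds (by simp; linarith)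
    filter_upwards [this] with s' hs'
    exact hS _ _ (le_of_lt hs')
  unfold pd_s
  rw [this.deriv_eq]; simp

lemma Supp.svf {f : ℝ → ℝ → ℝ} (h : Supp f) : Supp (Svf f) := by
  obtain ⟨S, hS⟩ := h.dt
  obtain ⟨S', hS'⟩ := h.ds
  refine ⟨max S S', fun t s hs => ?_⟩
  simp [Svf, hS t s (by linarith [le_max_left S S']), hS' t s (by linarith [le_max_right S S'])]

lemma Supp.mul_s {f : ℝ → ℝ → ℝ} (h : Supp f) (g : ℝ → ℝ) : Supp (fun t s => g s * f t s) := by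
  obtain ⟨S, hS⟩ := h
  exact ⟨S, fun t s hs => by simp [hS t s hs]⟩

/-- joint support bound for `ψ` and its first derivatives -/
lemma Supp.joint {f : ℝ → ℝ → ℝ} (h : Supp f) : ∃ S : ℝ, ∀ t s, S + |t - 1| ≤ s →
    f t s = 0 ∧ pd_t f t s = 0 ∧ pd_s f t s = 0 := by
  obtain ⟨S0, h0⟩ := h
  obtain ⟨S1, h1⟩ := Supp.dt ⟨S0, h0⟩
  obtain ⟨S2, h2⟩ := Supp.ds ⟨S0, h0⟩
  refine ⟨max S0 (max S1 S2), fun t s hs => ⟨h0 t s ?_, h1 t s ?_, h2 t s ?_⟩⟩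
  · linarith [le_max_left S0 (max S1 S2)]
  · linarith [le_max_right S0 (max S1 S2), le_max_left S1 S2]
  · linarith [le_max_right S0 (max S1 S2), le_max_right S1 S2]

def nD (B : Bg) (ψ : ℝ → ℝ → ℝ) (t s : ℝ) : ℝ :=
  t⁻¹ * eK B ψ t s + 2 * B.C * (jM B ψ t s + 2 * B.C * e0 B ψ t s)

def nK (B : Bg) (ψ : ℝ → ℝ → ℝ) (t s : ℝ) : ℝ :=
  t⁻¹ * kK B ψ t s + 2 * B.C * (kM B ψ t s + 2 * B.C * k0 ψ t s)

section
variable {B : Bg} {ψ F : ℝ → ℝ → ℝ}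

lemma cur_n (h : Sol B ψ F) : Cur (nD B ψ) (nK B ψ) (fun t s =>
    (t⁻¹ * (- t * B.W s * ψ t s ^ 2
    + 2 * F t s * ((1 + ((t + s) / 2) ^ 2) * (pd_t ψ t s + pd_s ψ t s)
      + (1 + ((t - s) / 2) ^ 2) * (pd_t ψ t s - pd_s ψ t s))) - (t ^ 2)⁻¹ * eK B ψ t s)
    + 2 * B.C * ((F t s * (B.h s * pd_s ψ t s + B.p s * ψ t s)
      - B.Bulk s (pd_t ψ t s) (pd_s ψ t s) (ψ t s)) + 2 * B.C * (4 * F t s * pd_t ψ t s))) :=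
  (cur_K h).inv_t.add (((cur_M h).add ((cur_0 h).smul (2 * B.C))).smul (2 * B.C))

lemma e0_nonneg (t s : ℝ) : 0 ≤ e0 B ψ t s := by
  have := B.Vpos s
  unfold e0; positivity

lemma e0_le_eK (t s : ℝ) : e0 B ψ t s ≤ eK B ψ t s := by
  have := B.Vpos s
  have h1 : 0 ≤ ((t + s) / 2) ^ 2 * (pd_t ψ t s + pd_s ψ t s) ^ 2 := by positivity
  have h2 : 0 ≤ ((t - s) / 2) ^ 2 * (pd_t ψ t s - pd_s ψ t s) ^ 2 := by positivity
  have h3 : 0 ≤ (t ^ 2 + s ^ 2) / 2 * B.V s * ψ t s ^ 2 := by positivity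
  unfold e0 eK; linarith

lemma eK_nonneg (t s : ℝ) : 0 ≤ eK B ψ t s := (e0_nonneg t s).trans (e0_le_eK t s)

lemma pw_aux {p c V C : ℝ} (hp : p ^ 2 ≤ C * V) (b : ℝ) :
    |p * c * b| ≤ (C * (V * c ^ 2) + b ^ 2) / 2 := by
  have h1 : (p * c) ^ 2 ≤ C * (V * c ^ 2) := by
    have := mul_le_mul_of_nonneg_right hp (sq_nonneg c)
    linarith [mul_pow p c 2]
  rw [abs_le]
  constructor <;> nlinarith [sq_nonneg (p * c - b), sq_nonneg (p * c + b)]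

lemma jM_le (t s : ℝ) : |jM B ψ t s| ≤ B.C * e0 B ψ t s := by
  have hC := B.C1
  have hh := B.h_le s
  have hp := pw_aux (c := ψ t s) (B.p_le s) (pd_t ψ t s)
  have hV : 0 ≤ B.V s * ψ t s ^ 2 := mul_nonneg (B.Vpos s).le (sq_nonneg _)
  unfold jM e0
  set a := pd_t ψ t s
  set b := pd_s ψ t s
  have h1 : |B.h s * (a * b)| ≤ B.C * ((a ^ 2 + b ^ 2) / 2) := by
    rw [abs_mul]
    apply mul_le_mul hh _ (abs_nonneg _) (by linarith)
    rw [abs_le]; constructor <;> nlinarith [sq_nonneg (a - b), sq_nonneg (a + b)]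
  have e : a * (B.h s * b + B.p s * ψ t s) = B.h s * (a * b) + B.p s * ψ t s * a := by ring
  rw [e]
  refine (abs_add_le _ _).trans ?_
  nlinarith [sq_nonneg a, sq_nonneg b]

lemma nD_ge {t : ℝ} (_ht : 0 < t) (s : ℝ) : t⁻¹ * eK B ψ t s + e0 B ψ t s ≤ nD B ψ t s := by
  have hC := B.C1
  have h1 := abs_le.1 (jM_le (B := B) (ψ := ψ) t s)
  have h2 := e0_nonneg (B := B) (ψ := ψ) t s
  unfold nD
  have : B.C * e0 B ψ t s ≤ jM B ψ t s + 2 * B.C * e0 B ψ t s := by linarith [h1.1]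
  have h3 : e0 B ψ t s ≤ B.C * e0 B ψ t s := by nlinarith
  have h4 : 0 ≤ jM B ψ t s + 2 * B.C * e0 B ψ t s := by linarith
  nlinarith

lemma nD_nonneg {t : ℝ} (ht : 0 < t) (s : ℝ) : 0 ≤ nD B ψ t s := by
  have := nD_ge (B := B) (ψ := ψ) ht s
  have h1 := e0_nonneg (B := B) (ψ := ψ) t s
  have h2 : 0 ≤ t⁻¹ * eK B ψ t s := mul_nonneg (inv_nonneg.2 ht.le) (eK_nonneg t s)
  linarith

lemma nD_one_le (s : ℝ) : nD B ψ 1 s ≤ 7 * B.C ^ 2 * eK B ψ 1 s := by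
  have hC := B.C1
  have h1 := abs_le.1 (jM_le (B := B) (ψ := ψ) 1 s)
  have h2 := e0_nonneg (B := B) (ψ := ψ) 1 s
  have h3 := e0_le_eK (B := B) (ψ := ψ) 1 s
  have h4 := eK_nonneg (B := B) (ψ := ψ) 1 s
  unfold nD
  have : jM B ψ 1 s + 2 * B.C * e0 B ψ 1 s ≤ 3 * B.C * eK B ψ 1 s := by nlinarith
  have h5 : 2 * B.C * (jM B ψ 1 s + 2 * B.C * e0 B ψ 1 s) ≤ 2 * B.C * (3 * B.C * eK B ψ 1 s) :=
    mul_le_mul_of_nonneg_left this (by linarith)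
  have h6 : eK B ψ 1 s ≤ B.C ^ 2 * eK B ψ 1 s := by nlinarith
  simp only [inv_one, one_mul]
  nlinarith

lemma flux_n {t : ℝ} (ht : 0 < t) (s : ℝ) :
    2 * t⁻¹ * ((1 + ((t - s) / 2) ^ 2) * (B.V s * ψ t s ^ 2)) ≤ nD B ψ t s + nK B ψ t s := by
  have hC := B.C1
  have hh := B.h_le s
  have hq := B.q_le s
  have hV : 0 ≤ B.V s * ψ t s ^ 2 := mul_nonneg (B.Vpos s).le (sq_nonneg _)
  unfold nD nK
  have hm : 0 ≤ jM B ψ t s + kM B ψ t s + 2 * B.C * (e0 B ψ t s + k0 ψ t s) := by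
    unfold jM kM e0 k0
    set a := pd_t ψ t s
    set b := pd_s ψ t s
    set c := ψ t s
    have hp := (abs_le.1 (pw_aux (c := c) (B.p_le s) (a + b))).1
    have e : a * (B.h s * b + B.p s * c) +
      (B.h s * (a ^ 2 + b ^ 2 - B.V s * c ^ 2) / 2 + B.p s * c * b + B.q s * c ^ 2) +
      2 * B.C * ((a + b) ^ 2 + (a - b) ^ 2 + 2 * B.V s * c ^ 2 + ((a + b) ^ 2 - (a - b) ^ 2))
      = B.h s * ((a + b) ^ 2 - B.V s * c ^ 2) / 2 + B.p s * c * (a + b) + B.q s * c ^ 2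
        + 4 * B.C * ((a + b) ^ 2 + B.V s * c ^ 2) := by ring
    rw [e]
    have h1 := abs_le.1 hh
    have h2 : -(B.C * (B.V s * c ^ 2)) ≤ B.q s * c ^ 2 := by
      have := mul_le_mul_of_nonneg_right (abs_le.1 hq).1 (sq_nonneg c)
      linarith
    have h3 : -(B.C * (a + b) ^ 2) ≤ B.h s * (a + b) ^ 2 := by
      have := mul_le_mul_of_nonneg_right h1.1 (sq_nonneg (a + b)); linarith
    have h4 : B.h s * (B.V s * c ^ 2) ≤ B.C * (B.V s * c ^ 2) :=
      mul_le_mul_of_nonneg_right h1.2 hV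
    have h5 : 0 ≤ B.C * (B.V s * c ^ 2) := by positivity
    have h6 : (a + b) ^ 2 ≤ B.C * (a + b) ^ 2 := by nlinarith [sq_nonneg (a + b)]
    linarith [sq_nonneg (a + b)]
  have hk : 2 * ((1 + ((t - s) / 2) ^ 2) * (B.V s * ψ t s ^ 2)) ≤ eK B ψ t s + kK B ψ t s := by
    unfold eK kK
    have : 0 ≤ (1 + ((t + s) / 2) ^ 2) * (pd_t ψ t s + pd_s ψ t s) ^ 2 := by positivity
    linarith
  have := mul_le_mul_of_nonneg_left hk (inv_nonneg.2 ht.le)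
  have h7 := mul_nonneg (show 0 ≤ 2 * B.C by linarith) hm
  linarith

lemma sp_nD (h : Sm ψ) : Sp (nD B ψ) := by
  have h1 := (Sp.inv_t).mul (sm_eK (B := B) h).sp
  have h2 : ∀ c : ℝ, Sp (fun _ _ => c) := fun c => Sm.sp (contDiff_const (c := c))
  exact h1.add ((h2 (2 * B.C)).mul ((sm_jM h).sp.add ((h2 (2 * B.C)).mul (sm_e0 h).sp)))

/-- monotonicity in terms of a general interval -/
lemma interval_shift (f : ℝ → ℝ) (a X : ℝ) :
    ∫ y in (0:ℝ)..X, f (a + y) = ∫ s in a..(a + X), f s := by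
  rw [intervalIntegral.integral_comp_add_left]; simp

lemma n_intble (h : Sm ψ) {t : ℝ} (ht : 0 < t) (a b : ℝ) :
    IntervalIntegrable (nD B ψ t) volume a b := by
  apply ContinuousOn.intervalIntegrable
  intro s _
  exact (((sp_nD h).cont (t, s) ht).continuousAt
    ((isOpen_lt continuous_const continuous_fst).mem_nhds ht)).comp
      (f := fun s => (t, s)) (by fun_prop) |>.continuousWithinAt

lemma eK_intble (h : Sm ψ) (t a b : ℝ) : IntervalIntegrable (eK B ψ t) volume a b := by
  apply Continuous.intervalIntegrable
  exact (sm_eK (B := B) h).continuous.comp (f := fun s => (t, s)) (by fun_prop)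

/-- Proposition 1 -/
lemma prop1 (h : Sol B ψ (fun _ _ => 0)) (hsupp : Supp ψ) {I : ℝ}
    (hI : ∀ a b, a ≤ b → ∫ s in a..b, eK B ψ 1 s ≤ I) {t a b : ℝ} (ht : 1 ≤ t) (hab : a ≤ b) :
    ∫ s in a..b, nD B ψ t s ≤ 7 * B.C ^ 2 * I := by
  obtain ⟨S, hS⟩ := hsupp.joint
  have hC := B.C1
  set a' := a - t
  set X := max (b - a) (S - 1 - a')
  have hX : 0 ≤ X := le_trans (by linarith) (le_max_left _ _)
  have hX2 : S - 1 - a' ≤ X := le_max_right _ _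
  have hc := cur_n h
  have key := energy_mono (a := a') (X := X) (T := t) hc.spρ hc.spK ht hX
    (by
      intro τ s h1 _
      have hτ : 0 < τ := by linarith
      rw [hc.eq τ s hτ]
      have hb := B.bulk s (pd_t ψ τ s) (pd_s ψ τ s) (ψ τ s)
      have hb0 := B.bulk0 s (pd_t ψ τ s) (pd_s ψ τ s) (ψ τ s)
      change _ ≤ _ + B.C * B.Bulk s _ _ _ at hb
      change 0 ≤ B.Bulk s _ _ _ at hb0
      have h3 : 0 ≤ (τ ^ 2)⁻¹ * eK B ψ τ s := mul_nonneg (by positivity) (eK_nonneg τ s)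
      have h4 : 0 ≤ B.C * B.Bulk s (pd_t ψ τ s) (pd_s ψ τ s) (ψ τ s) := by positivity
      have h5 : 0 ≤ |B.W s| * ψ τ s ^ 2 := by positivity
      have h6 : τ⁻¹ * (-τ * B.W s * ψ τ s ^ 2) = - (B.W s * ψ τ s ^ 2) := by field_simp
      simp only [mul_zero, zero_mul, add_zero, zero_sub]
      rw [h6]
      linarith)
    (by
      intro τ h1 _
      have hτ : 0 < τ := by linarith
      refine le_trans ?_ (flux_n hτ _)
      have := B.Vpos (a' + τ)
      positivity)
    (by
      intro τ h1 _
      obtain ⟨h2, h3, h4⟩ := hS τ (a' + τ + X) (by rw [abs_of_nonneg (by linarith)]; linarith)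
      simp [nD, nK, eK, kK, jM, kM, e0, k0, h2, h3, h4])
  rw [interval_shift (fun s => nD B ψ t s), interval_shift (fun s => nD B ψ 1 s)] at key
  have e1 : a' + t = a := by simp [a']
  rw [e1] at key
  have h1 : ∫ s in a..b, nD B ψ t s ≤ ∫ s in a..(a + X), nD B ψ t s := by
    apply intervalIntegral.integral_mono_interval le_rfl hab
      (by linarith [le_max_left (b - a) (S - 1 - a')])
    · exact Filter.Eventually.of_forall fun s => nD_nonneg (by linarith) s
    · exact n_intble h.sm (by linarith) _ _
  have h2 : ∫ s in (a' + 1)..(a' + 1 + X), nD B ψ 1 s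
      ≤ ∫ s in (a' + 1)..(a' + 1 + X), 7 * B.C ^ 2 * eK B ψ 1 s := by
    apply intervalIntegral.integral_mono_on (by linarith) (n_intble h.sm one_pos _ _)
      ((eK_intble h.sm _ _ _).const_mul _)
    intro s _
    exact nD_one_le s
  rw [intervalIntegral.integral_const_mul] at h2
  have h3 := mul_le_mul_of_nonneg_left (hI (a' + 1) (a' + 1 + X) (by linarith))
    (show 0 ≤ 7 * B.C ^ 2 by positivity)
  linarith
end

def chi (t s : ℝ) : ℝ := (t ^ 2 - s ^ 2) / (t ^ 2 + s ^ 2)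
def alp (t s : ℝ) : ℝ := t * chi t s ^ 2
def alp' (t s : ℝ) : ℝ := chi t s ^ 2 + 8 * t ^ 2 * s ^ 2 * (t ^ 2 - s ^ 2) / (t ^ 2 + s ^ 2) ^ 3

lemma alp_deriv {t : ℝ} (ht : 0 < t) (s : ℝ) : HasDerivAt (fun τ => alp τ s) (alp' t s) t := by
  have hN : t ^ 2 + s ^ 2 ≠ 0 := by positivity
  have d := (hasDerivAt_id t).mul (((((hasDerivAt_id t).pow 2).sub_const (s ^ 2)).div
    (((hasDerivAt_id t).pow 2).add_const (s ^ 2)) hN).pow 2)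
  refine d.congr_deriv ?_
  simp [alp', chi]
  field_simp
  ring

lemma sp_alp : Sp alp := by
  intro t s ht
  have hN : t ^ 2 + s ^ 2 ≠ 0 := by positivity
  have : ContDiffAt ℝ 2 (fun p : ℝ × ℝ => p.1 * ((p.1 ^ 2 - p.2 ^ 2) / (p.1 ^ 2 + p.2 ^ 2)) ^ 2) (t, s) := by
    apply ContDiffAt.mul (by fun_prop)
    apply ContDiffAt.pow
    exact ContDiffAt.div (by fun_prop) (by fun_prop) hN
  exact this

lemma chi_neg (t s : ℝ) : chi t (-s) = chi t s := by simp [chi]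
lemma alp_neg (t s : ℝ) : alp t (-s) = alp t s := by simp [alp, chi_neg]

lemma chi_abs {t : ℝ} (ht : 0 < t) (s : ℝ) : chi t s ^ 2 ≤ 1 := by
  have hN : 0 < t ^ 2 + s ^ 2 := by positivity
  unfold chi
  rw [div_pow, div_le_one (by positivity)]
  nlinarith [mul_nonneg (sq_nonneg t) (sq_nonneg s)]

lemma alp_abs {t : ℝ} (ht : 0 < t) (s : ℝ) : |alp t s| ≤ t := by
  unfold alp
  have := chi_abs ht s
  rw [abs_of_nonneg (by positivity)]
  nlinarith

lemma chi_sq_f {t : ℝ} (ht : 0 < t) (s : ℝ) :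
    chi t s ^ 2 ≤ 8 * (1 + ((t - s) / 2) ^ 2) * (t⁻¹) ^ 2 := by
  have hN : 0 < t ^ 2 + s ^ 2 := by positivity
  unfold chi
  have e : (t ^ 2 - s ^ 2) ^ 2 * t ^ 2 ≤ 8 * (1 + ((t - s) / 2) ^ 2) * (t ^ 2 + s ^ 2) ^ 2 := by
    have h1 : (t ^ 2 - s ^ 2) ^ 2 = (t - s) ^ 2 * (t + s) ^ 2 := by ring
    have h2 : (t + s) ^ 2 ≤ 2 * (t ^ 2 + s ^ 2) := by nlinarith [sq_nonneg (t - s)]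
    have h3 : t ^ 2 ≤ t ^ 2 + s ^ 2 := by nlinarith [sq_nonneg s]
    rw [h1]
    calc (t - s) ^ 2 * (t + s) ^ 2 * t ^ 2 ≤ (t - s) ^ 2 * (2 * (t ^ 2 + s ^ 2)) * (t ^ 2 + s ^ 2) := by
          gcongr
      _ ≤ _ := by nlinarith [sq_nonneg (t ^ 2 + s ^ 2), sq_nonneg (t - s)]
  rw [div_pow, div_le_iff₀ (by positivity)]
  have ht2 : 0 < t ^ 2 := by positivity
  rw [inv_pow]
  rw [mul_assoc, mul_comm (t ^ 2)⁻¹, ← mul_assoc, ← div_eq_mul_inv, le_div_iff₀ ht2]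
  exact e

lemma alp'_abs {t : ℝ} (ht : 0 < t) (s : ℝ) : |alp' t s| ≤ 3 := by
  have hN : 0 < t ^ 2 + s ^ 2 := by positivity
  have h1 := chi_abs ht s
  have h2 : |8 * t ^ 2 * s ^ 2 * (t ^ 2 - s ^ 2) / (t ^ 2 + s ^ 2) ^ 3| ≤ 2 := by
    rw [abs_div, abs_of_pos (show 0 < (t ^ 2 + s ^ 2) ^ 3 by positivity), div_le_iff₀ (by positivity),
      abs_mul, abs_of_nonneg (show 0 ≤ 8 * t ^ 2 * s ^ 2 by positivity)]
    have h3 : |t ^ 2 - s ^ 2| ≤ t ^ 2 + s ^ 2 := by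
      rw [abs_le]; constructor <;> nlinarith [sq_nonneg t, sq_nonneg s]
    have h4 : 8 * t ^ 2 * s ^ 2 ≤ 2 * (t ^ 2 + s ^ 2) ^ 2 := by nlinarith [sq_nonneg (t ^ 2 - s ^ 2)]
    calc _ ≤ 2 * (t ^ 2 + s ^ 2) ^ 2 * (t ^ 2 + s ^ 2) := by gcongr
      _ = _ := by ring
  unfold alp'
  refine (abs_add_le _ _).trans ?_
  rw [abs_of_nonneg (sq_nonneg (chi t s))]
  linarith

lemma t_sq_le (t s : ℝ) : t ^ 2 ≤ 8 * (1 + ((t - s) / 2) ^ 2) * (1 + s ^ 2) := by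
  nlinarith [sq_nonneg (t - 2 * s), mul_nonneg (sq_nonneg (t - s)) (sq_nonneg s), sq_nonneg (t-s), sq_nonneg s]

lemma cu_sq {t : ℝ} (ht : 0 < t) (s : ℝ) :
    (2 * (1 + ((t - s) / 2) ^ 2) * t⁻¹ - alp t s / 2) ^ 2
      ≤ 29 * (1 + ((t - s) / 2) ^ 2) * (1 + s ^ 2) * (t⁻¹) ^ 2 := by
  have hN : 0 < t ^ 2 + s ^ 2 := by positivity
  set k := (t - s) ^ 2 * (2 * t ^ 2 + t * s + s ^ 2) / (t ^ 2 + s ^ 2) ^ 2 with hk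
  have e : 2 * (1 + ((t - s) / 2) ^ 2) * t⁻¹ - alp t s / 2 = (2 - (t - s) / 2 * s * k) * t⁻¹ := by
    rw [hk]; unfold alp chi
    field_simp
    ring
  have k0 : 0 ≤ k := by
    rw [hk]
    have : 0 ≤ 2 * t ^ 2 + t * s + s ^ 2 := by nlinarith [sq_nonneg (t + s), sq_nonneg t, sq_nonneg s]
    positivity
  have k5 : k ≤ 5 := by
    rw [hk, div_le_iff₀ (by positivity)]
    have h1 : (t - s) ^ 2 ≤ 2 * (t ^ 2 + s ^ 2) := by nlinarith [sq_nonneg (t + s)]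
    have h2 : 2 * t ^ 2 + t * s + s ^ 2 ≤ 5 / 2 * (t ^ 2 + s ^ 2) := by
      nlinarith [sq_nonneg (t - s), sq_nonneg s]
    calc _ ≤ 2 * (t ^ 2 + s ^ 2) * (5 / 2 * (t ^ 2 + s ^ 2)) := by
          have : 0 ≤ 2 * t ^ 2 + t * s + s ^ 2 := by nlinarith [sq_nonneg (t + s), sq_nonneg t, sq_nonneg s]
          gcongr
      _ = _ := by ring
  rw [e, mul_pow]
  apply mul_le_mul_of_nonneg_right _ (by positivity)
  set u := (t - s) / 2
  have k25 : k ^ 2 ≤ 25 := by nlinarith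
  calc (2 - u * s * k) ^ 2 ≤ (4 + k ^ 2) * (1 + (u * s) ^ 2) := by
        nlinarith [sq_nonneg (2 * (u * s) + k)]
    _ ≤ 29 * (1 + (u * s) ^ 2) := by gcongr; linarith
    _ ≤ _ := by nlinarith [sq_nonneg u, sq_nonneg s]

lemma Acoef {t C : ℝ} (ht : 0 < t) (hC : 1 ≤ C) (s k : ℝ) (hk : |k| ≤ 9 * C ^ 2) :
    (2 * (1 + ((t - s) / 2) ^ 2) * t⁻¹ - alp t s / 2 + k) ^ 2
      ≤ 1400 * C ^ 4 * (1 + ((t - s) / 2) ^ 2) * (1 + s ^ 2) * (t⁻¹) ^ 2 := by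
  have h1 := cu_sq ht s
  have h2 : 1 ≤ 8 * (1 + ((t - s) / 2) ^ 2) * (1 + s ^ 2) * (t⁻¹) ^ 2 := by
    have := mul_le_mul_of_nonneg_right (t_sq_le t s) (sq_nonneg t⁻¹)
    have e : t ^ 2 * t⁻¹ ^ 2 = 1 := by field_simp
    linarith
  have h3 : k ^ 2 ≤ 81 * C ^ 4 := by
    have := sq_le_sq' (by linarith [abs_le.1 hk]) (abs_le.1 hk).2
    nlinarith
  have hC4 : 1 ≤ C ^ 4 := one_le_pow₀ hC
  set Z := (1 + ((t - s) / 2) ^ 2) * (1 + s ^ 2) * (t⁻¹) ^ 2 with hZ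
  have hZ0 : 0 ≤ Z := by positivity
  have h1' : (2 * (1 + ((t - s) / 2) ^ 2) * t⁻¹ - alp t s / 2) ^ 2 ≤ 29 * Z := by rw [hZ]; linarith
  have h2' : 1 ≤ 8 * Z := by rw [hZ]; linarith
  have : 1400 * C ^ 4 * (1 + ((t - s) / 2) ^ 2) * (1 + s ^ 2) * (t⁻¹) ^ 2 = 1400 * C ^ 4 * Z := by
    rw [hZ]; ring
  rw [this]
  have h5 : C ^ 4 ≤ C ^ 4 * (8 * Z) := le_mul_of_one_le_right (by linarith) h2'
  have h6 : Z ≤ C ^ 4 * Z := le_mul_of_one_le_left hZ0 hC4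
  nlinarith [sq_nonneg (2 * (1 + ((t - s) / 2) ^ 2) * t⁻¹ - alp t s / 2 - k)]

lemma termI {W c A e f S ti L C : ℝ} (hf : 0 < f) (hti : 0 < ti) (hL : 0 ≤ L)
    (hA : A ^ 2 ≤ L * f * S * ti ^ 2) (hW : |W| * S ≤ C) :
    W * c * (A * e) ≤ f * e ^ 2 * ti ^ 2 / 2 + L * C * (|W| * c ^ 2) / 2 := by
  set κ := f * ti ^ 2 with hκ
  have hκ0 : 0 < κ := by positivity
  have h1 : W * c * (A * e) ≤ κ * e ^ 2 / 2 + (W * c * A) ^ 2 / κ / 2 := by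
    have : 0 ≤ (κ * e - W * c * A) ^ 2 / κ / 2 := by positivity
    have e1 : (κ * e - W * c * A) ^ 2 / κ / 2 = κ * e ^ 2 / 2 + (W * c * A) ^ 2 / κ / 2 - W * c * (A * e) := by
      field_simp; ring
    linarith
  have h2 : (W * c * A) ^ 2 / κ ≤ L * C * (|W| * c ^ 2) := by
    rw [div_le_iff₀ hκ0]
    have e2 : (W * c * A) ^ 2 = (|W| * c ^ 2) * |W| * A ^ 2 := by
      rw [← sq_abs (W * c * A), abs_mul, abs_mul, mul_pow, mul_pow, sq_abs c, sq_abs A]; ring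
    rw [e2]
    calc |W| * c ^ 2 * |W| * A ^ 2 ≤ |W| * c ^ 2 * |W| * (L * f * S * ti ^ 2) := by gcongr
      _ = (|W| * c ^ 2 * L * κ) * (|W| * S) := by rw [hκ]; ring
      _ ≤ (|W| * c ^ 2 * L * κ) * C := by gcongr
      _ = _ := by ring
  have : κ * e ^ 2 / 2 = f * e ^ 2 * ti ^ 2 / 2 := by rw [hκ]; ring
  linarith

lemma alg_P2 {C W c y p α' : ℝ} (hC : 1 ≤ C) (hp : |p| ≤ C) (hα : |α'| ≤ 3) :
    (2 * C * p - α') * (W * c * y) ≤ |W| * y ^ 2 / 4 + 25 * C ^ 4 * (|W| * c ^ 2) := by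
  have hwcy : |W * c * y| = |W| * (|c| * |y|) := by rw [abs_mul, abs_mul, mul_assoc]
  have h1 : |2 * C * p - α'| ≤ 5 * C ^ 2 := by
    have h2 := abs_le.1 hα
    have h3 : |2 * C * p| ≤ 2 * C * C := by
      rw [abs_mul, abs_of_pos (by linarith : 0 < 2 * C)]
      exact mul_le_mul_of_nonneg_left hp (by linarith)
    have h4 := abs_le.1 h3
    rw [abs_le]; constructor <;> nlinarith
  calc _ ≤ |(2 * C * p - α') * (W * c * y)| := le_abs_self _
    _ = |2 * C * p - α'| * (|W| * (|c| * |y|)) := by rw [abs_mul, hwcy]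
    _ ≤ 5 * C ^ 2 * (|W| * (|c| * |y|)) := by gcongr
    _ = |W| * (5 * C ^ 2 * |c| * |y|) := by ring
    _ ≤ |W| * (y ^ 2 / 4 + 25 * C ^ 4 * c ^ 2) := by
        gcongr
        rw [← sq_abs y, ← sq_abs c]
        nlinarith [sq_nonneg (|y| / 2 - 5 * C ^ 2 * |c|)]
    _ = _ := by ring

lemma alg_P3 {C W s x y a b f g ti Eψ : ℝ} (hC : 1 ≤ C) (hW : |W| * (1 + s ^ 2) ≤ C)
    (hx0 : 0 ≤ x) (hχ1 : x ≤ 1) (hχf : x ≤ 8 * f * ti ^ 2) (hχg : x ≤ 8 * g * ti ^ 2)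
    (hE2 : g * (a + b) ^ 2 + f * (a - b) ^ 2 ≤ Eψ) :
    x * s * W * y * b ≤ |W| * y ^ 2 / 4 + 4 * C * (ti ^ 2 * Eψ) := by
  have hw0 := abs_nonneg W
  have h1 : x * s * W * y * b ≤ |W| * (y ^ 2 / 4) + |W| * (x * s * b) ^ 2 := by
    calc x * s * W * y * b ≤ |x * s * W * y * b| := le_abs_self _
      _ = |W| * |y * (x * s * b)| := by rw [← abs_mul]; congr 1; ring
      _ ≤ |W| * (y ^ 2 / 4 + (x * s * b) ^ 2) := by
        gcongr
        rw [abs_le]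
        constructor <;> nlinarith [sq_nonneg (y / 2 - x * s * b), sq_nonneg (y / 2 + x * s * b)]
      _ = _ := by ring
  have h2 : |W| * (x * s * b) ^ 2 ≤ C * (x * (x * b ^ 2)) := by
    have : |W| * s ^ 2 ≤ C := by linarith
    have e : |W| * (x * s * b) ^ 2 = (|W| * s ^ 2) * (x * (x * b ^ 2)) := by ring
    rw [e]; gcongr
  have h3 : x * (x * b ^ 2) ≤ x * b ^ 2 := by
    have : 0 ≤ x * b ^ 2 := by positivity
    exact mul_le_of_le_one_left this hχ1
  have h4 : x * b ^ 2 ≤ x * (a + b) ^ 2 / 2 + x * (a - b) ^ 2 / 2 := by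
    linarith [mul_nonneg hx0 (sq_nonneg a)]
  have h5 : x * (a + b) ^ 2 ≤ 8 * g * ti ^ 2 * (a + b) ^ 2 := by gcongr
  have h6 : x * (a - b) ^ 2 ≤ 8 * f * ti ^ 2 * (a - b) ^ 2 := by gcongr
  have h7 : x * (x * b ^ 2) ≤ 4 * (ti ^ 2 * Eψ) := by
    have := mul_le_mul_of_nonneg_left hE2 (sq_nonneg ti)
    linarith
  have h8 := mul_le_mul_of_nonneg_left h7 (show 0 ≤ C by linarith)
  linarith

lemma alg_P1 {C W y x Bη : ℝ} (hC : 1 ≤ C) (hx0 : 0 ≤ x) (hχ1 : x ≤ 1) (hBη : 0 ≤ Bη)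
    (hb1 : |W| * y ^ 2 ≤ W * y ^ 2 + C * Bη) :
    -(1 + x) * (W * y ^ 2) - 2 * C * Bη ≤ -(|W| * y ^ 2) := by
  have h1 := mul_le_mul_of_nonneg_left hb1 (show 0 ≤ 1 + x by linarith)
  have h2 : x * (C * Bη) ≤ C * Bη := mul_le_of_le_one_left (by positivity) hχ1
  have h3 : 0 ≤ x * (|W| * y ^ 2) := by positivity
  linarith

lemma alg_P5 {C Λ : ℝ} (hC : 1 ≤ C) (hΛ : 10000 * C ^ 5 ≤ Λ) :
    1400 * C ^ 4 * C + 25 * C ^ 4 ≤ Λ ∧ 4 * C ≤ Λ := by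
  have h4 : C ^ 4 ≤ C ^ 5 := pow_le_pow_right₀ hC (by norm_num)
  have h1 : C ^ 1 ≤ C ^ 5 := pow_le_pow_right₀ hC (by norm_num)
  have h5 : C ^ 5 = C ^ 4 * C := by ring
  have h0 := pow_nonneg (show 0 ≤ C by linarith) 5
  constructor <;> linarith

lemma alg_final {C W t s h p a b c y y1 y2 Bη Bψ Eη Eψ Λ ti f g x α' Av Au : ℝ}
    (htti : t * ti = 1) (hti0 : 0 < ti) (hC : 1 ≤ C) (hp : |p| ≤ C) (hW : |W| * (1 + s ^ 2) ≤ C)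
    (hy : y = t * a + s * b) (hBη : 0 ≤ Bη) (hBψ : 0 ≤ Bψ)
    (hb1 : |W| * y ^ 2 ≤ W * y ^ 2 + C * Bη) (hb2 : |W| * c ^ 2 ≤ W * c ^ 2 + C * Bψ)
    (hE1 : g * (y1 + y2) ^ 2 + f * (y1 - y2) ^ 2 ≤ Eη)
    (hE2 : g * (a + b) ^ 2 + f * (a - b) ^ 2 ≤ Eψ)
    (hΛ : 10000 * C ^ 5 ≤ Λ) (hf0 : 0 < f) (hg0 : 0 < g)
    (hx0 : 0 ≤ x) (hχ1 : x ≤ 1) (hχf : x ≤ 8 * f * ti ^ 2) (hχg : x ≤ 8 * g * ti ^ 2)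
    (hα' : |α'| ≤ 3)
    (hAv : Av = 2 * g * ti - t * x / 2 + (C * h + 8 * C ^ 2))
    (hAu : Au = 2 * f * ti - t * x / 2 + (-(C * h) + 8 * C ^ 2))
    (hAu2 : Au ^ 2 ≤ 1400 * C ^ 4 * f * (1 + s ^ 2) * ti ^ 2)
    (hAv2 : Av ^ 2 ≤ 1400 * C ^ 4 * g * (1 + s ^ 2) * ti ^ 2) :
    ((ti * (- t * W * y ^ 2 + 2 * (W * c) * (g * (y1 + y2) + f * (y1 - y2))) - ti ^ 2 * Eη)
    + 2 * C * ((W * c * (h * y2 + p * y) - Bη) + 2 * C * (4 * (W * c) * y1)))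
    - (α' * W * c * y + t * x * W * a * y + t * x * W * c * y1)
    + Λ * ((ti * (- t * W * c ^ 2) - ti ^ 2 * Eψ) - 2 * C * Bψ) ≤ 0 := by
  have hL : 0 ≤ 1400 * C ^ 4 := by positivity
  have I1 := termI (c := c) (e := y1 - y2) hf0 hti0 hL hAu2 hW
  have I2 := termI (c := c) (e := y1 + y2) hg0 hti0 hL hAv2 hW
  have hid : ((ti * (- t * W * y ^ 2 + 2 * (W * c) * (g * (y1 + y2) + f * (y1 - y2))) - ti ^ 2 * Eη)
    + 2 * C * ((W * c * (h * y2 + p * y) - Bη) + 2 * C * (4 * (W * c) * y1)))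
    - (α' * W * c * y + t * x * W * a * y + t * x * W * c * y1)
    + Λ * ((ti * (- t * W * c ^ 2) - ti ^ 2 * Eψ) - 2 * C * Bψ)
    = (-(1 + x) * (W * y ^ 2) - 2 * C * Bη) - ti ^ 2 * Eη + W * c * (Av * (y1 + y2)) + W * c * (Au * (y1 - y2))
      + (2 * C * p - α') * (W * c * y) + x * s * W * y * b
      + Λ * (-(W * c ^ 2) - ti ^ 2 * Eψ - 2 * C * Bψ) := by
    rw [hAv, hAu, hy]
    linear_combination (-(W * (t * a + s * b) ^ 2) - Λ * W * c ^ 2) * htti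
  rw [hid]
  clear hid hAv hAu hAu2 hAv2
  have P1 := alg_P1 hC hx0 hχ1 hBη hb1
  have P2 := alg_P2 (W := W) (c := c) (y := y) hC hp hα'
  have P3 := alg_P3 (y := y) hC hW hx0 hχ1 hχf hχg hE2
  have hE1' := mul_le_mul_of_nonneg_left hE1 (sq_nonneg ti)
  have hΛ0 : 0 ≤ Λ := le_trans (by positivity) hΛ
  have hEψ0 : 0 ≤ Eψ := le_trans (by positivity) hE2
  have P4 : Λ * (-(W * c ^ 2) - ti ^ 2 * Eψ - 2 * C * Bψ) ≤ - (Λ * (|W| * c ^ 2)) - Λ * (ti ^ 2 * Eψ) := by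
    have : -(W * c ^ 2) - ti ^ 2 * Eψ - 2 * C * Bψ ≤ -(|W| * c ^ 2) - ti ^ 2 * Eψ := by
      have : 0 ≤ C * Bψ := by positivity
      linarith
    have := mul_le_mul_of_nonneg_left this hΛ0
    linarith
  have P5 := mul_le_mul_of_nonneg_right (alg_P5 hC hΛ).1 (show 0 ≤ |W| * c ^ 2 by positivity)
  have P6 := mul_le_mul_of_nonneg_right (alg_P5 hC hΛ).2 (show 0 ≤ ti ^ 2 * Eψ by positivity)
  have P7 : 0 ≤ |W| * y ^ 2 := by positivity
  have P8 : 0 ≤ ti ^ 2 * (g * (y1 + y2) ^ 2 + f * (y1 - y2) ^ 2) := by positivity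
  linarith

lemma prop2_alg {C t s W h p a b c y1 y2 Bη Bψ Eη Eψ Λ : ℝ} (ht : 0 < t) (hC : 1 ≤ C)
    (hh : |h| ≤ C) (hp : |p| ≤ C) (hW : |W| * (1 + s ^ 2) ≤ C)
    (y : ℝ) (hy : y = t * a + s * b) (hBη : 0 ≤ Bη) (hBψ : 0 ≤ Bψ)
    (hb1 : |W| * y ^ 2 ≤ W * y ^ 2 + C * Bη) (hb2 : |W| * c ^ 2 ≤ W * c ^ 2 + C * Bψ)
    (hE1 : (1 + ((t + s) / 2) ^ 2) * (y1 + y2) ^ 2 + (1 + ((t - s) / 2) ^ 2) * (y1 - y2) ^ 2 ≤ Eη)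
    (hE2 : (1 + ((t + s) / 2) ^ 2) * (a + b) ^ 2 + (1 + ((t - s) / 2) ^ 2) * (a - b) ^ 2 ≤ Eψ)
    (hΛ : 10000 * C ^ 5 ≤ Λ) :
    ((t⁻¹ * (- t * W * y ^ 2 + 2 * (W * c) * ((1 + ((t + s) / 2) ^ 2) * (y1 + y2)
      + (1 + ((t - s) / 2) ^ 2) * (y1 - y2))) - (t ^ 2)⁻¹ * Eη)
    + 2 * C * ((W * c * (h * y2 + p * y) - Bη) + 2 * C * (4 * (W * c) * y1)))
    - (alp' t s * W * c * y + alp t s * W * a * y + alp t s * W * c * y1)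
    + Λ * ((t⁻¹ * (- t * W * c ^ 2) - (t ^ 2)⁻¹ * Eψ) - 2 * C * Bψ) ≤ 0 := by
  have hCh : |C * h| ≤ C * C := by
    rw [abs_mul, abs_of_pos (by linarith : 0 < C)]
    exact mul_le_mul_of_nonneg_left hh (by linarith)
  have hCh' := abs_le.1 hCh
  have hC2 : 0 ≤ C * C := by positivity
  have ht2 : (t ^ 2)⁻¹ = t⁻¹ ^ 2 := by rw [inv_pow]
  have hχg := chi_sq_f ht (-s)
  rw [chi_neg, sub_neg_eq_add] at hχg
  have hAv2 := Acoef ht hC (-s) (C * h + 8 * C ^ 2) (by rw [abs_le]; constructor <;> linarith)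
  rw [alp_neg, sub_neg_eq_add, neg_sq] at hAv2
  rw [ht2]
  exact alg_final (x := chi t s ^ 2) (mul_inv_cancel₀ ht.ne') (inv_pos.2 ht) hC hp hW hy hBη hBψ hb1 hb2 hE1 hE2 hΛ
    (by positivity) (by positivity) (sq_nonneg _) (chi_abs ht s) (chi_sq_f ht s) hχg (alp'_abs ht s)
    rfl rfl
    (Acoef ht hC s (-(C * h) + 8 * C ^ 2) (by rw [abs_le]; constructor <;> linarith)) hAv2

section
variable {B : Bg} {ψ F : ℝ → ℝ → ℝ}

lemma sol_svf (h : Sol B ψ (fun _ _ => 0)) : Sol B (Svf ψ) (fun t s => B.W s * ψ t s) where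
  sm := h.sm.svf
  eq := by
    intro t s
    have hs := h.sm
    have cm := hs.comm
    have cmt := hs.dt.comm
    have cms := hs.ds.comm
    have eq1 : pd_t (pd_t ψ) = fun t s => pd_s (pd_s ψ) t s - B.V s * ψ t s := by
      ext t s; simpa using h.eq t s
    have et : pd_t (Svf ψ) = fun t s => (1 * pd_t ψ t s + t * pd_t (pd_t ψ) t s)
        + s * pd_t (pd_s ψ) t s := by
      ext t s
      exact (((hasDerivAt_id t).mul (hs.dt.t t s)).add ((hs.ds.t t s).const_mul s)).deriv
    have es : pd_s (Svf ψ) = fun t s => t * pd_s (pd_t ψ) t s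
        + (1 * pd_s ψ t s + s * pd_s (pd_s ψ) t s) := by
      ext t s
      exact (((hs.dt.s t s).const_mul t).add ((hasDerivAt_id s).mul (hs.ds.s t s))).deriv
    have ett : pd_t (pd_t (Svf ψ)) t s = (1 * pd_t (pd_t ψ) t s
        + (1 * pd_t (pd_t ψ) t s + t * pd_t (pd_t (pd_t ψ)) t s))
        + s * pd_t (pd_t (pd_s ψ)) t s := by
      rw [et]
      exact ((((hs.dt.t t s).const_mul 1).add ((hasDerivAt_id t).mul (hs.dt.dt.t t s))).add
        ((hs.ds.dt.t t s).const_mul s)).deriv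
    have ess : pd_s (pd_s (Svf ψ)) t s = t * pd_s (pd_s (pd_t ψ)) t s
        + (1 * pd_s (pd_s ψ) t s + (1 * pd_s (pd_s ψ) t s + s * pd_s (pd_s (pd_s ψ)) t s)) := by
      rw [es]
      exact (((hs.dt.ds.s t s).const_mul t).add (((hs.ds.s t s).const_mul 1).add
        ((hasDerivAt_id s).mul (hs.ds.ds.s t s)))).deriv
    have e3 : pd_t (pd_t (pd_t ψ)) t s = pd_t (pd_s (pd_s ψ)) t s - B.V s * pd_t ψ t s := by
      rw [eq1]
      exact ((hs.ds.ds.t t s).sub ((hs.t t s).const_mul (B.V s))).deriv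
    have e4 : pd_s (pd_t (pd_t ψ)) t s = pd_s (pd_s (pd_s ψ)) t s
        - (B.V' s * ψ t s + B.V s * pd_s ψ t s) := by
      rw [eq1]
      exact ((hs.ds.ds.s t s).sub ((B.dV s).mul (hs.s t s))).deriv
    have e5 : pd_t (pd_s (pd_s ψ)) t s = pd_s (pd_s (pd_t ψ)) t s := by rw [cms, cm]
    have e6 : pd_t (pd_t (pd_s ψ)) t s = pd_s (pd_t (pd_t ψ)) t s := by rw [cm, cmt]
    rw [ett, ess, e3, e5, e6, e4, eq1, B.W_eq, Svf]
    ring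

lemma cur_corr {η : ℝ → ℝ → ℝ} (hψ : Sm ψ) (hη : Sm η) :
    Cur (fun t s => -(alp t s * B.W s * ψ t s * η t s)) (fun _ _ => 0)
      (fun t s => -(alp' t s * B.W s * ψ t s * η t s + alp t s * B.W s * pd_t ψ t s * η t s
        + alp t s * B.W s * ψ t s * pd_t η t s)) := by
  have hW : Sp (fun _ s => B.W s) := (Sm.ofs B.smW).sp
  have s1 := ((sp_alp.mul hW).mul hψ.sp).mul hη.sp
  have hm : Sp (fun _ _ => (-1:ℝ)) := Sm.sp (show Sm (fun _ _ => (-1:ℝ)) from contDiff_const)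
  have h0 : Sp (fun _ _ => (0:ℝ)) := Sm.sp (show Sm (fun _ _ => (0:ℝ)) from contDiff_const)
  have s2 := hm.mul s1
  refine cur_of ?_ h0 _ _
    (fun t s ht => by
      exact (((((alp_deriv ht s).mul_const (B.W s)).mul (hψ.t t s)).mul (hη.t t s)).neg))
    (fun t s _ => hasDerivAt_const s (0:ℝ)) ?_
  · have e : (fun t s => -(alp t s * B.W s * ψ t s * η t s))
      = fun t s => (-1:ℝ) * (alp t s * B.W s * ψ t s * η t s) := by ext t s; ring
    rw [e]; exact s2
  · intro t s _
    simp only [Pi.mul_apply]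
    ring

def ee (s : ℝ) : ℝ := ((1 + s ^ 2) ^ 2)⁻¹

lemma ee_deriv (s : ℝ) : HasDerivAt ee (-(4 * s) * ((1 + s ^ 2) ^ 3)⁻¹) s := by
  have hN : (1 + s ^ 2) ^ 2 ≠ 0 := by positivity
  have hd := ((((hasDerivAt_id s).pow 2).const_add 1).pow 2).inv (by simpa using hN)
  refine hd.congr_deriv ?_
  simp
  field_simp
  norm_num
  ring

lemma hardy_pt (B : Bg) (s x b : ℝ) : |B.W s| * x ^ 2 ≤ 6 * B.C ^ 2 * (B.V s * x ^ 2 + (1 + s ^ 2)⁻¹ * b ^ 2)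
    + B.C * (-(4 * s) * ((1 + s ^ 2) ^ 3)⁻¹ * x ^ 2 + ee s * (2 * x * b)) := by
  have hC := B.C1
  have hV := B.Vpos s
  have hC2 : B.C ≤ B.C ^ 2 := by nlinarith
  have hw0 := abs_nonneg (B.W s)
  set k := (1 + s ^ 2)⁻¹ with hk
  have hk0 : 0 < k := by positivity
  have hk1 : k ≤ 1 := inv_le_one_of_one_le₀ (by nlinarith [sq_nonneg s])
  have hkk : k * (1 + s ^ 2) = 1 := inv_mul_cancel₀ (by positivity)
  have e3 : ((1 + s ^ 2) ^ 3)⁻¹ = k ^ 3 := by rw [hk, inv_pow]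
  have e2 : ee s = k ^ 2 := by rw [ee, hk, inv_pow]
  rw [e3, e2]
  have hVx : 0 ≤ B.V s * x ^ 2 := by positivity
  have hbk : 0 ≤ k * b ^ 2 := by positivity
  have hCk : B.C * (k * b ^ 2) ≤ B.C ^ 2 * (k * b ^ 2) := mul_le_mul_of_nonneg_right hC2 hbk
  have hCV : B.C * (B.V s * x ^ 2) ≤ B.C ^ 2 * (B.V s * x ^ 2) := mul_le_mul_of_nonneg_right hC2 hVx
  have hC2k : 0 ≤ B.C ^ 2 * (k * b ^ 2) := by positivity
  have hC2V : 0 ≤ B.C ^ 2 * (B.V s * x ^ 2) := by positivity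
  rcases le_total (-1) s with h1 | h1
  · have w3 := mul_le_mul_of_nonneg_right (B.W3 s h1) (sq_nonneg x)
    have w4 : k ^ 2 ≤ B.C * B.V s := by
      have := mul_le_mul_of_nonneg_right (B.W4 s h1) (sq_nonneg k)
      have e : B.C * B.V s * (1 + s ^ 2) ^ 2 * k ^ 2 = B.C * B.V s * (k * (1 + s ^ 2)) ^ 2 := by ring
      rw [e, hkk] at this; linarith
    have hsk : |s| * k ≤ 1 := by
      have : |s| ≤ 1 + s ^ 2 := by rw [← sq_abs s]; nlinarith [sq_nonneg (|s| - 1)]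
      calc |s| * k ≤ (1 + s ^ 2) * k := by gcongr
        _ = 1 := by linarith
    have h5 : -(4 * s) * k ^ 3 * x ^ 2 ≥ -(4 * (k ^ 2 * x ^ 2)) := by
      have : s * k ≤ 1 := le_trans (mul_le_mul_of_nonneg_right (le_abs_self s) hk0.le) hsk
      have h6 : 0 ≤ k ^ 2 * x ^ 2 := by positivity
      have := mul_le_mul_of_nonneg_right this h6
      nlinarith
    have h6 : k ^ 2 * (2 * x * b) ≥ -(k ^ 2 * x ^ 2) - k * b ^ 2 := by
      have h7 : k ^ 2 * b ^ 2 ≤ k * b ^ 2 := by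
        have : k ^ 2 ≤ k := by nlinarith
        gcongr
      have := mul_nonneg (sq_nonneg k) (sq_nonneg (x + b))
      nlinarith
    have h8 : k ^ 2 * x ^ 2 ≤ B.C * (B.V s * x ^ 2) := by
      have := mul_le_mul_of_nonneg_right w4 (sq_nonneg x); linarith
    have h9 : -(5 * (B.C * (B.V s * x ^ 2))) - k * b ^ 2 ≤ -(4 * s) * k ^ 3 * x ^ 2 + k ^ 2 * (2 * x * b) := by
      linarith
    have := mul_le_mul_of_nonneg_left h9 (show 0 ≤ B.C by linarith)
    nlinarith
  · have w5 : |B.W s| ≤ B.C * (|s| * k ^ 3) := by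
      have := mul_le_mul_of_nonneg_right (B.W5 s h1) (show 0 ≤ k ^ 3 by positivity)
      have e : |B.W s| * (1 + s ^ 2) ^ 3 * k ^ 3 = |B.W s| * (k * (1 + s ^ 2)) ^ 3 := by ring
      rw [e, hkk] at this; linarith
    have w6 := mul_le_mul_of_nonneg_right w5 (sq_nonneg x)
    rw [abs_of_nonpos (by linarith : s ≤ 0)] at w6
    have h6 : k ^ 2 * (2 * x * b) ≥ -(-s * k ^ 3 * x ^ 2) - k * b ^ 2 := by
      -- (−s) k³ x² + 2 k² x b + k b² ≥ k³x² + 2k²xb + k b² = k (k x + b)²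
      have h7 : k ^ 3 * x ^ 2 ≤ -s * k ^ 3 * x ^ 2 := by
        have : 0 ≤ k ^ 3 * x ^ 2 := by positivity
        nlinarith
      have := mul_nonneg hk0.le (sq_nonneg (k * x + b))
      nlinarith
    have h8 : 0 ≤ -s * k ^ 3 * x ^ 2 := by
      have : 0 ≤ -s := by linarith
      positivity
    have h9 : 3 * (-s * k ^ 3 * x ^ 2) - k * b ^ 2 ≤ -(4 * s) * k ^ 3 * x ^ 2 + k ^ 2 * (2 * x * b) := by
      linarith
    have := mul_le_mul_of_nonneg_left h9 (show 0 ≤ B.C by linarith)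
    have h10 := mul_nonneg (show 0 ≤ B.C by linarith) h8
    linarith

lemma n_ctrl {t : ℝ} (ht : 0 < t) (s : ℝ) :
    t * (B.V s * ψ t s ^ 2 + (1 + s ^ 2)⁻¹ * pd_s ψ t s ^ 2) ≤ 4 * nD B ψ t s := by
  have h1 := nD_ge (B := B) (ψ := ψ) ht s
  have h2 := e0_nonneg (B := B) (ψ := ψ) t s
  have hV := B.Vpos s
  suffices h : t * (B.V s * ψ t s ^ 2 + (1 + s ^ 2)⁻¹ * pd_s ψ t s ^ 2) ≤ 4 * (t⁻¹ * eK B ψ t s) by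
    linarith
  have e : t * (B.V s * ψ t s ^ 2 + (1 + s ^ 2)⁻¹ * pd_s ψ t s ^ 2)
    = t⁻¹ * (t ^ 2 * (B.V s * ψ t s ^ 2) + t ^ 2 * (1 + s ^ 2)⁻¹ * pd_s ψ t s ^ 2) := by
    field_simp
  rw [e]
  have hf : t ^ 2 * (1 + s ^ 2)⁻¹ ≤ 8 * (1 + ((t - s) / 2) ^ 2) := by
    rw [← div_eq_mul_inv, div_le_iff₀ (by positivity)]; exact t_sq_le t s
  have hg : t ^ 2 * (1 + s ^ 2)⁻¹ ≤ 8 * (1 + ((t + s) / 2) ^ 2) := by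
    rw [← div_eq_mul_inv, div_le_iff₀ (by positivity)]
    simpa [sub_neg_eq_add] using t_sq_le t (-s)
  have e' : 4 * (t⁻¹ * eK B ψ t s) = t⁻¹ * (4 * eK B ψ t s) := by ring
  rw [e']
  apply mul_le_mul_of_nonneg_left _ (inv_nonneg.2 ht.le)
  unfold eK
  set k := t ^ 2 * (1 + s ^ 2)⁻¹
  have hk : 0 ≤ k := by positivity
  set a := pd_t ψ t s
  set b := pd_s ψ t s
  have h5 := mul_le_mul_of_nonneg_right hf (sq_nonneg (a - b))
  have h6 := mul_le_mul_of_nonneg_right hg (sq_nonneg (a + b))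
  have h7 := mul_nonneg hk (sq_nonneg a)
  have h8 : 0 ≤ B.V s * ψ t s ^ 2 := by positivity
  have h9 := mul_nonneg (sq_nonneg s) h8
  nlinarith

def rho2 (B : Bg) (ψ : ℝ → ℝ → ℝ) (t s : ℝ) : ℝ :=
  nD B (Svf ψ) t s + -(alp t s * B.W s * ψ t s * Svf ψ t s) + 10000 * B.C ^ 5 * nD B ψ t s

def kap2 (B : Bg) (ψ : ℝ → ℝ → ℝ) (t s : ℝ) : ℝ :=
  nK B (Svf ψ) t s + 0 + 10000 * B.C ^ 5 * nK B ψ t s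

lemma cur_2 (h : Sol B ψ (fun _ _ => 0)) : ∃ b, Cur (rho2 B ψ) (kap2 B ψ) b ∧
    ∀ t s, 0 < t → b t s ≤ 0 := by
  refine ⟨_, ((cur_n (sol_svf h)).add (cur_corr (B := B) h.sm h.sm.svf)).add
    ((cur_n h).smul (10000 * B.C ^ 5)), ?_⟩
  intro t s ht
  have hc := prop2_alg (C := B.C) (t := t) (s := s) (W := B.W s) (h := B.h s) (p := B.p s)
    (a := pd_t ψ t s) (b := pd_s ψ t s) (c := ψ t s) (y1 := pd_t (Svf ψ) t s) (y2 := pd_s (Svf ψ) t s)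
    (Eη := eK B (Svf ψ) t s) (Eψ := eK B ψ t s) (Λ := 10000 * B.C ^ 5) ht B.C1 (B.h_le s) (B.p_le2 s)
    (B.W1 s) (Svf ψ t s) rfl (B.bulk0 s (pd_t (Svf ψ) t s) (pd_s (Svf ψ) t s) (Svf ψ t s))
    (B.bulk0 s (pd_t ψ t s) (pd_s ψ t s) (ψ t s))
    (B.bulk s _ _ _) (B.bulk s _ _ _)
    (by
      have := B.Vpos s
      unfold eK
      have : 0 ≤ (2 + (t ^ 2 + s ^ 2) / 2) * B.V s * Svf ψ t s ^ 2 := by positivity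
      linarith)
    (by
      have := B.Vpos s
      unfold eK
      have : 0 ≤ (2 + (t ^ 2 + s ^ 2) / 2) * B.V s * ψ t s ^ 2 := by positivity
      linarith) le_rfl
  unfold Bg.Bulk
  refine le_trans (le_of_eq ?_) hc
  ring

lemma corr_le {t : ℝ} (ht : 0 < t) (s c y : ℝ) {ε : ℝ} (hε : 0 < ε) :
    |alp t s * B.W s * c * y| ≤ ε * (t * (|B.W s| * y ^ 2)) + (4 * ε)⁻¹ * (t * (|B.W s| * c ^ 2)) := by
  have h1 := alp_abs ht s
  have e : |alp t s * B.W s * c * y| = |alp t s| * (|B.W s| * |c * y|) := by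
    simp only [abs_mul]; ring
  rw [e]
  have h2 : |c * y| ≤ ε * y ^ 2 + (4 * ε)⁻¹ * c ^ 2 := by
    have h3 : (4 * ε)⁻¹ * (2 * ε * |y| - |c|) ^ 2 = ε * y ^ 2 + (4 * ε)⁻¹ * c ^ 2 - |c * y| := by
      rw [abs_mul, ← sq_abs y, ← sq_abs c]; field_simp; ring
    have : 0 ≤ (4 * ε)⁻¹ * (2 * ε * |y| - |c|) ^ 2 := by positivity
    linarith
  calc |alp t s| * (|B.W s| * |c * y|) ≤ t * (|B.W s| * (ε * y ^ 2 + (4 * ε)⁻¹ * c ^ 2)) := by gcongr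
    _ = _ := by ring

lemma rho2_lower {t : ℝ} (ht : 0 < t) (s : ℝ) :
    nD B (Svf ψ) t s / 2 - t * ((-(4 * s) * ((1 + s ^ 2) ^ 3)⁻¹ * Svf ψ t s ^ 2
      + ee s * (2 * Svf ψ t s * pd_s (Svf ψ) t s)) * (48 * B.C)⁻¹
      + (-(4 * s) * ((1 + s ^ 2) ^ 3)⁻¹ * ψ t s ^ 2
      + ee s * (2 * ψ t s * pd_s ψ t s)) * (12 * B.C ^ 3)) ≤ rho2 B ψ t s := by
  have hC := B.C1
  have hC0 : 0 < B.C := by linarith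
  have hε : 0 < (48 * B.C ^ 2)⁻¹ := by positivity
  have c1 := (abs_le.1 (corr_le (B := B) ht s (ψ t s) (Svf ψ t s) hε)).2
  have H1 := mul_le_mul_of_nonneg_left (hardy_pt B s (Svf ψ t s) (pd_s (Svf ψ) t s)) ht.le
  have H2 := mul_le_mul_of_nonneg_left (hardy_pt B s (ψ t s) (pd_s ψ t s)) ht.le
  have n1 := n_ctrl (B := B) (ψ := Svf ψ) ht s
  have n2 := n_ctrl (B := B) (ψ := ψ) ht s
  have n0 := nD_nonneg (B := B) (ψ := ψ) ht s
  unfold rho2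
  generalize -(4 * s) * ((1 + s ^ 2) ^ 3)⁻¹ * Svf ψ t s ^ 2
      + ee s * (2 * Svf ψ t s * pd_s (Svf ψ) t s) = D1 at *
  generalize -(4 * s) * ((1 + s ^ 2) ^ 3)⁻¹ * ψ t s ^ 2
      + ee s * (2 * ψ t s * pd_s ψ t s) = D2 at *
  generalize B.V s * Svf ψ t s ^ 2 + (1 + s ^ 2)⁻¹ * pd_s (Svf ψ) t s ^ 2 = G1 at *
  generalize B.V s * ψ t s ^ 2 + (1 + s ^ 2)⁻¹ * pd_s ψ t s ^ 2 = G2 at *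
  generalize |B.W s| * Svf ψ t s ^ 2 = w1 at *
  generalize |B.W s| * ψ t s ^ 2 = w2 at *
  generalize nD B (Svf ψ) t s = N1 at *
  generalize nD B ψ t s = N2 at *
  generalize alp t s * B.W s * ψ t s * Svf ψ t s = Z at *
  generalize B.C = C at *
  have e1 : (4 * (48 * C ^ 2)⁻¹)⁻¹ = 12 * C ^ 2 := by field_simp; norm_num
  rw [e1] at c1
  have H1' := mul_le_mul_of_nonneg_left H1 hε.le
  have H2' := mul_le_mul_of_nonneg_left H2 (show 0 ≤ 12 * C ^ 2 by positivity)
  have e2 : (48 * C ^ 2)⁻¹ * (t * (6 * C ^ 2 * G1 + C * D1)) = (t * G1) / 8 + t * (D1 * (48 * C)⁻¹) := by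
    field_simp; ring
  have e3 : 12 * C ^ 2 * (t * (6 * C ^ 2 * G2 + C * D2)) = 72 * C ^ 4 * (t * G2) + t * (D2 * (12 * C ^ 3)) := by
    ring
  rw [e2] at H1'
  rw [e3] at H2'
  have n2' := mul_le_mul_of_nonneg_left n2 (show 0 ≤ 72 * C ^ 4 by positivity)
  have h45 : C ^ 4 ≤ C ^ 5 := pow_le_pow_right₀ hC (by norm_num)
  have h6 : C ^ 4 * N2 ≤ C ^ 5 * N2 := mul_le_mul_of_nonneg_right h45 n0
  have h7 : 0 ≤ C ^ 5 * N2 := by positivity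
  linarith

lemma rho2_one (s : ℝ) : rho2 B ψ 1 s ≤ 100000 * B.C ^ 7 * (eK B (Svf ψ) 1 s + eK B ψ 1 s) := by
  have hC := B.C1
  have hV := B.Vpos s
  have c1 := (abs_le.1 (corr_le (B := B) one_pos s (ψ 1 s) (Svf ψ 1 s) (ε := 1/2) (by norm_num))).1
  have n1 := nD_one_le (B := B) (ψ := Svf ψ) s
  have n2 := nD_one_le (B := B) (ψ := ψ) s
  have w : ∀ x : ℝ, |B.W s| * x ^ 2 ≤ 2 * B.C * ((2 + (1 ^ 2 + s ^ 2) / 2) * B.V s * x ^ 2) := by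
    intro x
    have h1 := mul_le_mul_of_nonneg_right (B.W2 s) (sq_nonneg x)
    have h2 : B.C * (1 + |s|) * B.V s * x ^ 2 ≤ B.C * (2 * (2 + (1 ^ 2 + s ^ 2) / 2)) * B.V s * x ^ 2 := by
      gcongr
      nlinarith [sq_abs s, sq_nonneg (|s| - 1)]
    linarith
  have k : ∀ ξ : ℝ → ℝ → ℝ, |B.W s| * ξ 1 s ^ 2 ≤ 2 * B.C * eK B ξ 1 s := by
    intro ξ
    refine (w (ξ 1 s)).trans ?_
    apply mul_le_mul_of_nonneg_left _ (by linarith)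
    unfold eK
    have : 0 ≤ (1 + ((1 + s) / 2) ^ 2) * (pd_t ξ 1 s + pd_s ξ 1 s) ^ 2
      + (1 + ((1 - s) / 2) ^ 2) * (pd_t ξ 1 s - pd_s ξ 1 s) ^ 2 := by positivity
    linarith
  have k1 := k ψ
  have k2 := k (Svf ψ)
  have p1 := eK_nonneg (B := B) (ψ := ψ) 1 s
  have p2 := eK_nonneg (B := B) (ψ := Svf ψ) 1 s
  unfold rho2
  norm_num at c1
  generalize alp 1 s * B.W s * ψ 1 s * Svf ψ 1 s = Z at *
  generalize eK B ψ 1 s = E1 at *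
  generalize eK B (Svf ψ) 1 s = E2 at *
  generalize nD B ψ 1 s = N1 at *
  generalize nD B (Svf ψ) 1 s = N2 at *
  generalize B.C = C at *
  have a1 : C ^ 2 ≤ C ^ 7 := pow_le_pow_right₀ hC (by norm_num)
  have a2 : C ^ 1 ≤ C ^ 7 := pow_le_pow_right₀ hC (by norm_num)
  have b1 := mul_le_mul_of_nonneg_right a1 p1
  have b2 := mul_le_mul_of_nonneg_right a1 p2
  have b3 := mul_le_mul_of_nonneg_right a2 p1
  have b4 := mul_le_mul_of_nonneg_right a2 p2
  have b5 := mul_le_mul_of_nonneg_left n2 (show 0 ≤ 10000 * C ^ 5 by positivity)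
  have e5 : 10000 * C ^ 5 * (7 * C ^ 2 * E1) = 70000 * (C ^ 7 * E1) := by ring
  rw [e5] at b5
  have q1 : 0 ≤ C ^ 7 * E1 := by positivity
  have q2 : 0 ≤ C ^ 7 * E2 := by positivity
  rw [pow_one] at b3 b4
  linarith

lemma flux2 {t s T : ℝ} (ht : 1 ≤ t) (htT : t ≤ T) (hs : s ≤ -(2 * B.C * T ^ 2)) :
    0 ≤ rho2 B ψ t s + kap2 B ψ t s := by
  have hC := B.C1
  have hV := B.Vpos s
  have ht0 : 0 < t := by linarith
  have f1 := flux_n (B := B) (ψ := ψ) ht0 s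
  have f2 := flux_n (B := B) (ψ := Svf ψ) ht0 s
  have c1 := (abs_le.1 (corr_le (B := B) ht0 s (ψ t s) (Svf ψ t s) (ε := 1/2) (by norm_num))).2
  have key : t * |B.W s| ≤ 2 * t⁻¹ * (1 + ((t - s) / 2) ^ 2) * B.V s := by
    have h1 := mul_le_mul_of_nonneg_left (B.W2 s) ht0.le
    have hsneg : s ≤ -2 := by nlinarith
    have hss : 2 * B.C * t ^ 2 ≤ -s := by
      have : t ^ 2 ≤ T ^ 2 := by gcongr
      nlinarith
    have h2 : B.C * t ^ 2 * (1 + |s|) ≤ 2 * (1 + ((t - s) / 2) ^ 2) := by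
      rw [abs_of_neg (by linarith)]
      have h3 : B.C * t ^ 2 * (1 + -s) ≤ -s / 2 * (1 + -s) := by
        apply mul_le_mul_of_nonneg_right _ (by linarith)
        linarith
      nlinarith
    have h4 : t * (B.C * (1 + |s|) * B.V s) = t⁻¹ * (B.C * t ^ 2 * (1 + |s|)) * B.V s := by
      field_simp
    have h5 : t⁻¹ * (B.C * t ^ 2 * (1 + |s|)) * B.V s ≤ t⁻¹ * (2 * (1 + ((t - s) / 2) ^ 2)) * B.V s := by
      gcongr
    linarith
  have k1 := mul_le_mul_of_nonneg_right key (sq_nonneg (ψ t s))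
  have k2 := mul_le_mul_of_nonneg_right key (sq_nonneg (Svf ψ t s))
  have hC5 : 1 ≤ 10000 * B.C ^ 5 := by
    have := one_le_pow₀ (n := 5) hC; linarith
  have f1' : nD B ψ t s + nK B ψ t s ≤ 10000 * B.C ^ 5 * (nD B ψ t s + nK B ψ t s) := by
    apply le_mul_of_one_le_left _ hC5
    exact le_trans (by positivity) f1
  unfold rho2 kap2
  have p1 : 0 ≤ t * |B.W s| * ψ t s ^ 2 := by positivity
  have p2 : 0 ≤ t * |B.W s| * Svf ψ t s ^ 2 := by positivity
  norm_num at c1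
  linarith

lemma rho2_intble (h : Sol B ψ (fun _ _ => 0)) {t : ℝ} (ht : 0 < t) (a b : ℝ) :
    IntervalIntegrable (rho2 B ψ t) volume a b := by
  obtain ⟨_, hc, _⟩ := cur_2 h
  apply ContinuousOn.intervalIntegrable
  intro s _
  exact ((hc.spρ.cont (t, s) ht).continuousAt
    ((isOpen_lt continuous_const continuous_fst).mem_nhds ht)).comp
      (f := fun s => (t, s)) (by fun_prop) |>.continuousWithinAt

lemma Sm.cont_right {f : ℝ → ℝ → ℝ} (h : Sm f) (t : ℝ) : Continuous (f t) :=
  ContDiff.continuous h |>.comp (f := fun s => (t, s)) (by fun_prop)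

lemma ee_cont : Continuous ee := by
  unfold ee
  exact Continuous.inv₀ (by fun_prop) (fun s => by positivity)

/-- Proposition 2 -/
lemma prop2 (h : Sol B ψ (fun _ _ => 0)) (hsupp : Supp ψ) {I : ℝ}
    (hI : ∀ a b, a ≤ b → ∫ s in a..b, (eK B (Svf ψ) 1 s + eK B ψ 1 s) ≤ I)
    {t a b : ℝ} (ht : 1 ≤ t) (hab : a ≤ b) :
    ∫ s in a..b, nD B (Svf ψ) t s ≤ 200000 * B.C ^ 7 * I := by
  obtain ⟨S1, hS1⟩ := hsupp.joint
  obtain ⟨S2, hS2⟩ := hsupp.svf.joint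
  have hC := B.C1
  have ht0 : 0 < t := by linarith
  set a₁ := min a (-(2 * B.C * t ^ 2)) with ha₁
  have ha1 : a₁ ≤ a := min_le_left _ _
  have ha2 : a₁ ≤ -(2 * B.C * t ^ 2) := min_le_right _ _
  set a' := a₁ - t with ha'
  obtain ⟨X, hX1, hX2, hX3⟩ : ∃ X, b - a₁ ≤ X ∧ S1 - 1 - a' ≤ X ∧ S2 - 1 - a' ≤ X :=
    ⟨max (b - a₁) (max (S1 - 1 - a') (S2 - 1 - a')), le_max_left _ _,
      le_trans (le_max_left _ _) (le_max_right _ _), le_trans (le_max_right _ _) (le_max_right _ _)⟩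
  have hX : 0 ≤ X := by linarith
  obtain ⟨bb, hc, hb⟩ := cur_2 h
  have key := energy_mono (a := a') (X := X) (T := t) hc.spρ hc.spK ht hX
    (by
      intro τ s h1 _
      have hτ : 0 < τ := by linarith
      rw [hc.eq τ s hτ]
      linarith [hb τ s hτ])
    (by
      intro τ h1 h2
      exact flux2 (T := t) h1 h2 (by linarith))
    (by
      intro τ h1 _
      obtain ⟨h2, h3, h4⟩ := hS1 τ (a' + τ + X) (by rw [abs_of_nonneg (by linarith)]; linarith)
      obtain ⟨h5, h6, h7⟩ := hS2 τ (a' + τ + X) (by rw [abs_of_nonneg (by linarith)]; linarith)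
      simp [rho2, kap2, nD, nK, eK, kK, jM, kM, e0, k0, h2, h3, h4, h5, h6, h7])
  rw [interval_shift (fun s => rho2 B ψ t s), interval_shift (fun s => rho2 B ψ 1 s)] at key
  have e1 : a' + t = a₁ := by simp [a']
  rw [e1] at key
  have h1 : ∫ s in a..b, nD B (Svf ψ) t s ≤ ∫ s in a₁..(a₁ + X), nD B (Svf ψ) t s := by
    apply intervalIntegral.integral_mono_interval ha1 hab (by linarith)
    · exact Filter.Eventually.of_forall fun s => nD_nonneg (by linarith) s
    · exact n_intble h.sm.svf (by linarith) _ _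
  have h2 : ∫ s in (a' + 1)..(a' + 1 + X), rho2 B ψ 1 s
      ≤ ∫ s in (a' + 1)..(a' + 1 + X), 100000 * B.C ^ 7 * (eK B (Svf ψ) 1 s + eK B ψ 1 s) := by
    apply intervalIntegral.integral_mono_on (by linarith) (rho2_intble h one_pos _ _)
      (((eK_intble h.sm.svf _ _ _).add (eK_intble h.sm _ _ _)).const_mul _)
    intro s _
    exact rho2_one s
  rw [intervalIntegral.integral_const_mul] at h2
  have h3 := mul_le_mul_of_nonneg_left (hI (a' + 1) (a' + 1 + X) (by linarith))
    (show 0 ≤ 100000 * B.C ^ 7 by positivity)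
  -- lower bound
  set P' : ℝ → ℝ := fun s => t * ((-(4 * s) * ((1 + s ^ 2) ^ 3)⁻¹ * Svf ψ t s ^ 2
      + ee s * (2 * Svf ψ t s * pd_s (Svf ψ) t s)) * (48 * B.C)⁻¹
      + (-(4 * s) * ((1 + s ^ 2) ^ 3)⁻¹ * ψ t s ^ 2
      + ee s * (2 * ψ t s * pd_s ψ t s)) * (12 * B.C ^ 3)) with hP'
  have cP : Continuous P' := by
    have c1 := h.sm.cont_right t
    have c2 := h.sm.svf.cont_right t
    have c3 := h.sm.ds.cont_right t
    have c4 := h.sm.svf.ds.cont_right t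
    have c5 := ee_cont
    have c6 : Continuous (fun s : ℝ => ((1 + s ^ 2) ^ 3)⁻¹) :=
      Continuous.inv₀ (by fun_prop) (fun s => by positivity)
    rw [hP']
    fun_prop
  have hPint : ∫ s in a₁..(a₁ + X), P' s = t * (ee (a₁ + X) * Svf ψ t (a₁ + X) ^ 2 * (48 * B.C)⁻¹
      + ee (a₁ + X) * ψ t (a₁ + X) ^ 2 * (12 * B.C ^ 3))
      - t * (ee a₁ * Svf ψ t a₁ ^ 2 * (48 * B.C)⁻¹ + ee a₁ * ψ t a₁ ^ 2 * (12 * B.C ^ 3)) := by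
    apply intervalIntegral.integral_eq_sub_of_hasDerivAt
      (f := fun s => t * (ee s * Svf ψ t s ^ 2 * (48 * B.C)⁻¹ + ee s * ψ t s ^ 2 * (12 * B.C ^ 3)))
    · intro s _
      have d := (((((ee_deriv s).mul ((h.sm.svf.s t s).pow 2)).mul_const (48 * B.C)⁻¹)).add
        (((ee_deriv s).mul ((h.sm.s t s).pow 2)).mul_const (12 * B.C ^ 3))).const_mul t
      refine d.congr_deriv ?_
      rw [hP']; simp
    · exact cP.intervalIntegrable _ _
  have z1 : ψ t (a₁ + X) = 0 := (hS1 t (a₁ + X) (by rw [abs_of_nonneg (by linarith)]; linarith)).1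
  have z2 : Svf ψ t (a₁ + X) = 0 := (hS2 t (a₁ + X) (by rw [abs_of_nonneg (by linarith)]; linarith)).1
  rw [z1, z2] at hPint
  have hPneg : ∫ s in a₁..(a₁ + X), P' s ≤ 0 := by
    rw [hPint]
    have : 0 ≤ ee a₁ := by unfold ee; positivity
    have : 0 ≤ t * (ee a₁ * Svf ψ t a₁ ^ 2 * (48 * B.C)⁻¹ + ee a₁ * ψ t a₁ ^ 2 * (12 * B.C ^ 3)) := by
      positivity
    simp only [ne_eq, OfNat.ofNat_ne_zero, not_false_eq_true, zero_pow, mul_zero, zero_mul, add_zero]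
    linarith
  have iN := n_intble (B := B) h.sm.svf ht0 a₁ (a₁ + X)
  have h4 : ∫ s in a₁..(a₁ + X), (nD B (Svf ψ) t s / 2 - P' s) ≤ ∫ s in a₁..(a₁ + X), rho2 B ψ t s := by
    apply intervalIntegral.integral_mono_on (by linarith) ((iN.div_const 2).sub (cP.intervalIntegrable _ _))
      (rho2_intble h ht0 _ _)
    intro s _
    exact rho2_lower ht0 s
  rw [intervalIntegral.integral_sub (iN.div_const 2) (cP.intervalIntegrable _ _),
    intervalIntegral.integral_div] at h4
  linarith
end

section
variable {M : ℝ} {r : ℝ → ℝ}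

def xx (r : ℝ → ℝ) (s : ℝ) : ℝ := (r s)⁻¹
def dd (M : ℝ) (r : ℝ → ℝ) (s : ℝ) : ℝ := 1 - 2 * M * xx r s

lemma r_pos (hM : 0 < M) (hr : IsTortoise M r) (s : ℝ) : 0 < r s := by
  have := hr.1 s; linarith
lemma xx_pos (hM : 0 < M) (hr : IsTortoise M r) (s : ℝ) : 0 < xx r s := inv_pos.2 (r_pos hM hr s)
lemma r_xx (hM : 0 < M) (hr : IsTortoise M r) (s : ℝ) : r s * xx r s = 1 :=
  mul_inv_cancel₀ (r_pos hM hr s).ne'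
lemma dd_pos (hM : 0 < M) (hr : IsTortoise M r) (s : ℝ) : 0 < dd M r s := by
  have h1 := hr.1 s
  have h2 := r_xx hM hr s
  have h3 := xx_pos hM hr s
  unfold dd
  nlinarith
lemma dd_le (hM : 0 < M) (hr : IsTortoise M r) (s : ℝ) : dd M r s ≤ 1 := by
  have h3 := xx_pos hM hr s
  unfold dd
  nlinarith
lemma Mxx_le (hM : 0 < M) (hr : IsTortoise M r) (s : ℝ) : M * xx r s ≤ 1 / 2 := by
  have := dd_pos hM hr s
  unfold dd at this; linarith
lemma r_deriv (hr : IsTortoise M r) (s : ℝ) : HasDerivAt r (dd M r s) s := by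
  have := hr.2.1 s
  refine this.congr_deriv ?_
  unfold dd xx; rw [div_eq_mul_inv]
lemma xx_deriv (hM : 0 < M) (hr : IsTortoise M r) (s : ℝ) :
    HasDerivAt (xx r) (-(xx r s) ^ 2 * dd M r s) s := by
  have := (r_deriv hr s).inv (r_pos hM hr s).ne'
  refine this.congr_deriv ?_
  unfold xx; rw [inv_pow]; ring
lemma dd_deriv (hM : 0 < M) (hr : IsTortoise M r) (s : ℝ) :
    HasDerivAt (dd M r) (2 * M * (xx r s) ^ 2 * dd M r s) s := by
  have := (((xx_deriv hM hr s).const_mul (2 * M)).const_sub 1)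
  refine this.congr_deriv ?_
  ring

lemma r_smooth (hM : 0 < M) (hr : IsTortoise M r) : ContDiff ℝ (⊤ : ℕ∞) r := by
  rw [contDiff_infty]
  intro n
  induction n with
  | zero =>
    rw [Nat.cast_zero, contDiff_zero]
    exact continuous_iff_continuousAt.2 fun s => (r_deriv hr s).continuousAt
  | succ n ih =>
    rw [Nat.cast_succ, contDiff_succ_iff_deriv]
    refine ⟨fun s => (r_deriv hr s).differentiableAt, by simp, ?_⟩
    have e : deriv r = fun s => 1 - 2 * M * (r s)⁻¹ := by
      ext s; exact (r_deriv hr s).deriv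
    rw [e]
    exact contDiff_const.sub (contDiff_const.mul (ih.inv fun s => (r_pos hM hr s).ne'))
lemma xx_smooth (hM : 0 < M) (hr : IsTortoise M r) : ContDiff ℝ (⊤ : ℕ∞) (xx r) :=
  (r_smooth hM hr).inv fun s => (r_pos hM hr s).ne'
lemma dd_smooth (hM : 0 < M) (hr : IsTortoise M r) : ContDiff ℝ (⊤ : ℕ∞) (dd M r) :=
  contDiff_const.sub (contDiff_const.mul (xx_smooth hM hr))

lemma r_mono (hM : 0 < M) (hr : IsTortoise M r) : Monotone r :=
  monotone_of_deriv_nonneg (fun s => (r_deriv hr s).differentiableAt)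
    (fun s => by rw [(r_deriv hr s).deriv]; exact (dd_pos hM hr s).le)
lemma dd_mono (hM : 0 < M) (hr : IsTortoise M r) : Monotone (dd M r) :=
  monotone_of_deriv_nonneg (fun s => (dd_deriv hM hr s).differentiableAt)
    (fun s => by
      rw [(dd_deriv hM hr s).deriv]
      have := dd_pos hM hr s
      positivity)

lemma r_sub_mono (hM : 0 < M) (hr : IsTortoise M r) : Monotone (fun s => s - r s) :=
  monotone_of_deriv_nonneg (fun s => ((hasDerivAt_id s).sub (r_deriv hr s)).differentiableAt)
    (fun s => by
      have := ((hasDerivAt_id s).sub (r_deriv hr s)).deriv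
      have h2 := dd_le hM hr s
      have e : (id - r) = fun s => s - r s := by ext; simp
      rw [e] at this
      rw [this]; linarith)

lemma r_le (hM : 0 < M) (hr : IsTortoise M r) {s : ℝ} (hs : 0 ≤ s) : r s ≤ 3 * M + s := by
  have := r_sub_mono hM hr hs
  simp only at this
  rw [hr.2.2] at this; linarith
lemma r_le_neg (hM : 0 < M) (hr : IsTortoise M r) {s : ℝ} (hs : s ≤ 0) : r s ≤ 3 * M := by
  rw [← hr.2.2]; exact r_mono hM hr hs
lemma r_le_abs (hM : 0 < M) (hr : IsTortoise M r) (s : ℝ) : r s ≤ 3 * M + |s| := by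
  rcases le_total 0 s with h | h
  · rw [abs_of_nonneg h]; exact r_le hM hr h
  · have := r_le_neg hM hr h
    have := abs_nonneg s
    linarith

lemma r_ge (hM : 0 < M) (hr : IsTortoise M r) {s : ℝ} (hs : 0 ≤ s) : 3 * M + s / 3 ≤ r s := by
  have hm : MonotoneOn (fun s => r s - s / 3) (Set.Ici 0) := by
    have hd : ∀ s, HasDerivAt (fun s => r s - s / 3) (dd M r s - 1 / 3) s := fun s =>
      (r_deriv hr s).sub ((hasDerivAt_id s).div_const 3)
    apply monotoneOn_of_deriv_nonneg (convex_Ici 0)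
      (fun s _ => (hd s).continuousAt.continuousWithinAt) (fun s _ => (hd s).differentiableAt.differentiableWithinAt)
    intro s hs
    rw [interior_Ici] at hs
    rw [(hd s).deriv]
    have h0 : dd M r 0 ≤ dd M r s := dd_mono hM hr (le_of_lt hs)
    have : dd M r 0 = 1 / 3 := by
      unfold dd xx; rw [hr.2.2]; field_simp; norm_num
    linarith
  have := hm (Set.mem_Ici.2 le_rfl) (Set.mem_Ici.2 hs) hs
  simp only at this
  rw [hr.2.2] at this; linarith

lemma dd_exp (hM : 0 < M) (hr : IsTortoise M r) {S s : ℝ} (hS : 0 ≤ S) (hs : s ≤ S) :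
    dd M r s ≤ rexp (2 * M / (3 * M + S) ^ 2 * (s - S)) := by
  set c := 2 * M / (3 * M + S) ^ 2 with hc
  have hd : ∀ s, HasDerivAt (fun s => dd M r s * rexp (-c * s))
      (2 * M * (xx r s) ^ 2 * dd M r s * rexp (-c * s) + dd M r s * (rexp (-c * s) * (-c))) s := by
    intro s
    have h1 : HasDerivAt (fun s => -c * s) (-c) s := by
      simpa using (hasDerivAt_id s).const_mul (-c)
    exact (dd_deriv hM hr s).mul h1.exp
  have hm : MonotoneOn (fun s => dd M r s * rexp (-c * s)) (Set.Iic S) := by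
    apply monotoneOn_of_deriv_nonneg (convex_Iic S)
      (fun s _ => (hd s).continuousAt.continuousWithinAt) (fun s _ => (hd s).differentiableAt.differentiableWithinAt)
    intro s hs
    rw [interior_Iic] at hs
    rw [(hd s).deriv]
    have h1 : r s ≤ 3 * M + S := (r_mono hM hr (le_of_lt hs)).trans (r_le hM hr hS)
    have h2 : c ≤ 2 * M * (xx r s) ^ 2 := by
      rw [hc, div_eq_mul_inv, xx, ← inv_pow]
      have := r_pos hM hr s
      gcongr
    have h3 := dd_pos hM hr s
    have h4 : 0 ≤ dd M r s * rexp (-c * s) * (2 * M * (xx r s) ^ 2 - c) :=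
      mul_nonneg (by positivity) (by linarith)
    linarith
  have h1 := hm (Set.mem_Iic.2 hs) (Set.mem_Iic.2 le_rfl) hs
  simp only at h1
  have h2 : dd M r s = dd M r s * rexp (-c * s) * rexp (c * s) := by
    rw [mul_assoc, ← Real.exp_add]; simp
  rw [h2]
  calc dd M r s * rexp (-c * s) * rexp (c * s) ≤ (dd M r S * rexp (-c * S)) * rexp (c * s) := by gcongr
    _ ≤ (1 * rexp (-c * S)) * rexp (c * s) := by
        have := dd_le hM hr S
        gcongr
    _ = _ := by rw [one_mul, ← Real.exp_add]; congr 1; ring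

lemma exists_pow_exp {c : ℝ} (hc : 0 < c) (k : ℕ) : ∃ K : ℝ, 1 ≤ K ∧ ∀ y : ℝ, 0 ≤ y →
    (1 + y) ^ k * rexp (-c * y) ≤ K := by
  refine ⟨1 + c⁻¹ ^ k * (k.factorial * rexp c), ?_, ?_⟩
  · have : 0 ≤ c⁻¹ ^ k * (k.factorial * rexp c) := by positivity
    linarith
  · intro y hy
    have h := Real.pow_div_factorial_le_exp (c * (1 + y)) (by positivity) k
    rw [div_le_iff₀ (by positivity)] at h
    have e : (1 + y) ^ k = c⁻¹ ^ k * (c * (1 + y)) ^ k := by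
      rw [mul_pow, ← mul_assoc, ← mul_pow, inv_mul_cancel₀ hc.ne', one_pow, one_mul]
    rw [e]
    have e2 : rexp (c * (1 + y)) * rexp (-c * y) = rexp c := by
      rw [← Real.exp_add]; congr 1; ring
    calc c⁻¹ ^ k * (c * (1 + y)) ^ k * rexp (-c * y)
        ≤ c⁻¹ ^ k * (rexp (c * (1 + y)) * k.factorial) * rexp (-c * y) := by gcongr
      _ = c⁻¹ ^ k * (k.factorial * (rexp (c * (1 + y)) * rexp (-c * y))) := by ring
      _ = c⁻¹ ^ k * (k.factorial * rexp c) := by rw [e2]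
      _ ≤ _ := by linarith

/-- chain rule for functions of `x = 1/r` -/
lemma poly_deriv (hM : 0 < M) (hr : IsTortoise M r) {P : ℝ → ℝ} {P' : ℝ} (s : ℝ)
    (h : HasDerivAt P P' (xx r s)) :
    HasDerivAt (fun s => P (xx r s)) (P' * (-(xx r s) ^ 2 * dd M r s)) s :=
  h.comp s (xx_deriv hM hr s)

def VV (M x : ℝ) : ℝ := 2 * M * (1 - 2 * M * x) * x ^ 3
def VV' (M x : ℝ) : ℝ := 2 * M * (1 - 2 * M * x) * x ^ 4 * (8 * M * x - 3)
def hh (M x : ℝ) : ℝ := 1 - 40 * M ^ 3 * x ^ 3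
def hh' (M x : ℝ) : ℝ := 120 * M ^ 3 * x ^ 4 * (1 - 2 * M * x)
def pp (M x : ℝ) : ℝ := 40 * M ^ 3 * (1 - 2 * M * x) * x ^ 4
def pp' (M x : ℝ) : ℝ := 40 * M ^ 3 * (4 * x ^ 3 - 10 * M * x ^ 4) * (-x ^ 2 * (1 - 2 * M * x))
def qq (M x : ℝ) : ℝ := 4 * M ^ 2 * (1 - 2 * M * x) * x ^ 4
  - 100 * M ^ 3 * (1 - 2 * M * x) ^ 2 * x ^ 5 - pp' M x / 2
def qq' (M x : ℝ) : ℝ := (deriv (qq M) x) * (-x ^ 2 * (1 - 2 * M * x))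

lemma qq_deriv (M x : ℝ) : HasDerivAt (qq M) (16 * M ^ 2 * x ^ 3 - 40 * M ^ 3 * x ^ 4
   - 100 * M ^ 3 * (5 * x ^ 4 - 24 * M * x ^ 5 + 28 * M ^ 2 * x ^ 6)
   + 20 * M ^ 3 * (20 * x ^ 4 - 108 * M * x ^ 5 + 140 * M ^ 2 * x ^ 6)) x := by
  have e : qq M = fun x => 4 * M ^ 2 * x ^ 4 - 8 * M ^ 3 * x ^ 5
     - 100 * M ^ 3 * (x ^ 5 - 4 * M * x ^ 6 + 4 * M ^ 2 * x ^ 7)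
     + 20 * M ^ 3 * (4 * x ^ 5 - 18 * M * x ^ 6 + 20 * M ^ 2 * x ^ 7) := by
    ext x; unfold qq pp'; ring
  rw [e]
  have k : ∀ n : ℕ, ∀ a : ℝ, HasDerivAt (fun x : ℝ => a * x ^ n) (a * (n * x ^ (n - 1))) x :=
    fun n a => (hasDerivAt_pow n x).const_mul a
  have := (((k 4 (4 * M ^ 2)).sub (k 5 (8 * M ^ 3))).sub
    ((((hasDerivAt_pow 5 x).sub (k 6 (4 * M))).add (k 7 (4 * M ^ 2))).const_mul (100 * M ^ 3))).add
    ((((k 5 4).sub (k 6 (18 * M))).add (k 7 (20 * M ^ 2))).const_mul (20 * M ^ 3))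
  refine this.congr_deriv ?_
  norm_num
  ring

lemma bulk_id (M x a b c : ℝ) : (hh' M x / 2 - pp M x) * a ^ 2 + (hh' M x / 2 + pp M x) * b ^ 2
    + (pp M x * VV M x - (hh' M x * VV M x + hh M x * VV' M x) / 2 + qq' M x) * c ^ 2
    + (pp' M x + 2 * qq M x) * c * b
    = 20 * M ^ 3 * (1 - 2 * M * x) * x ^ 4 * a ^ 2
      + (1 - 2 * M * x) * x ^ 4 * (100 * M ^ 3 * (b - (1 - 2 * M * x) * x * c) ^ 2
        + 8 * M ^ 2 * c * (b - (1 - 2 * M * x) * x * c)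
        + M * (3 - 16 * M * x + 24 * M ^ 2 * x ^ 2) * c ^ 2) := by
  unfold qq'
  rw [(qq_deriv M x).deriv]
  unfold hh' pp hh VV VV' qq pp'
  ring

lemma bulk_ge {M x : ℝ} (hM : 0 < M) (hD : 0 < 1 - 2 * M * x) (a b c : ℝ) :
    M / 6 * ((1 - 2 * M * x) * x ^ 4) * c ^ 2 ≤
    (hh' M x / 2 - pp M x) * a ^ 2 + (hh' M x / 2 + pp M x) * b ^ 2
    + (pp M x * VV M x - (hh' M x * VV M x + hh M x * VV' M x) / 2 + qq' M x) * c ^ 2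
    + (pp' M x + 2 * qq M x) * c * b := by
  rw [bulk_id]
  generalize b - (1 - 2 * M * x) * x * c = z
  have h1 : 0 ≤ 20 * M ^ 3 * (1 - 2 * M * x) * x ^ 4 * a ^ 2 := by positivity
  have h2 : M / 6 * c ^ 2 ≤ 100 * M ^ 3 * z ^ 2 + 8 * M ^ 2 * c * z
        + M * (3 - 16 * M * x + 24 * M ^ 2 * x ^ 2) * c ^ 2 := by
    have e : 100 * M ^ 3 * z ^ 2 + 8 * M ^ 2 * c * z
        + M * (3 - 16 * M * x + 24 * M ^ 2 * x ^ 2) * c ^ 2 - M / 6 * c ^ 2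
        = 4 * M ^ 3 * z ^ 2 + M * (24 * M * z + c) ^ 2 / 6 + M * (8 / 3 * (1 - 3 * M * x) ^ 2) * c ^ 2 := by
      ring
    have : 0 ≤ 4 * M ^ 3 * z ^ 2 + M * (24 * M * z + c) ^ 2 / 6 + M * (8 / 3 * (1 - 3 * M * x) ^ 2) * c ^ 2 := by
      positivity
    linarith
  have := mul_le_mul_of_nonneg_left h2 (show 0 ≤ (1 - 2 * M * x) * x ^ 4 by positivity)
  linarith
end

section
variable {M : ℝ} {r : ℝ → ℝ}

def WW (M : ℝ) (r : ℝ → ℝ) (s : ℝ) : ℝ := -(2 * VV M (xx r s) + s * VV' M (xx r s))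

lemma VV_eq (M : ℝ) (r : ℝ → ℝ) (s : ℝ) : VV M (xx r s) = 2 * M * dd M r s * xx r s ^ 3 := rfl

lemma WW_eq (M : ℝ) (r : ℝ → ℝ) (s : ℝ) :
    WW M r s = -(VV M (xx r s) * (2 + s * xx r s * (8 * M * xx r s - 3))) := by
  unfold WW VV VV'; ring

lemma VV_pos (hM : 0 < M) (hr : IsTortoise M r) (s : ℝ) : 0 < VV M (xx r s) := by
  rw [VV_eq]
  have := dd_pos hM hr s
  have := xx_pos hM hr s
  positivity

lemma xx_le (hM : 0 < M) (hr : IsTortoise M r) (s : ℝ) : xx r s ≤ 1 / (2 * M) := by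
  rw [le_div_iff₀ (by positivity)]
  have := Mxx_le hM hr s
  linarith

lemma s_xx_le (hM : 0 < M) (hr : IsTortoise M r) {s : ℝ} (hs : 0 ≤ s) : s * xx r s ≤ 3 := by
  have h1 := r_ge hM hr hs
  have h2 := r_xx hM hr s
  have h3 := xx_pos hM hr s
  nlinarith

lemma eight_abs (hM : 0 < M) (hr : IsTortoise M r) (s : ℝ) : |8 * M * xx r s - 3| ≤ 3 := by
  have h1 := Mxx_le hM hr s
  have h3 := mul_pos hM (xx_pos hM hr s)
  rw [abs_le]; constructor <;> linarith

lemma WW_abs (hM : 0 < M) (hr : IsTortoise M r) (s : ℝ) :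
    |WW M r s| ≤ VV M (xx r s) * (2 + 3 * (|s| * xx r s)) := by
  have hV := VV_pos hM hr s
  have hx := xx_pos hM hr s
  rw [WW_eq, abs_neg, abs_mul, abs_of_pos hV]
  apply mul_le_mul_of_nonneg_left _ hV.le
  refine (abs_add_le _ _).trans ?_
  rw [abs_of_pos (by norm_num : (0:ℝ) < 2), abs_mul, abs_mul, abs_of_pos hx]
  have := mul_le_mul_of_nonneg_left (eight_abs hM hr s) (show 0 ≤ |s| * xx r s by positivity)
  linarith

lemma WW2 (hM : 0 < M) (hr : IsTortoise M r) : ∃ C : ℝ, 0 ≤ C ∧ ∀ s, |WW M r s| ≤ C * (1 + |s|) * VV M (xx r s) := by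
  refine ⟨2 + 3 / (2 * M), by positivity, fun s => ?_⟩
  have hV := VV_pos hM hr s
  refine (WW_abs hM hr s).trans ?_
  rw [mul_comm]
  apply mul_le_mul_of_nonneg_right _ hV.le
  have h1 := mul_le_mul_of_nonneg_left (xx_le hM hr s) (abs_nonneg s)
  have h2 : 0 ≤ 1 / (2 * M) := by positivity
  have h3 := abs_nonneg s
  have e : 3 / (2 * M) = 3 * (1 / (2 * M)) := by ring
  rw [e]
  nlinarith

lemma abs_xx_le (hM : 0 < M) (hr : IsTortoise M r) {s : ℝ} (hs : -1 ≤ s) :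
    |s| * xx r s ≤ 3 + 1 / (2 * M) := by
  have h2 : 0 ≤ 1 / (2 * M) := by positivity
  rcases le_total 0 s with h | h
  · rw [abs_of_nonneg h]
    have := s_xx_le hM hr h
    linarith
  · have h1 : |s| ≤ 1 := by rw [abs_of_nonpos h]; linarith
    have := xx_le hM hr s
    have := xx_pos hM hr s
    nlinarith

lemma WW3 (hM : 0 < M) (hr : IsTortoise M r) : ∃ C : ℝ, 0 ≤ C ∧ ∀ s, -1 ≤ s → |WW M r s| ≤ C * VV M (xx r s) := by
  refine ⟨2 + 3 * (3 + 1 / (2 * M)), by positivity, fun s hs => ?_⟩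
  have hV := VV_pos hM hr s
  refine (WW_abs hM hr s).trans ?_
  rw [mul_comm]
  apply mul_le_mul_of_nonneg_right _ hV.le
  have := abs_xx_le hM hr hs
  linarith

lemma WW4 (hM : 0 < M) (hr : IsTortoise M r) : ∃ C : ℝ, 0 ≤ C ∧ ∀ s, -1 ≤ s → 1 ≤ C * VV M (xx r s) * (1 + s ^ 2) ^ 2 := by
  have hd := dd_pos hM hr (-1)
  refine ⟨2 * (3 * M + 1) ^ 3 / (M * dd M r (-1)), by positivity, fun s hs => ?_⟩
  have h1 := dd_mono hM hr hs
  have hx := xx_pos hM hr s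
  have h2 : 1 ≤ xx r s * ((3 * M + 1) * (1 + |s|)) := by
    have h3 := r_le_abs hM hr s
    have h4 := r_xx hM hr s
    have h5 : r s ≤ (3 * M + 1) * (1 + |s|) := by
      have := mul_nonneg hM.le (abs_nonneg s)
      nlinarith
    calc 1 = xx r s * r s := by linarith
      _ ≤ _ := by gcongr
  have h3 : 1 ≤ (xx r s * ((3 * M + 1) * (1 + |s|))) ^ 3 := one_le_pow₀ h2
  have h4 : (1 + |s|) ^ 3 ≤ 4 * (1 + s ^ 2) ^ 2 := by
    rw [← sq_abs s]
    have := abs_nonneg s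
    generalize |s| = y at *
    nlinarith [sq_nonneg (y - 1), sq_nonneg (y ^ 2 - 1), mul_nonneg this (sq_nonneg (y - 1)), mul_nonneg (sq_nonneg y) (sq_nonneg (y - 1))]
  rw [VV_eq]
  have e : 2 * (3 * M + 1) ^ 3 / (M * dd M r (-1)) * (2 * M * dd M r s * xx r s ^ 3) * (1 + s ^ 2) ^ 2
     = (xx r s ^ 3 * (3 * M + 1) ^ 3) * (4 * (1 + s ^ 2) ^ 2) * (dd M r s / dd M r (-1)) := by
    field_simp; ring
  rw [e]
  have h5 : 1 ≤ dd M r s / dd M r (-1) := by rw [one_le_div hd]; exact h1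
  calc (1:ℝ) = 1 * 1 := by norm_num
    _ ≤ (xx r s * ((3 * M + 1) * (1 + |s|))) ^ 3 * (dd M r s / dd M r (-1)) := by gcongr
    _ = (xx r s ^ 3 * (3 * M + 1) ^ 3) * (1 + |s|) ^ 3 * (dd M r s / dd M r (-1)) := by ring
    _ ≤ _ := by gcongr

lemma WW5 (hM : 0 < M) (hr : IsTortoise M r) : ∃ C : ℝ, 0 ≤ C ∧ ∀ s, s ≤ -1 → |WW M r s| * (1 + s ^ 2) ^ 3 ≤ C * |s| := by
  obtain ⟨C, hC, h2⟩ := WW2 hM hr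
  obtain ⟨K, hK, hK2⟩ := exists_pow_exp (c := 2 * M / (3 * M + 0) ^ 2) (by positivity) 6
  refine ⟨C * 2 * (2 * M * (1 / (2 * M)) ^ 3 * K), by positivity, fun s hs => ?_⟩
  have hx := xx_pos hM hr s
  have hD := dd_pos hM hr s
  have hxl := xx_le hM hr s
  have h3 := dd_exp hM hr le_rfl (show s ≤ 0 by linarith)
  have h4 := hK2 (-s) (by linarith)
  have e : -(2 * M / (3 * M + 0) ^ 2) * -s = 2 * M / (3 * M + 0) ^ 2 * (s - 0) := by ring
  rw [e] at h4
  have h5 : (1 + s ^ 2) ^ 3 ≤ (1 + -s) ^ 6 := by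
    have : (1 + -s) ^ 6 = ((1 + -s) ^ 2) ^ 3 := by ring
    rw [this]
    apply pow_le_pow_left₀ (by positivity)
    nlinarith
  have h6 : dd M r s * (1 + s ^ 2) ^ 3 ≤ K := by
    calc dd M r s * (1 + s ^ 2) ^ 3 ≤ rexp (2 * M / (3 * M + 0) ^ 2 * (s - 0)) * (1 + -s) ^ 6 := by gcongr
      _ ≤ K := by linarith
  have h7 : 1 + |s| ≤ 2 * |s| := by rw [abs_of_neg (by linarith)]; linarith
  calc |WW M r s| * (1 + s ^ 2) ^ 3 ≤ C * (1 + |s|) * VV M (xx r s) * (1 + s ^ 2) ^ 3 := by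
        gcongr; exact h2 s
    _ = C * (1 + |s|) * (2 * M * xx r s ^ 3 * (dd M r s * (1 + s ^ 2) ^ 3)) := by rw [VV_eq]; ring
    _ ≤ C * (2 * |s|) * (2 * M * (1 / (2 * M)) ^ 3 * K) := by gcongr
    _ = _ := by ring

lemma WW1 (hM : 0 < M) (hr : IsTortoise M r) : ∃ C : ℝ, 0 ≤ C ∧ ∀ s, |WW M r s| * (1 + s ^ 2) ≤ C := by
  obtain ⟨C5, hC5, h5⟩ := WW5 hM hr
  obtain ⟨C3, hC3, h3⟩ := WW3 hM hr
  have pM : 0 < 1 / (2 * M) := by positivity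
  refine ⟨C5 + C3 * (2 * M * (1 / (2 * M)) * ((1 / (2 * M)) ^ 2 + (3 + 1 / (2 * M)) ^ 2)), by positivity, fun s => ?_⟩
  have k0 := abs_nonneg (WW M r s)
  rcases le_total (-1) s with hs | hs
  · have hx := xx_pos hM hr s
    have hD := dd_pos hM hr s
    have hD1 := dd_le hM hr s
    have hxl := xx_le hM hr s
    have ha := abs_xx_le hM hr hs
    have : |WW M r s| * (1 + s ^ 2) ≤ C3 * (2 * M * (1 / (2 * M)) * ((1 / (2 * M)) ^ 2 + (3 + 1 / (2 * M)) ^ 2)) := by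
      calc |WW M r s| * (1 + s ^ 2) ≤ C3 * VV M (xx r s) * (1 + s ^ 2) := by gcongr; exact h3 s hs
        _ = C3 * (2 * M * (dd M r s * xx r s) * (xx r s ^ 2 + (|s| * xx r s) ^ 2)) := by
            rw [VV_eq, mul_pow, sq_abs]; ring
        _ ≤ C3 * (2 * M * (1 * (1 / (2 * M))) * ((1 / (2 * M)) ^ 2 + (3 + 1 / (2 * M)) ^ 2)) := by
            have : 0 ≤ |s| * xx r s := by positivity
            gcongr
        _ = _ := by ring
    linarith
  · have h1 := h5 s hs
    have : |WW M r s| * (1 + s ^ 2) ≤ C5 := by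
      have hs2 : |s| ≤ (1 + s ^ 2) ^ 2 := by
        rw [← sq_abs s]; nlinarith [abs_nonneg s, sq_nonneg (|s| - 1), sq_nonneg (|s| ^ 2)]
      have : |WW M r s| * (1 + s ^ 2) * (1 + s ^ 2) ^ 2 ≤ C5 * (1 + s ^ 2) ^ 2 := by
        calc _ = |WW M r s| * (1 + s ^ 2) ^ 3 := by ring
          _ ≤ C5 * |s| := h1
          _ ≤ _ := by gcongr
      exact le_of_mul_le_mul_right this (by positivity)
    have : 0 ≤ C3 * (2 * M * (1 / (2 * M)) * ((1 / (2 * M)) ^ 2 + (3 + 1 / (2 * M)) ^ 2)) := by positivity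
    linarith

lemma WWneg (hM : 0 < M) (hr : IsTortoise M r) : ∃ C : ℝ, 0 ≤ C ∧ ∀ s, -(C * (dd M r s * xx r s ^ 4)) ≤ WW M r s := by
  set c := 2 * M / (3 * M + 0) ^ 2 with hc
  have hc0 : 0 < c := by positivity
  refine ⟨2 * M * (30 * M + 9 / c), by positivity, fun s => ?_⟩
  have hx := xx_pos hM hr s
  have hD := dd_pos hM hr s
  have hrx := r_xx hM hr s
  have key : 2 * r s + s * (8 * M * xx r s - 3) ≤ 30 * M + 9 / c := by
    have hcp : 0 ≤ 9 / c := by positivity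
    rcases le_total 0 s with h | h
    · have h1 := r_le hM hr h
      have h2 := mul_le_mul_of_nonneg_left (s_xx_le hM hr h) hM.le
      nlinarith
    · have h1 := r_le_neg hM hr h
      rcases le_total 3 (8 * M * xx r s) with h3 | h3
      · nlinarith
      · have h4 := dd_exp hM hr le_rfl h
        have h5 : 1 / 4 ≤ dd M r s := by unfold dd; linarith
        have h6 : rexp (c * (s - 0)) * rexp (-(c * s)) = 1 := by rw [← Real.exp_add]; simp
        have h7 := Real.add_one_le_exp (-(c * s))
        have h8 := Real.exp_pos (-(c * s))
        rw [← hc] at h4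
        have h9 : rexp (-(c * s)) ≤ 4 := by nlinarith
        have h10 : -s ≤ 3 / c := by rw [le_div_iff₀ hc0]; linarith
        have h11 := (abs_le.1 (eight_abs hM hr s)).1
        have e : 9 / c = 3 * (3 / c) := by ring
        rw [e]
        nlinarith
  have e : WW M r s = -(2 * M * (2 * r s + s * (8 * M * xx r s - 3)) * (dd M r s * xx r s ^ 4)) := by
    have : xx r s ^ 3 = xx r s ^ 4 * r s := by
      calc xx r s ^ 3 = xx r s ^ 3 * (r s * xx r s) := by rw [hrx, mul_one]
        _ = _ := by ring
    unfold WW VV VV' 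
    rw [this]
    unfold dd
    ring
  rw [e]
  apply neg_le_neg
  gcongr

lemma exists_bg (hM : 0 < M) (hr : IsTortoise M r) : ∃ B : Bg, B.V = fun s => VV M (xx r s) := by
  obtain ⟨c1, p1, h1⟩ := WW1 hM hr
  obtain ⟨c2, p2, h2⟩ := WW2 hM hr
  obtain ⟨c3, p3, h3⟩ := WW3 hM hr
  obtain ⟨c4, p4, h4⟩ := WW4 hM hr
  obtain ⟨c5, p5, h5⟩ := WW5 hM hr
  obtain ⟨c6, p6, h6⟩ := WWneg hM hr
  set C := 30 + 5 / M + c1 + c2 + c3 + c4 + c5 + 12 * c6 / M with hC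
  have q1 : 0 ≤ 5 / M := by positivity
  have q2 : 0 ≤ 12 * c6 / M := by positivity
  have sx := xx_smooth hM hr
  have hb0 : ∀ s a b c, 0 ≤ (hh' M (xx r s) / 2 - pp M (xx r s)) * a ^ 2 + (hh' M (xx r s) / 2 + pp M (xx r s)) * b ^ 2
    + (pp M (xx r s) * VV M (xx r s) - (hh' M (xx r s) * VV M (xx r s) + hh M (xx r s) * VV' M (xx r s)) / 2 + qq' M (xx r s)) * c ^ 2
    + (pp' M (xx r s) + 2 * qq M (xx r s)) * c * b := by
    intro s a b c
    refine le_trans ?_ (bulk_ge hM (dd_pos hM hr s) a b c)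
    have := dd_pos hM hr s
    unfold dd at this
    positivity
  have kd : ∀ n : ℕ, ∀ a x : ℝ, HasDerivAt (fun x : ℝ => a * x ^ n) (a * (n * x ^ (n - 1))) x :=
    fun n a x => (hasDerivAt_pow n x).const_mul a
  refine ⟨⟨fun s => VV M (xx r s), fun s => VV' M (xx r s), WW M r, fun s => hh M (xx r s),
    fun s => hh' M (xx r s), fun s => pp M (xx r s), fun s => pp' M (xx r s), fun s => qq M (xx r s),
    fun s => qq' M (xx r s), C, ?_, ?_, ?_, ?_, ?_, ?_, ?_, ?_, ?_, ?_, ?_, ?_, ?_, ?_, ?_, ?_, hb0, ?_, ?_, ?_, ?_, ?_, ?_⟩, rfl⟩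
  · unfold VV; fun_prop
  · unfold WW VV VV'; fun_prop
  · unfold hh; fun_prop
  · unfold pp; fun_prop
  · unfold qq pp'; fun_prop
  · intro s
    have e : VV M = fun x => 2 * M * x ^ 3 - 4 * M ^ 2 * x ^ 4 := by ext x; unfold VV; ring
    have := poly_deriv hM hr (P := VV M) s (by rw [e]; exact (kd 3 (2 * M) _).sub (kd 4 (4 * M ^ 2) _))
    refine this.congr_deriv ?_
    unfold VV' dd; push_cast; ring
  · intro s
    have e : hh M = fun x => 1 - 40 * M ^ 3 * x ^ 3 := rfl
    have := poly_deriv hM hr (P := hh M) s (by rw [e]; exact (kd 3 (40 * M ^ 3) _).const_sub 1)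
    refine this.congr_deriv ?_
    unfold hh' dd; push_cast; ring
  · intro s
    have e : pp M = fun x => 40 * M ^ 3 * x ^ 4 - 80 * M ^ 4 * x ^ 5 := by ext x; unfold pp; ring
    have := poly_deriv hM hr (P := pp M) s (by rw [e]; exact (kd 4 (40 * M ^ 3) _).sub (kd 5 (80 * M ^ 4) _))
    refine this.congr_deriv ?_
    unfold pp' dd; push_cast; ring
  · intro s
    have := poly_deriv hM hr (P := qq M) s (qq_deriv M _).differentiableAt.hasDerivAt
    exact this
  · intro s; rfl
  · linarith
  · exact VV_pos hM hr
  · intro s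
    have a1 := Mxx_le hM hr s
    have a2 := mul_pos hM (xx_pos hM hr s)
    have e : hh M (xx r s) = 1 - 40 * (M * xx r s) ^ 3 := by unfold hh; ring
    simp only [e]
    have a3 : (M * xx r s) ^ 3 ≤ (1 / 2) ^ 3 := by gcongr
    have a4 : 0 ≤ (M * xx r s) ^ 3 := by positivity
    rw [abs_le]; constructor <;> linarith
  · intro s
    have a1 := Mxx_le hM hr s
    have a2 := mul_pos hM (xx_pos hM hr s)
    have a0 := VV_pos hM hr s
    have a5 := dd_pos hM hr s
    have a6 := dd_le hM hr s
    have e : pp M (xx r s) ^ 2 = 800 * ((M * xx r s) ^ 5 * dd M r s) * VV M (xx r s) := by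
      rw [VV_eq]; unfold pp dd; ring
    simp only [e]
    have a3 : (M * xx r s) ^ 5 * dd M r s ≤ (1 / 2) ^ 5 * 1 := by gcongr
    apply mul_le_mul_of_nonneg_right _ a0.le
    linarith
  · intro s
    have a1 := Mxx_le hM hr s
    have a2 := mul_pos hM (xx_pos hM hr s)
    have a5 := dd_pos hM hr s
    have a6 := dd_le hM hr s
    have e : pp M (xx r s) = 40 / M * ((M * xx r s) ^ 4 * dd M r s) := by
      unfold pp dd; field_simp
    have a3 : (M * xx r s) ^ 4 * dd M r s ≤ (1 / 2) ^ 4 * 1 := by gcongr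
    have a4 : 0 ≤ (M * xx r s) ^ 4 * dd M r s := by positivity
    have a7 : pp M (xx r s) ≤ 5 / M := by
      rw [e]
      calc 40 / M * ((M * xx r s) ^ 4 * dd M r s) ≤ 40 / M * ((1 / 2) ^ 4 * 1) := by gcongr
        _ = 5 / M / 2 := by ring
        _ ≤ _ := by linarith
    have a8 : 0 ≤ pp M (xx r s) := by rw [e]; positivity
    simp only [abs_of_nonneg a8]
    linarith
  · intro s
    have a1 := Mxx_le hM hr s
    have a2 := mul_pos hM (xx_pos hM hr s)
    have a0 := VV_pos hM hr s
    have a5 := dd_pos hM hr s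
    have a6 := dd_le hM hr s
    have e : qq M (xx r s) = VV M (xx r s) * (2 * (M * xx r s) - 50 * ((M * xx r s) ^ 2 * dd M r s)
        + 10 * (M * xx r s) ^ 2 * (4 - 10 * (M * xx r s))) := by
      unfold qq pp' VV dd; ring
    simp only [e]
    rw [abs_mul, abs_of_pos a0, mul_comm]
    apply mul_le_mul_of_nonneg_right _ a0.le
    generalize M * xx r s = y at *
    have b1 : y ^ 2 ≤ (1 / 2) ^ 2 := by gcongr
    have b2 : y ^ 2 * dd M r s ≤ (1 / 2) ^ 2 * 1 := by gcongr
    have b3 : 0 ≤ y ^ 2 * dd M r s := by positivity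
    have b4 : y ^ 2 * (4 - 10 * y) ≤ 1 := by nlinarith
    have b5 : -1 ≤ y ^ 2 * (4 - 10 * y) := by nlinarith
    rw [abs_le]; constructor <;> nlinarith
  · intro s a b c
    have w := h6 s
    have hD := dd_pos hM hr s
    have hx := xx_pos hM hr s
    have k1 : |WW M r s| ≤ WW M r s + 2 * (c6 * (dd M r s * xx r s ^ 4)) := by
      have : 0 ≤ c6 * (dd M r s * xx r s ^ 4) := by positivity
      rw [abs_le]; constructor <;> linarith
    have k2 := mul_le_mul_of_nonneg_right k1 (sq_nonneg c)
    have k3 := bulk_ge hM (dd_pos hM hr s) a b c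
    have k4 := hb0 s a b c
    generalize (hh' M (xx r s) / 2 - pp M (xx r s)) * a ^ 2 + (hh' M (xx r s) / 2 + pp M (xx r s)) * b ^ 2
      + (pp M (xx r s) * VV M (xx r s) - (hh' M (xx r s) * VV M (xx r s) + hh M (xx r s) * VV' M (xx r s)) / 2 + qq' M (xx r s)) * c ^ 2
      + (pp' M (xx r s) + 2 * qq M (xx r s)) * c * b = Z at *
    have k5 := mul_le_mul_of_nonneg_left k3 q2
    have k6 : 12 * c6 / M * (M / 6 * ((1 - 2 * M * xx r s) * xx r s ^ 4) * c ^ 2)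
      = 2 * (c6 * (dd M r s * xx r s ^ 4)) * c ^ 2 := by unfold dd; field_simp; ring
    have k7 : 12 * c6 / M * Z ≤ C * Z := by
      apply mul_le_mul_of_nonneg_right _ k4; linarith
    linarith
  · intro s
    have := h1 s; linarith
  · intro s
    refine (h2 s).trans ?_
    have := (VV_pos hM hr s).le
    have := abs_nonneg s
    gcongr; linarith
  · intro s hs
    refine (h3 s hs).trans ?_
    have := (VV_pos hM hr s).le
    gcongr; linarith
  · intro s hs
    refine (h4 s hs).trans ?_
    have := (VV_pos hM hr s).le
    gcongr; linarith
  · intro s hs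
    refine (h5 s hs).trans ?_
    have := abs_nonneg s
    gcongr; linarith
end

section
variable {M : ℝ} {r : ℝ → ℝ} {φ : ℝ → ℝ → ℝ}

def rm (r : ℝ → ℝ) (φ : ℝ → ℝ → ℝ) : ℝ → ℝ → ℝ := fun t s => r s * φ t s

lemma wave_sm (h : IsWaveSol r φ) : Sm φ := h.1

lemma wave_eq (hM : 0 < M) (hr : IsTortoise M r) (h : IsWaveSol r φ) (t s : ℝ) :
    pd_t (pd_t φ) t s = pd_s (pd_s φ) t s + 2 * dd M r s * xx r s * pd_s φ t s := by
  rw [h.2.1 t s]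
  have hs := wave_sm h
  have := (((r_deriv hr s).pow 2).mul (hs.ds.s t s)).deriv
  have e : ((r ^ 2 * fun σ => pd_s φ t σ) : ℝ → ℝ) = fun x => r x ^ 2 * pd_s φ t x := by
    ext x; simp
  rw [e] at this
  rw [this]
  have hp := r_pos hM hr s
  simp
  unfold xx
  field_simp
  ring

lemma wave_of (hM : 0 < M) (hr : IsTortoise M r) (h : Sm φ) (hS : Supp φ)
    (he : ∀ t s, pd_t (pd_t φ) t s = pd_s (pd_s φ) t s + 2 * dd M r s * xx r s * pd_s φ t s) :
    IsWaveSol r φ := by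
  refine ⟨h, fun t s => ?_, hS⟩
  rw [he t s]
  have := (((r_deriv hr s).pow 2).mul (h.ds.s t s)).deriv
  have e : ((r ^ 2 * fun σ => pd_s φ t σ) : ℝ → ℝ) = fun x => r x ^ 2 * pd_s φ t x := by
    ext x; simp
  rw [e] at this
  rw [this]
  have hp := r_pos hM hr s
  simp
  unfold xx
  field_simp
  ring

lemma wave_dt (hM : 0 < M) (hr : IsTortoise M r) (h : IsWaveSol r φ) : IsWaveSol r (pd_t φ) := by
  have hs := wave_sm h
  apply wave_of hM hr hs.dt (Supp.dt h.2.2)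
  intro t s
  have eq1 : pd_t (pd_t φ) = fun t s => pd_s (pd_s φ) t s + 2 * dd M r s * xx r s * pd_s φ t s := by
    ext t s; exact wave_eq hM hr h t s
  have : pd_t (pd_t (pd_t φ)) t s = pd_t (pd_s (pd_s φ)) t s + 2 * dd M r s * xx r s * pd_t (pd_s φ) t s := by
    rw [eq1]
    exact ((hs.ds.ds.t t s).add ((hs.ds.t t s).const_mul _)).deriv
  rw [this, hs.ds.comm, hs.comm]

lemma rm_sm (hM : 0 < M) (hr : IsTortoise M r) (h : Sm φ) : Sm (rm r φ) :=
  (Sm.ofs (r_smooth hM hr)).mul h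

lemma rm_supp (h : Supp φ) : Supp (rm r φ) := h.mul_s r

lemma pd_t_rm (h : Sm φ) : pd_t (rm r φ) = rm r (pd_t φ) := by
  ext t s
  exact ((h.t t s).const_mul (r s)).deriv

lemma pd_s_rm (hr : IsTortoise M r) (h : Sm φ) (t s : ℝ) :
    pd_s (rm r φ) t s = dd M r s * φ t s + r s * pd_s φ t s :=
  ((r_deriv hr s).mul (h.s t s)).deriv

lemma rm_sol (hM : 0 < M) (hr : IsTortoise M r) (h : IsWaveSol r φ) {B : Bg}
    (hB : B.V = fun s => VV M (xx r s)) : Sol B (rm r φ) (fun _ _ => 0) where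
  sm := rm_sm hM hr h.1
  eq := by
    intro t s
    have hs := wave_sm h
    have e1 : pd_s (rm r φ) = fun t s => dd M r s * φ t s + r s * pd_s φ t s := by
      ext t s; exact pd_s_rm hr hs t s
    have e2 : pd_s (pd_s (rm r φ)) t s = (2 * M * (xx r s) ^ 2 * dd M r s * φ t s + dd M r s * pd_s φ t s)
        + (dd M r s * pd_s φ t s + r s * pd_s (pd_s φ) t s) := by
      rw [e1]
      exact (((dd_deriv hM hr s).mul (hs.s t s)).add ((r_deriv hr s).mul (hs.ds.s t s))).deriv
    have e3 : pd_t (pd_t (rm r φ)) t s = r s * pd_t (pd_t φ) t s := by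
      rw [pd_t_rm hs, pd_t_rm hs.dt]; rfl
    rw [e2, e3, wave_eq hM hr h t s, hB]
    have hx := r_xx hM hr s
    simp only [rm, VV_eq]
    have k1 : r s * (pd_s (pd_s φ) t s + 2 * dd M r s * xx r s * pd_s φ t s) = r s * pd_s (pd_s φ) t s
      + 2 * dd M r s * (r s * xx r s) * pd_s φ t s := by ring
    have k2 : 2 * M * dd M r s * xx r s ^ 3 * (r s * φ t s) = 2 * M * dd M r s * xx r s ^ 2 * (r s * xx r s) * φ t s := by ring
    rw [k1, k2, hx]
    ring

lemma svf_rm (hr : IsTortoise M r) (h : Sm φ) (t s : ℝ) :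
    Svf (rm r φ) t s = r s * Svf φ t s + s * dd M r s * φ t s := by
  unfold Svf
  rw [pd_s_rm hr h, pd_t_rm h]
  unfold rm
  ring

/-- algebraic data estimate -/
lemma data_alg {s D ρ K α γ V a b ξ : ℝ} (hD : 0 < D) (hD1 : D ≤ 1) (hρ : 0 < ρ) (hK : 0 ≤ K)
    (h1 : α ^ 2 ≤ K * ρ ^ 2) (h2 : γ ^ 2 ≤ K * D) (h3 : V * α ^ 2 ≤ K * D) :
    (1 + ((1 + s) / 2) ^ 2) * (α * a + (α * b + γ * ξ)) ^ 2
      + (1 + ((1 - s) / 2) ^ 2) * (α * a - (α * b + γ * ξ)) ^ 2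
      + (2 + (1 ^ 2 + s ^ 2) / 2) * V * (α * ξ) ^ 2
    ≤ 10 * K * ((D⁻¹ * (a - b) ^ 2 + (a + b) ^ 2 + ((1 - s) / 2) ^ 2 * (a - b) ^ 2
      + ((1 + s) / 2) ^ 2 * (a + b) ^ 2 + D * ((1 + s ^ 2) / ρ ^ 2) * ξ ^ 2) * ρ ^ 2) := by
  have gen : ∀ w c : ℝ, (1 + w ^ 2) * (α * c + γ * ξ) ^ 2 ≤ 2 * (1 + w ^ 2) * (K * ρ ^ 2 * c ^ 2 + K * D * ξ ^ 2) := by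
    intro w c
    have h4 := mul_le_mul_of_nonneg_right h1 (sq_nonneg c)
    have h5 := mul_le_mul_of_nonneg_right h2 (sq_nonneg ξ)
    have h6 : (α * c + γ * ξ) ^ 2 ≤ 2 * (K * ρ ^ 2 * c ^ 2 + K * D * ξ ^ 2) := by
      nlinarith [sq_nonneg (α * c - γ * ξ)]
    have := mul_le_mul_of_nonneg_left h6 (show 0 ≤ 1 + w ^ 2 by positivity)
    linarith
  have g1 := gen ((1 + s) / 2) (a + b)
  have g2 := gen ((1 - s) / 2) (b - a)
  have e1 : α * (a + b) + γ * ξ = α * a + (α * b + γ * ξ) := by ring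
  have e2 : (α * (b - a) + γ * ξ) ^ 2 = (α * a - (α * b + γ * ξ)) ^ 2 := by ring
  rw [e1] at g1
  rw [e2] at g2
  have g3 : (2 + (1 ^ 2 + s ^ 2) / 2) * V * (α * ξ) ^ 2 ≤ (2 + (1 ^ 2 + s ^ 2) / 2) * (K * D) * ξ ^ 2 := by
    have := mul_le_mul_of_nonneg_right h3 (sq_nonneg ξ)
    have := mul_le_mul_of_nonneg_left this (show 0 ≤ 2 + (1 ^ 2 + s ^ 2) / 2 by positivity)
    linarith
  have e3 : (D⁻¹ * (a - b) ^ 2 + (a + b) ^ 2 + ((1 - s) / 2) ^ 2 * (a - b) ^ 2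
      + ((1 + s) / 2) ^ 2 * (a + b) ^ 2 + D * ((1 + s ^ 2) / ρ ^ 2) * ξ ^ 2) * ρ ^ 2
      = (D⁻¹ * (a - b) ^ 2 + (a + b) ^ 2 + ((1 - s) / 2) ^ 2 * (a - b) ^ 2
      + ((1 + s) / 2) ^ 2 * (a + b) ^ 2) * ρ ^ 2 + D * (1 + s ^ 2) * ξ ^ 2 := by
    field_simp
  rw [e3]
  have hDi : 1 ≤ D⁻¹ := (one_le_inv₀ hD).2 hD1
  have g4 : 0 ≤ (D⁻¹ - 1) * (a - b) ^ 2 := mul_nonneg (by linarith) (sq_nonneg _)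
  have g5 : ((1 + ((1 - s) / 2) ^ 2) * (a - b) ^ 2 + (1 + ((1 + s) / 2) ^ 2) * (a + b) ^ 2)
     ≤ (D⁻¹ * (a - b) ^ 2 + (a + b) ^ 2 + ((1 - s) / 2) ^ 2 * (a - b) ^ 2
      + ((1 + s) / 2) ^ 2 * (a + b) ^ 2) := by linarith
  have g6 := mul_le_mul_of_nonneg_left g5 (show 0 ≤ 2 * (K * ρ ^ 2) by positivity)
  have g7 : 0 ≤ (D⁻¹ * (a - b) ^ 2 + (a + b) ^ 2 + ((1 - s) / 2) ^ 2 * (a - b) ^ 2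
      + ((1 + s) / 2) ^ 2 * (a + b) ^ 2) := by positivity
  have g8 := mul_nonneg (show 0 ≤ K * ρ ^ 2 by positivity) g7
  have g9 : 0 ≤ K * D * ξ ^ 2 := by positivity
  have g10 := mul_nonneg (sq_nonneg s) g9
  generalize (D⁻¹ * (a - b) ^ 2 + (a + b) ^ 2 + ((1 - s) / 2) ^ 2 * (a - b) ^ 2
      + ((1 + s) / 2) ^ 2 * (a + b) ^ 2) = Z at *
  nlinarith

lemma one_mu (M : ℝ) (r : ℝ → ℝ) (s : ℝ) : 1 - muS M r s = dd M r s := by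
  unfold muS dd xx; rw [div_eq_mul_inv]

lemma E0I_nonneg (hM : 0 < M) (hr : IsTortoise M r) (ξ : ℝ → ℝ → ℝ) (s : ℝ) : 0 ≤ E0Integrand M r ξ s := by
  unfold E0Integrand
  rw [one_mu]
  have := dd_pos hM hr s
  positivity

lemma E0_nonneg (hM : 0 < M) (hr : IsTortoise M r) (ξ : ℝ → ℝ → ℝ) : 0 ≤ E0 M r ξ :=
  integral_nonneg fun s => E0I_nonneg hM hr ξ s

lemma int_le_E0 (hM : 0 < M) (hr : IsTortoise M r) {ξ : ℝ → ℝ → ℝ} (hf : FinE0 M r ξ)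
    {a b : ℝ} (hab : a ≤ b) : ∫ s in a..b, E0Integrand M r ξ s ≤ E0 M r ξ := by
  rw [intervalIntegral.integral_of_le hab]
  exact setIntegral_le_integral hf (Filter.Eventually.of_forall fun s => E0I_nonneg hM hr ξ s)

lemma eK_rm_le (hM : 0 < M) (hr : IsTortoise M r) {B : Bg} (hB : B.V = fun s => VV M (xx r s))
    {ξ : ℝ → ℝ → ℝ} (h : Sm ξ) (s : ℝ) : eK B (rm r ξ) 1 s ≤ 10 * E0Integrand M r ξ s := by
  have hp := r_pos hM hr s
  have hD := dd_pos hM hr s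
  have hD1 := dd_le hM hr s
  have hx := r_xx hM hr s
  have := data_alg (s := s) (D := dd M r s) (ρ := r s) (K := 1) (α := r s) (γ := dd M r s) (V := VV M (xx r s))
    (a := pd_t ξ 1 s) (b := pd_s ξ 1 s) (ξ := ξ 1 s) hD hD1 hp (by norm_num) (by linarith) (by nlinarith)
    (by
      rw [VV_eq]
      have e : 2 * M * dd M r s * xx r s ^ 3 * r s ^ 2 = (2 * (M * xx r s)) * (r s * xx r s) ^ 2 * dd M r s := by ring
      rw [e, hx]
      have := Mxx_le hM hr s
      nlinarith)
  unfold eK E0Integrand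
  rw [one_mu, pd_s_rm hr h, pd_t_rm h, hB]
  simp only [rm]
  refine le_trans (le_of_eq ?_) (this.trans (le_of_eq ?_)) <;> ring

lemma eK_add_le {B : Bg} {f g : ℝ → ℝ → ℝ} (hf : Sm f) (hg : Sm g) (t s : ℝ) :
    eK B (fun t s => f t s + g t s) t s ≤ 2 * eK B f t s + 2 * eK B g t s := by
  have e1 : pd_t (fun t s => f t s + g t s) t s = pd_t f t s + pd_t g t s := ((hf.t t s).add (hg.t t s)).deriv
  have e2 : pd_s (fun t s => f t s + g t s) t s = pd_s f t s + pd_s g t s := ((hf.s t s).add (hg.s t s)).deriv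
  have hV := B.Vpos s
  unfold eK
  rw [e1, e2]
  have gen : ∀ w x y : ℝ, 0 ≤ w → w * (x + y) ^ 2 ≤ 2 * (w * x ^ 2) + 2 * (w * y ^ 2) := by
    intro w x y hw
    nlinarith [mul_nonneg hw (sq_nonneg (x - y))]
  have g1 := gen (1 + ((t + s) / 2) ^ 2) (pd_t f t s + pd_s f t s) (pd_t g t s + pd_s g t s) (by positivity)
  have g2 := gen (1 + ((t - s) / 2) ^ 2) (pd_t f t s - pd_s f t s) (pd_t g t s - pd_s g t s) (by positivity)
  have g3 := gen ((2 + (t ^ 2 + s ^ 2) / 2) * B.V s) (f t s) (g t s) (by positivity)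
  have a1 : pd_t f t s + pd_t g t s + (pd_s f t s + pd_s g t s) = pd_t f t s + pd_s f t s + (pd_t g t s + pd_s g t s) := by ring
  have a2 : pd_t f t s + pd_t g t s - (pd_s f t s + pd_s g t s) = pd_t f t s - pd_s f t s + (pd_t g t s - pd_s g t s) := by ring
  rw [a1, a2]
  linarith

lemma dxs_le (hM : 0 < M) (hr : IsTortoise M r) : ∃ K : ℝ, 0 ≤ K ∧ ∀ s, dd M r s * (s * xx r s) ^ 2 ≤ K := by
  obtain ⟨K, hK, hK2⟩ := exists_pow_exp (c := 2 * M / (3 * M + 0) ^ 2) (by positivity) 2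
  refine ⟨9 + K * (1 / (2 * M)) ^ 2, by positivity, fun s => ?_⟩
  have hD := dd_pos hM hr s
  have hD1 := dd_le hM hr s
  have hx := xx_pos hM hr s
  have hxl := xx_le hM hr s
  have p : 0 ≤ K * (1 / (2 * M)) ^ 2 := by positivity
  rcases le_total 0 s with h | h
  · have := s_xx_le hM hr h
    have h2 : 0 ≤ s * xx r s := by positivity
    have h3 : (s * xx r s) ^ 2 ≤ 3 ^ 2 := by gcongr
    nlinarith
  · have h4 := hK2 (-s) (by linarith)
    have e : -(2 * M / (3 * M + 0) ^ 2) * -s = 2 * M / (3 * M + 0) ^ 2 * (s - 0) := by ring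
    rw [e] at h4
    have h3 := dd_exp hM hr le_rfl h
    have h5 : s ^ 2 ≤ (1 + -s) ^ 2 := by nlinarith
    have h6 : dd M r s * s ^ 2 ≤ K := by
      calc dd M r s * s ^ 2 ≤ rexp (2 * M / (3 * M + 0) ^ 2 * (s - 0)) * (1 + -s) ^ 2 := by gcongr
        _ ≤ K := by linarith
    have : dd M r s * (s * xx r s) ^ 2 ≤ K * (1 / (2 * M)) ^ 2 := by
      calc dd M r s * (s * xx r s) ^ 2 = (dd M r s * s ^ 2) * xx r s ^ 2 := by ring
        _ ≤ _ := by gcongr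
    linarith

lemma eK_beta_le (hM : 0 < M) (hr : IsTortoise M r) {B : Bg} (hB : B.V = fun s => VV M (xx r s)) :
    ∃ K : ℝ, 0 ≤ K ∧ ∀ ξ : ℝ → ℝ → ℝ, Sm ξ → ∀ s,
      eK B (fun t s => s * dd M r s * ξ t s) 1 s ≤ K * E0Integrand M r ξ s := by
  obtain ⟨K, hK, h⟩ := dxs_le hM hr
  refine ⟨10 * (2 + 2 * K), by positivity, fun ξ hξ s => ?_⟩
  have hp := r_pos hM hr s
  have hD := dd_pos hM hr s
  have hD1 := dd_le hM hr s
  have hx := r_xx hM hr s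
  have hx0 := xx_pos hM hr s
  have hk := h s
  have hy0 := mul_pos hM hx0
  have hy := Mxx_le hM hr s
  have e1 : pd_t (fun t s => s * dd M r s * ξ t s) 1 s = s * dd M r s * pd_t ξ 1 s :=
    ((hξ.t 1 s).const_mul (s * dd M r s)).deriv
  have e2 : pd_s (fun t s => s * dd M r s * ξ t s) 1 s =
      (1 * dd M r s + s * (2 * M * xx r s ^ 2 * dd M r s)) * ξ 1 s + s * dd M r s * pd_s ξ 1 s :=
    (((hasDerivAt_id s).mul (dd_deriv hM hr s)).mul (hξ.s 1 s)).deriv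
  have := data_alg (s := s) (D := dd M r s) (ρ := r s) (K := 2 + 2 * K) (α := s * dd M r s)
    (γ := 1 * dd M r s + s * (2 * M * xx r s ^ 2 * dd M r s)) (V := VV M (xx r s))
    (a := pd_t ξ 1 s) (b := pd_s ξ 1 s) (ξ := ξ 1 s) hD hD1 hp (by positivity)
    (by
      have e : (s * dd M r s) ^ 2 = dd M r s * (dd M r s * (s * xx r s) ^ 2) * r s ^ 2 := by
        calc (s * dd M r s) ^ 2 = (s * dd M r s) ^ 2 * (r s * xx r s) ^ 2 := by rw [hx]; ring
          _ = _ := by ring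
      rw [e]
      apply mul_le_mul_of_nonneg_right _ (by positivity)
      have : 0 ≤ dd M r s * (s * xx r s) ^ 2 := by positivity
      nlinarith)
    (by
      have e : (1 * dd M r s + s * (2 * M * xx r s ^ 2 * dd M r s)) ^ 2
        = (dd M r s * (1 + 2 * (M * xx r s) * (s * xx r s)) ^ 2) * dd M r s := by ring
      rw [e]
      apply mul_le_mul_of_nonneg_right _ hD.le
      generalize s * xx r s = z at *
      generalize M * xx r s = y at *
      have hy2 : (2 * y) ^ 2 ≤ 1 := by nlinarith
      have h5 : (1 + 2 * y * z) ^ 2 ≤ 2 + 2 * ((2 * y) ^ 2 * z ^ 2) := by nlinarith [sq_nonneg (1 - 2 * y * z)]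
      have h6 : (2 * y) ^ 2 * z ^ 2 ≤ z ^ 2 := by nlinarith [sq_nonneg z]
      have h7 : dd M r s * (1 + 2 * y * z) ^ 2 ≤ dd M r s * (2 + 2 * z ^ 2) := by
        apply mul_le_mul_of_nonneg_left _ hD.le; linarith
      nlinarith)
    (by
      rw [VV_eq]
      have e : 2 * M * dd M r s * xx r s ^ 3 * (s * dd M r s) ^ 2
        = (2 * (M * xx r s)) * (dd M r s * (s * xx r s) ^ 2) * dd M r s * dd M r s := by ring
      rw [e]
      apply mul_le_mul_of_nonneg_right _ hD.le
      have q : 0 ≤ dd M r s * (s * xx r s) ^ 2 := by positivity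
      have q2 : 2 * (M * xx r s) * (dd M r s * (s * xx r s) ^ 2) ≤ 1 * K := by
        apply mul_le_mul (by linarith) hk q (by norm_num)
      have q3 : 0 ≤ 2 * (M * xx r s) * (dd M r s * (s * xx r s) ^ 2) := by positivity
      nlinarith)
  unfold eK E0Integrand
  rw [one_mu, e1, e2, hB]
  refine le_trans (le_of_eq ?_) (this.trans (le_of_eq ?_)) <;> ring

/-- energy bounds for the conformal energy of a solution and of its scaling derivative -/
lemma energy_bounds (hM : 0 < M) (hr : IsTortoise M r) {B : Bg} (hB : B.V = fun s => VV M (xx r s)) :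
    ∃ K : ℝ, 0 ≤ K ∧ ∀ φ : ℝ → ℝ → ℝ, IsWaveSol r φ → FinE0 M r φ → FinE0 M r (Svf φ) →
      ∀ G : ℝ, E0 M r φ ≤ G → E0 M r (Svf φ) ≤ G → ∀ t, 1 ≤ t → ∀ a b, a ≤ b →
      ∫ s in a..b, nD B (rm r φ) t s ≤ K * G ∧ ∫ s in a..b, nD B (Svf (rm r φ)) t s ≤ K * G := by
  obtain ⟨K, hK, hβ⟩ := eK_beta_le hM hr hB
  have hC := B.C1
  have q1 : 0 ≤ 7 * B.C ^ 2 * 10 := by positivity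
  have q2 : 0 ≤ 200000 * B.C ^ 7 * (30 + 2 * K) := by positivity
  refine ⟨7 * B.C ^ 2 * 10 + 200000 * B.C ^ 7 * (30 + 2 * K), by linarith, ?_⟩
  intro φ hφ f1 f2 G g1 g2 t ht a b hab
  have hs := wave_sm hφ
  have hsol := rm_sol hM hr hφ hB
  have hsupp : Supp (rm r φ) := rm_supp hφ.2.2
  have G0 : 0 ≤ G := (E0_nonneg hM hr φ).trans g1
  have i1 : ∀ ξ, FinE0 M r ξ → ∀ a b, IntervalIntegrable (E0Integrand M r ξ) volume a b :=
    fun ξ h a b => h.intervalIntegrable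
  have d1 : ∀ a b, a ≤ b → ∫ s in a..b, eK B (rm r φ) 1 s ≤ 10 * G := by
    intro a b hab
    have : ∫ s in a..b, eK B (rm r φ) 1 s ≤ ∫ s in a..b, 10 * E0Integrand M r φ s :=
      intervalIntegral.integral_mono_on hab (eK_intble hsol.sm _ _ _) ((i1 _ f1 a b).const_mul 10)
        (fun s _ => eK_rm_le hM hr hB hs s)
    rw [intervalIntegral.integral_const_mul] at this
    have := int_le_E0 hM hr f1 hab
    linarith
  have hSm : Sm (fun t s => s * dd M r s * φ t s) := by
    have : ContDiff ℝ (⊤ : ℕ∞) (fun s => s * dd M r s) := contDiff_id.mul (dd_smooth hM hr)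
    exact (Sm.ofs this).mul hs
  have eS : Svf (rm r φ) = fun t s => rm r (Svf φ) t s + s * dd M r s * φ t s := by
    ext t s; exact svf_rm hr hs t s
  have d2 : ∀ a b, a ≤ b → ∫ s in a..b, (eK B (Svf (rm r φ)) 1 s + eK B (rm r φ) 1 s) ≤ (30 + 2 * K) * G := by
    intro a b hab
    have h1 : ∫ s in a..b, (eK B (Svf (rm r φ)) 1 s + eK B (rm r φ) 1 s)
        ≤ ∫ s in a..b, (20 * E0Integrand M r (Svf φ) s + (10 + 2 * K) * E0Integrand M r φ s) := by
      apply intervalIntegral.integral_mono_on hab ((eK_intble hsol.sm.svf _ _ _).add (eK_intble hsol.sm _ _ _))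
        (((i1 _ f2 a b).const_mul 20).add ((i1 _ f1 a b).const_mul (10 + 2 * K)))
      intro s _
      rw [eS]
      have k1 := eK_add_le (B := B) (rm_sm hM hr hs.svf) hSm 1 s
      have k2 := eK_rm_le hM hr hB hs.svf s
      have k3 := hβ φ hs s
      have k4 := eK_rm_le hM hr hB hs s
      linarith
    rw [intervalIntegral.integral_add ((i1 _ f2 a b).const_mul 20) ((i1 _ f1 a b).const_mul (10 + 2 * K)),
      intervalIntegral.integral_const_mul, intervalIntegral.integral_const_mul] at h1
    have h2 := int_le_E0 hM hr f1 hab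
    have h3 := int_le_E0 hM hr f2 hab
    have h4 := mul_le_mul_of_nonneg_left (h2.trans g1) (show 0 ≤ 10 + 2 * K by linarith)
    linarith
  have r1 := prop1 hsol hsupp d1 ht hab
  have r2 := prop2 hsol hsupp d2 ht hab
  have m1 := mul_nonneg q1 G0
  have m2 := mul_nonneg q2 G0
  constructor
  · linarith
  · linarith
end

section
lemma cs_int {f : ℝ → ℝ} (hf : Continuous f) {a b : ℝ} (hab : a ≤ b) :
    (∫ x in a..b, f x) ^ 2 ≤ (b - a) * ∫ x in a..b, f x ^ 2 := by
  rcases hab.eq_or_lt with h | h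
  · subst h; simp
  · set m := (∫ x in a..b, f x) / (b - a) with hm
    have h0 : 0 ≤ ∫ x in a..b, (f x - m) ^ 2 :=
      intervalIntegral.integral_nonneg hab fun x _ => sq_nonneg _
    have e : ∀ x, (f x - m) ^ 2 = f x ^ 2 - 2 * m * f x + m ^ 2 := fun x => by ring
    simp only [e] at h0
    rw [intervalIntegral.integral_add, intervalIntegral.integral_sub, intervalIntegral.integral_const_mul,
      intervalIntegral.integral_const] at h0
    · have hb : 0 < b - a := by linarith
      have hI : ∫ x in a..b, f x = m * (b - a) := by rw [hm]; field_simp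
      rw [hI] at h0 ⊢
      simp only [smul_eq_mul] at h0
      nlinarith
    · exact (hf.pow 2).intervalIntegrable _ _
    · exact (hf.const_mul (2 * m)).intervalIntegrable _ _
    · exact ((hf.pow 2).sub (hf.const_mul (2 * m))).intervalIntegrable _ _
    · exact intervalIntegrable_const

/-- fundamental theorem of calculus plus Cauchy-Schwarz -/
lemma ftc_cs {ψ : ℝ → ℝ → ℝ} (h : Sm ψ) (t : ℝ) {a b : ℝ} (hab : a ≤ b) :
    (ψ t b - ψ t a) ^ 2 ≤ (b - a) * ∫ x in a..b, pd_s ψ t x ^ 2 := by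
  have c := h.ds.cont_right t
  have : ∫ x in a..b, pd_s ψ t x = ψ t b - ψ t a :=
    intervalIntegral.integral_eq_sub_of_hasDerivAt (fun x _ => h.s t x) (c.intervalIntegrable _ _)
  rw [← this]
  exact cs_int c hab

lemma exists_small {f : ℝ → ℝ} (hf : Continuous f) {N : ℝ} (h : ∫ x in (0:ℝ)..1, f x ≤ N) :
    ∃ x, 0 ≤ x ∧ x ≤ 1 ∧ f x ≤ N := by
  by_contra hc
  push Not at hc
  have h1 : ∫ x in (0:ℝ)..1, (fun _ => N) x < ∫ x in (0:ℝ)..1, f x := by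
    apply intervalIntegral.integral_lt_integral_of_continuousOn_of_le_of_exists_lt (by norm_num)
      continuousOn_const hf.continuousOn
    · intro x hx
      exact (hc x hx.1.le hx.2).le
    · exact ⟨0, ⟨le_rfl, by norm_num⟩, hc 0 le_rfl (by norm_num)⟩
  simp at h1
  linarith

lemma R0 {B : Bg} {ψ : ℝ → ℝ → ℝ} (h : Sm ψ) {N t : ℝ} (ht : 1 ≤ t)
    (hN : ∀ a b, a ≤ b → ∫ s in a..b, nD B ψ t s ≤ N) (s : ℝ) :
    |ψ t s| ≤ 7 * B.C * (1 + |s|) ^ 2 * √N * (√t)⁻¹ := by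
  have ht0 : 0 < t := by linarith
  have hC := B.C1
  have N0 : 0 ≤ N := by
    have := hN 0 0 le_rfl; simpa using this
  have cψ := h.cont_right t
  have cψs := h.ds.cont_right t
  have cV : Continuous B.V := B.smV.continuous
  have ck : Continuous (fun s : ℝ => (1 + s ^ 2)⁻¹) :=
    Continuous.inv₀ (by fun_prop) (fun s => by positivity)
  have iA : ∀ a b, a ≤ b → ∫ s in a..b, (B.V s * ψ t s ^ 2 + (1 + s ^ 2)⁻¹ * pd_s ψ t s ^ 2) ≤ 4 * N / t := by
    intro a b hab
    have h1 : ∫ s in a..b, t * (B.V s * ψ t s ^ 2 + (1 + s ^ 2)⁻¹ * pd_s ψ t s ^ 2)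
        ≤ ∫ s in a..b, 4 * nD B ψ t s := by
      apply intervalIntegral.integral_mono_on hab _ ((n_intble h ht0 a b).const_mul 4)
      · intro s _; exact n_ctrl ht0 s
      · apply Continuous.intervalIntegrable; fun_prop
    rw [intervalIntegral.integral_const_mul, intervalIntegral.integral_const_mul] at h1
    rw [le_div_iff₀ ht0]
    have := hN a b hab
    linarith
  obtain ⟨s0, hs0, hs1, hsm⟩ := exists_small (by fun_prop) (iA 0 1 (by norm_num))
  have w4 := B.W4 s0 (by linarith)
  have hV := B.Vpos s0
  have h1 : ψ t s0 ^ 2 ≤ 16 * B.C * (N / t) := by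
    have k0 : s0 ^ 2 ≤ 1 := by nlinarith
    have k1 : (1 + s0 ^ 2) ^ 2 ≤ 4 := by nlinarith [sq_nonneg s0]
    have k2 : 1 ≤ B.C * B.V s0 * 4 := w4.trans (by gcongr)
    have k3 : 0 ≤ (1 + s0 ^ 2)⁻¹ * pd_s ψ t s0 ^ 2 := by positivity
    have k4 := mul_le_mul_of_nonneg_right k2 (sq_nonneg (ψ t s0))
    have e : 4 * N / t = 4 * (N / t) := by ring
    rw [e] at hsm
    have k5 : 4 * B.C * (B.V s0 * ψ t s0 ^ 2) ≤ 4 * B.C * (4 * (N / t)) := by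
      apply mul_le_mul_of_nonneg_left _ (by linarith); linarith
    linarith
  have gen : ∀ a b, a ≤ b → b - a ≤ 1 + |s| → (∀ x, a ≤ x → x ≤ b → |x| ≤ 1 + |s|) →
      (ψ t b - ψ t a) ^ 2 ≤ 8 * (1 + |s|) ^ 3 * (N / t) := by
    intro a b hab hl hx
    have f1 := ftc_cs h t hab
    have f2 : ∫ x in a..b, pd_s ψ t x ^ 2 ≤ ∫ x in a..b, 2 * (1 + |s|) ^ 2 *
        (B.V x * ψ t x ^ 2 + (1 + x ^ 2)⁻¹ * pd_s ψ t x ^ 2) := by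
      apply intervalIntegral.integral_mono_on hab
      · exact (cψs.pow 2).intervalIntegrable _ _
      · apply Continuous.intervalIntegrable; fun_prop
      · intro x hxx
        have m1 := hx x hxx.1 hxx.2
        have m2 : 1 + x ^ 2 ≤ 2 * (1 + |s|) ^ 2 := by
          rw [← sq_abs x]
          nlinarith [abs_nonneg x, abs_nonneg s]
        have m3 : 0 ≤ B.V x * ψ t x ^ 2 := by have := B.Vpos x; positivity
        have m4 : pd_s ψ t x ^ 2 = (1 + x ^ 2) * ((1 + x ^ 2)⁻¹ * pd_s ψ t x ^ 2) := by field_simp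
        have m5 : 0 ≤ (1 + x ^ 2)⁻¹ * pd_s ψ t x ^ 2 := by positivity
        calc pd_s ψ t x ^ 2 = (1 + x ^ 2) * ((1 + x ^ 2)⁻¹ * pd_s ψ t x ^ 2) := m4
          _ ≤ 2 * (1 + |s|) ^ 2 * ((1 + x ^ 2)⁻¹ * pd_s ψ t x ^ 2) := by gcongr
          _ ≤ _ := by gcongr; linarith
    rw [intervalIntegral.integral_const_mul] at f2
    have f3 := iA a b hab
    have e : 4 * N / t = 4 * (N / t) := by ring
    rw [e] at f3
    have hs' := abs_nonneg s
    calc (ψ t b - ψ t a) ^ 2 ≤ (b - a) * ∫ x in a..b, pd_s ψ t x ^ 2 := f1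
      _ ≤ (b - a) * (2 * (1 + |s|) ^ 2 * (4 * (N / t))) := by
          apply mul_le_mul_of_nonneg_left _ (by linarith)
          exact f2.trans (mul_le_mul_of_nonneg_left f3 (by positivity))
      _ ≤ (1 + |s|) * (2 * (1 + |s|) ^ 2 * (4 * (N / t))) := by
          apply mul_le_mul_of_nonneg_right hl; positivity
      _ = _ := by ring
  have h2 : (ψ t s - ψ t s0) ^ 2 ≤ 8 * (1 + |s|) ^ 3 * (N / t) := by
    have hsa := le_abs_self s
    have hsn := neg_abs_le s
    rcases le_total s0 s with hh | hh
    · apply gen s0 s hh (by linarith)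
      intro x hx1 hx2
      rw [abs_le]; constructor <;> linarith
    · have := gen s s0 hh (by linarith) (by
        intro x hx1 hx2
        rw [abs_le]; constructor <;> linarith)
      nlinarith
  have h3 : ψ t s ^ 2 ≤ 48 * B.C ^ 2 * (1 + |s|) ^ 4 * (N / t) := by
    have y0 := abs_nonneg s
    have n0 : 0 ≤ N / t := by positivity
    have a1 : ψ t s ^ 2 ≤ 2 * (ψ t s - ψ t s0) ^ 2 + 2 * ψ t s0 ^ 2 := by
      nlinarith [sq_nonneg (ψ t s - 2 * ψ t s0)]
    have a2 : (1 + |s|) ^ 3 ≤ (1 + |s|) ^ 4 := pow_le_pow_right₀ (by linarith) (by norm_num)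
    have a3 : (1 + |s|) ^ 4 ≤ B.C ^ 2 * (1 + |s|) ^ 4 := by
      have : 1 ≤ B.C ^ 2 := one_le_pow₀ hC
      have : 0 ≤ (1 + |s|) ^ 4 := by positivity
      nlinarith
    have a4 : B.C ≤ B.C ^ 2 * (1 + |s|) ^ 4 := by
      have m1 : 1 ≤ (1 + |s|) ^ 4 := one_le_pow₀ (by linarith)
      have m2 : B.C ≤ B.C ^ 2 := by nlinarith
      nlinarith
    have a5 := mul_le_mul_of_nonneg_right (a2.trans a3) n0
    have a6 := mul_le_mul_of_nonneg_right a4 n0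
    linarith
  apply abs_le_of_sq_le_sq _ (by positivity)
  have e : (7 * B.C * (1 + |s|) ^ 2 * √N * (√t)⁻¹) ^ 2 = 49 * B.C ^ 2 * (1 + |s|) ^ 4 * (N / t) := by
    rw [mul_pow, mul_pow, inv_pow, Real.sq_sqrt N0, Real.sq_sqrt ht0.le]
    rw [div_eq_mul_inv]; ring
  rw [e]
  have : 0 ≤ B.C ^ 2 * (1 + |s|) ^ 4 * (N / t) := by positivity
  linarith
end

section
def uu (t : ℝ) : ℝ := (√t)⁻¹

lemma uu_pos {t : ℝ} (ht : 0 < t) : 0 < uu t := inv_pos.2 (Real.sqrt_pos.2 ht)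

lemma uu_le {a t L : ℝ} (ha : 0 < a) (hL : 1 ≤ L) (h : a ≤ t * L) : uu t ≤ L * uu a := by
  have ht : 0 < t := by
    by_contra hc
    push Not at hc
    nlinarith
  have h1 : √a ≤ √t * L := by
    calc √a ≤ √(t * L) := Real.sqrt_le_sqrt h
      _ = √t * √L := Real.sqrt_mul ht.le L
      _ ≤ √t * L := by
          gcongr
          rw [Real.sqrt_le_left (by linarith)]
          nlinarith
  unfold uu
  have h2 := Real.sqrt_pos.2 ha
  have h3 := Real.sqrt_pos.2 ht
  rw [← div_eq_mul_inv, inv_eq_one_div, div_le_div_iff₀ h3 h2]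
  linarith

lemma uu_sq {t : ℝ} (ht : 0 < t) : uu t ^ 2 = t⁻¹ := by
  unfold uu; rw [inv_pow, Real.sq_sqrt ht.le]

lemma pow_exp_bound {γ S : ℝ} (hγ : 0 < γ) (hS : 0 ≤ S) (n : ℕ) : ∃ K : ℝ, 1 ≤ K ∧ ∀ σ, σ ≤ S →
    (1 + |σ|) ^ n * rexp (γ * σ) ≤ K := by
  obtain ⟨K, hK, h⟩ := exists_pow_exp hγ n
  have p : 0 ≤ (1 + S) ^ n * rexp (γ * S) := by positivity
  refine ⟨K + (1 + S) ^ n * rexp (γ * S), by linarith, fun σ hσ => ?_⟩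
  rcases le_total 0 σ with h0 | h0
  · rw [abs_of_nonneg h0]
    have : (1 + σ) ^ n * rexp (γ * σ) ≤ (1 + S) ^ n * rexp (γ * S) := by gcongr
    linarith
  · rw [abs_of_nonpos h0]
    have := h (-σ) (by linarith)
    have e : -γ * -σ = γ * σ := by ring
    rw [e] at this
    linarith

lemma decay_conv {γ S : ℝ} (hγ : 0 < γ) (hS : 0 ≤ S) (m k : ℕ) : ∃ K : ℝ, 1 ≤ K ∧
    ∀ t τ σ s : ℝ, 1 ≤ τ → σ ≤ s → s ≤ S → t = τ + s - σ →
    (1 + |σ|) ^ m * rexp (γ * σ) * uu τ ^ k ≤ K * rexp (γ / 2 * σ) * uu t ^ k := by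
  obtain ⟨K, hK, h⟩ := pow_exp_bound (half_pos hγ) hS (m + k)
  have hS1 : 1 ≤ (1 + S) ^ k := one_le_pow₀ (by linarith)
  refine ⟨K * (1 + S) ^ k, by nlinarith, ?_⟩
  intro t τ σ s hτ hσ hs ht
  have y0 := abs_nonneg σ
  have hL : 1 + s - σ ≤ (1 + S) * (1 + |σ|) := by
    have := neg_abs_le σ
    nlinarith
  have h1 : uu τ ≤ (1 + S) * (1 + |σ|) * uu t := by
    apply uu_le (by linarith) (by nlinarith)
    have : τ * (1 + s - σ) ≤ τ * ((1 + S) * (1 + |σ|)) := by gcongr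
    nlinarith
  have hu0 := (uu_pos (show 0 < τ by linarith)).le
  have hu1 := (uu_pos (show 0 < t by linarith)).le
  have h2 : uu τ ^ k ≤ ((1 + S) * (1 + |σ|) * uu t) ^ k := by gcongr
  have e : rexp (γ * σ) = rexp (γ / 2 * σ) * rexp (γ / 2 * σ) := by
    rw [← Real.exp_add]; congr 1; ring
  calc (1 + |σ|) ^ m * rexp (γ * σ) * uu τ ^ k
      ≤ (1 + |σ|) ^ m * rexp (γ * σ) * ((1 + S) * (1 + |σ|) * uu t) ^ k := by gcongr
    _ = ((1 + |σ|) ^ (m + k) * rexp (γ / 2 * σ)) * ((1 + S) ^ k * rexp (γ / 2 * σ) * uu t ^ k) := by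
        rw [e, mul_pow, mul_pow, pow_add]; ring
    _ ≤ K * ((1 + S) ^ k * rexp (γ / 2 * σ) * uu t ^ k) := by
        apply mul_le_mul_of_nonneg_right (h σ (by linarith)); positivity
    _ = _ := by ring

variable {M : ℝ} {r : ℝ → ℝ} {φ : ℝ → ℝ → ℝ}

def QQ (φ : ℝ → ℝ → ℝ) : ℝ → ℝ → ℝ := fun t s => pd_t φ t s - pd_s φ t s

lemma QQ_sm (h : Sm φ) : Sm (QQ φ) := ContDiff.sub h.dt h.ds

lemma QQ_v (hM : 0 < M) (hr : IsTortoise M r) (h : IsWaveSol r φ) (t s : ℝ) :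
    pd_t (QQ φ) t s + pd_s (QQ φ) t s = 2 * dd M r s * xx r s * pd_s φ t s := by
  have hs := wave_sm h
  have e1 : pd_t (QQ φ) t s = pd_t (pd_t φ) t s - pd_t (pd_s φ) t s := ((hs.dt.t t s).sub (hs.ds.t t s)).deriv
  have e2 : pd_s (QQ φ) t s = pd_s (pd_t φ) t s - pd_s (pd_s φ) t s := ((hs.dt.s t s).sub (hs.ds.s t s)).deriv
  rw [e1, e2, wave_eq hM hr h, hs.comm]
  ring

lemma transport_deriv (hM : 0 < M) (hr : IsTortoise M r) (h : IsWaveSol r φ) (d τ : ℝ) :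
    HasDerivAt (fun τ => r (d + τ) ^ 2 * QQ φ τ (d + τ))
      (2 * r (d + τ) * dd M r (d + τ) * pd_t φ τ (d + τ)) τ := by
  have hs := wave_sm h
  have g2 : HasDerivAt (fun τ => d + τ) 1 τ := by simpa using (hasDerivAt_id τ).const_add d
  have l := hasDeriv_line (f := QQ φ) (γ₁ := fun τ => τ) (γ₂ := fun τ => d + τ) (a := 1) (b := 1) (τ := τ)
    ((QQ_sm hs).diff _ _) (hasDerivAt_id τ) g2
  have hr2 := ((r_deriv hr (d + τ)).comp τ g2).pow 2
  have := hr2.mul l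
  refine (this.congr_deriv ?_)
  have hx := r_xx hM hr (d + τ)
  have v := QQ_v hM hr h τ (d + τ)
  simp
  rw [v]
  have e : r (d + τ) ^ 2 * (2 * dd M r (d + τ) * xx r (d + τ) * pd_s φ τ (d + τ))
    = 2 * r (d + τ) * dd M r (d + τ) * (r (d + τ) * xx r (d + τ)) * pd_s φ τ (d + τ) := by ring
  rw [e, hx]
  unfold QQ
  ring

/-- exponential rate -/
def gam (M S : ℝ) : ℝ := M / (3 * M + S) ^ 2

lemma dd_gam (hM : 0 < M) (hr : IsTortoise M r) {S s : ℝ} (hS : 0 ≤ S) (hs : s ≤ S) :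
    √(dd M r s) ≤ rexp (gam M S * s) := by
  have h1 := dd_exp hM hr hS hs
  have e : rexp (2 * M / (3 * M + S) ^ 2 * (s - S)) ≤ (rexp (gam M S * s)) ^ 2 := by
    rw [← Real.exp_nat_mul]
    apply Real.exp_le_exp.2
    unfold gam
    push_cast
    have : 0 ≤ 2 * M / (3 * M + S) ^ 2 * S := by positivity
    have e : 2 * M / (3 * M + S) ^ 2 * (s - S) = 2 * (M / (3 * M + S) ^ 2 * s) - 2 * M / (3 * M + S) ^ 2 * S := by ring
    rw [e]; linarith
  rw [Real.sqrt_le_left (Real.exp_pos _).le]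
  linarith

lemma dd_gam' (hM : 0 < M) (hr : IsTortoise M r) {S s : ℝ} (hS : 0 ≤ S) (hs : s ≤ S) :
    dd M r s ≤ rexp (gam M S * s) := by
  refine le_trans ?_ (dd_gam hM hr hS hs)
  have h1 := dd_pos hM hr s
  have h2 := dd_le hM hr s
  apply Real.le_sqrt_of_sq_le
  nlinarith

lemma exp_int_le {c : ℝ} (hc : 0 < c) (d a b : ℝ) :
    ∫ τ in a..b, rexp (c * (d + τ)) ≤ c⁻¹ * rexp (c * (d + b)) := by
  have hd : ∀ τ ∈ Set.uIcc a b, HasDerivAt (fun τ => c⁻¹ * rexp (c * (d + τ))) (rexp (c * (d + τ))) τ := by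
    intro τ _
    have g2 : HasDerivAt (fun τ => c * (d + τ)) c τ := by
      simpa using ((hasDerivAt_id τ).const_add d).const_mul c
    refine (g2.exp.const_mul c⁻¹).congr_deriv ?_
    field_simp
  rw [intervalIntegral.integral_eq_sub_of_hasDerivAt hd (by apply Continuous.intervalIntegrable; fun_prop)]
  have : 0 ≤ c⁻¹ * rexp (c * (d + a)) := by positivity
  linarith

lemma transport (hM : 0 < M) (hr : IsTortoise M r) {S : ℝ} (hS : 0 ≤ S) (m k : ℕ) :
    ∃ K : ℝ, 1 ≤ K ∧ ∀ φ, IsWaveSol r φ → ∀ A : ℝ, 0 ≤ A →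
    (∀ σ, σ ≤ S → |QQ φ 1 σ| ≤ A * rexp (gam M S * σ)) →
    (∀ τ σ, 1 ≤ τ → σ ≤ S → |pd_t φ τ σ| ≤ A * (1 + |σ|) ^ m * uu τ ^ k) →
    ∀ t s, 1 ≤ t → s ≤ S → |QQ φ t s| ≤ K * A * rexp (gam M S / 2 * s) * uu t ^ k := by
  set γ := gam M S with hγ
  have g0 : 0 < γ := by rw [hγ]; unfold gam; positivity
  obtain ⟨K0, hK0, h0⟩ := decay_conv g0 hS 0 k
  obtain ⟨K1, hK1, h1⟩ := decay_conv g0 hS m k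
  set R := 3 * M + S with hR
  have R0 : 0 < R := by positivity
  have q : 0 ≤ (R ^ 2 * K0 + 2 * R * K1 * (γ / 2)⁻¹) / (4 * M ^ 2) := by positivity
  refine ⟨1 + (R ^ 2 * K0 + 2 * R * K1 * (γ / 2)⁻¹) / (4 * M ^ 2), by linarith, ?_⟩
  intro φ hφ A hA hdata hdec t s ht hs
  have hsm := wave_sm hφ
  have rle : ∀ σ, σ ≤ S → r σ ≤ R := fun σ h => (r_mono hM hr h).trans (r_le hM hr hS)
  set d := s - t with hd
  have u0 := (uu_pos (show 0 < t by linarith)).le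
  have ftc : ∫ τ in (1:ℝ)..t, 2 * r (d + τ) * dd M r (d + τ) * pd_t φ τ (d + τ)
      = r (d + t) ^ 2 * QQ φ t (d + t) - r (d + 1) ^ 2 * QQ φ 1 (d + 1) := by
    apply intervalIntegral.integral_eq_sub_of_hasDerivAt
      (f := fun τ => r (d + τ) ^ 2 * QQ φ τ (d + τ)) (fun τ _ => transport_deriv hM hr hφ d τ)
    apply Continuous.intervalIntegrable
    have c1 : Continuous (Function.uncurry (pd_t φ)) := hsm.dt.continuous
    have c2 : Continuous (fun τ => pd_t φ τ (d + τ)) :=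
      c1.comp (continuous_id.prodMk (continuous_const.add continuous_id))
    have c3 := (r_smooth hM hr).continuous
    have c4 := (dd_smooth hM hr).continuous
    fun_prop
  have b1 : |∫ τ in (1:ℝ)..t, 2 * r (d + τ) * dd M r (d + τ) * pd_t φ τ (d + τ)|
      ≤ ∫ τ in (1:ℝ)..t, (2 * R * A * K1 * uu t ^ k) * rexp (γ / 2 * (d + τ)) := by
    rw [← Real.norm_eq_abs]
    apply intervalIntegral.norm_integral_le_of_norm_le ht
    · apply Filter.Eventually.of_forall
      intro τ hτ
      rw [Real.norm_eq_abs]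
      have hσ : d + τ ≤ S := by have := hτ.2; linarith
      have k1 := rle _ hσ
      have k2 := r_pos hM hr (d + τ)
      have k3 := dd_pos hM hr (d + τ)
      have k4 := dd_gam' hM hr hS hσ
      have k5 := hdec τ (d + τ) hτ.1.le hσ
      have k6 := h1 t τ (d + τ) s hτ.1.le (by have := hτ.2; linarith) hs (by rw [hd]; ring)
      rw [abs_mul, abs_of_pos (by positivity)]
      calc 2 * r (d + τ) * dd M r (d + τ) * |pd_t φ τ (d + τ)|
          ≤ 2 * R * rexp (γ * (d + τ)) * (A * (1 + |d + τ|) ^ m * uu τ ^ k) := by gcongr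
        _ = 2 * R * A * ((1 + |d + τ|) ^ m * rexp (γ * (d + τ)) * uu τ ^ k) := by ring
        _ ≤ 2 * R * A * (K1 * rexp (γ / 2 * (d + τ)) * uu t ^ k) := by gcongr
        _ = _ := by ring
    · apply Continuous.intervalIntegrable; fun_prop
  rw [intervalIntegral.integral_const_mul] at b1
  have b2 := exp_int_le (half_pos g0) d 1 t
  have b3 : |r (d + 1) ^ 2 * QQ φ 1 (d + 1)| ≤ R ^ 2 * (A * (K0 * rexp (γ / 2 * s) * uu t ^ k)) := by
    have hσ : d + 1 ≤ S := by linarith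
    have k1 := rle _ hσ
    have k2 := r_pos hM hr (d + 1)
    have k5 := hdata (d + 1) hσ
    have k6 := h0 t 1 (d + 1) s le_rfl (by linarith) hs (by rw [hd]; ring)
    have k7 : uu 1 = 1 := by simp [uu]
    rw [k7] at k6
    simp only [pow_zero, one_pow, mul_one, one_mul] at k6
    have k8 : rexp (γ / 2 * (d + 1)) ≤ rexp (γ / 2 * s) := by
      apply Real.exp_le_exp.2; apply mul_le_mul_of_nonneg_left _ (by linarith); linarith
    rw [abs_mul, abs_of_pos (by positivity)]
    calc r (d + 1) ^ 2 * |QQ φ 1 (d + 1)| ≤ R ^ 2 * (A * rexp (γ * (d + 1))) := by gcongr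
      _ ≤ R ^ 2 * (A * (K0 * rexp (γ / 2 * (d + 1)) * uu t ^ k)) := by gcongr
      _ ≤ _ := by gcongr
  have e0 : d + t = s := by rw [hd]; ring
  rw [e0] at ftc b2
  have b4 : |r s ^ 2 * QQ φ t s| ≤ (R ^ 2 * K0 + 2 * R * K1 * (γ / 2)⁻¹) * (A * rexp (γ / 2 * s) * uu t ^ k) := by
    have e1 : r s ^ 2 * QQ φ t s = r (d + 1) ^ 2 * QQ φ 1 (d + 1)
      + ∫ τ in (1:ℝ)..t, 2 * r (d + τ) * dd M r (d + τ) * pd_t φ τ (d + τ) := by linarith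
    rw [e1]
    refine (abs_add_le _ _).trans ?_
    have b5 := mul_le_mul_of_nonneg_left b2 (show 0 ≤ 2 * R * A * K1 * uu t ^ k by positivity)
    linarith
  have rs := hr.1 s
  have hrr : 4 * M ^ 2 ≤ r s ^ 2 := by nlinarith
  rw [abs_mul, abs_of_nonneg (sq_nonneg _)] at b4
  have b6 : |QQ φ t s| ≤ (R ^ 2 * K0 + 2 * R * K1 * (γ / 2)⁻¹) / (4 * M ^ 2) * (A * rexp (γ / 2 * s) * uu t ^ k) := by
    rw [div_mul_eq_mul_div, le_div_iff₀ (by positivity)]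
    have := mul_le_mul_of_nonneg_right hrr (abs_nonneg (QQ φ t s))
    linarith
  have b7 : 0 ≤ A * rexp (γ / 2 * s) * uu t ^ k := by positivity
  linarith
end

section
variable {M : ℝ} {r : ℝ → ℝ} {φ : ℝ → ℝ → ℝ}

lemma unit_bound {g g' e : ℝ → ℝ} (hd : ∀ x, HasDerivAt g (g' x) x) (he : ∀ a b, IntervalIntegrable e volume a b)
    (h0 : ∀ x, 0 ≤ e x) (h1 : ∀ x, g x ≤ e x) (h2 : ∀ x, g' x ≤ e x) {N : ℝ}
    (hN : ∀ a b, a ≤ b → ∫ x in a..b, e x ≤ N) (σ : ℝ) : g σ ≤ 2 * N := by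
  have cg : Continuous g := continuous_iff_continuousAt.2 fun x => (hd x).continuousAt
  have i1 : ∫ x in (0:ℝ)..1, g (x + (σ - 1)) ≤ N := by
    rw [intervalIntegral.integral_comp_add_right g]
    refine le_trans ?_ (hN (0 + (σ - 1)) (1 + (σ - 1)) (by linarith))
    exact intervalIntegral.integral_mono_on (by linarith) (cg.intervalIntegrable _ _) (he _ _) fun x _ => h1 x
  obtain ⟨x, hx0, hx1, hx⟩ := exists_small (by fun_prop) i1
  have hle : x + (σ - 1) ≤ σ := by linarith
  have := intervalIntegral.sub_le_integral_of_hasDeriv_right_of_le hle cg.continuousOn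
    (fun y _ => (hd y).hasDerivWithinAt) ((intervalIntegrable_iff_integrableOn_Icc_of_le hle).1 (he _ _)) (fun y _ => h2 y)
  have := hN _ _ hle

  linarith

lemma e0_low (hM : 0 < M) (hr : IsTortoise M r) (ξ : ℝ → ℝ → ℝ) (s : ℝ) :
    4 * M ^ 2 * ((dd M r s)⁻¹ * (QQ ξ 1 s) ^ 2 + (pd_t ξ 1 s + pd_s ξ 1 s) ^ 2) ≤ E0Integrand M r ξ s := by
  unfold E0Integrand QQ
  rw [one_mu]
  have hD := dd_pos hM hr s
  have hp := r_pos hM hr s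
  have h4 : 4 * M ^ 2 ≤ r s ^ 2 := by have := hr.1 s; nlinarith
  rw [mul_comm (4 * M ^ 2)]
  apply mul_le_mul _ h4 (by positivity) (by positivity)
  have a1 : 0 ≤ ((1 - s) / 2) ^ 2 * (pd_t ξ 1 s - pd_s ξ 1 s) ^ 2 := by positivity
  have a2 : 0 ≤ ((1 + s) / 2) ^ 2 * (pd_t ξ 1 s + pd_s ξ 1 s) ^ 2 := by positivity
  have a3 : 0 ≤ dd M r s * ((1 + s ^ 2) / (r s) ^ 2) * (ξ 1 s) ^ 2 := by positivity
  linarith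

lemma e0_low1 (hM : 0 < M) (hr : IsTortoise M r) (ξ : ℝ → ℝ → ℝ) (s : ℝ) :
    (dd M r s)⁻¹ * (QQ ξ 1 s) ^ 2 ≤ (1 / M ^ 2) * E0Integrand M r ξ s := by
  have h := e0_low hM hr ξ s
  rw [one_div_mul_eq_div, le_div_iff₀ (by positivity)]
  have hD := dd_pos hM hr s
  have a1 : 0 ≤ (dd M r s)⁻¹ * (QQ ξ 1 s) ^ 2 * M ^ 2 := by positivity
  have a2 : 0 ≤ (pd_t ξ 1 s + pd_s ξ 1 s) ^ 2 * M ^ 2 := by positivity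
  linarith

lemma e0_low2 (hM : 0 < M) (hr : IsTortoise M r) (ξ : ℝ → ℝ → ℝ) (s : ℝ) :
    pd_t ξ 1 s ^ 2 + pd_s ξ 1 s ^ 2 ≤ (1 / M ^ 2) * E0Integrand M r ξ s := by
  have h := e0_low hM hr ξ s
  rw [one_div_mul_eq_div, le_div_iff₀ (by positivity)]
  have hD := dd_pos hM hr s
  have hi : 1 ≤ (dd M r s)⁻¹ := (one_le_inv₀ hD).2 (dd_le hM hr s)
  have a1 : (QQ ξ 1 s) ^ 2 ≤ (dd M r s)⁻¹ * (QQ ξ 1 s) ^ 2 := le_mul_of_one_le_left (sq_nonneg _) hi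
  have a3 : 4 * M ^ 2 * ((QQ ξ 1 s) ^ 2 + (pd_t ξ 1 s + pd_s ξ 1 s) ^ 2) ≤ E0Integrand M r ξ s := by
    refine le_trans ?_ h
    gcongr
  unfold QQ at a3
  have : 0 ≤ M ^ 2 * (pd_t ξ 1 s ^ 2 + pd_s ξ 1 s ^ 2) := by positivity
  nlinarith

lemma QQ_s (hM : 0 < M) (hr : IsTortoise M r) (h : IsWaveSol r φ) (t s : ℝ) :
    pd_s (QQ φ) t s = - QQ (pd_t φ) t s + 2 * dd M r s * xx r s * pd_s φ t s := by
  have hs := wave_sm h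
  have e2 : pd_s (QQ φ) t s = pd_s (pd_t φ) t s - pd_s (pd_s φ) t s := ((hs.dt.s t s).sub (hs.ds.s t s)).deriv
  have := wave_eq hM hr h t s
  unfold QQ at *
  linarith

lemma e_int (hM : 0 < M) (hr : IsTortoise M r) {ξ ζ : ℝ → ℝ → ℝ} (h1 : FinE0 M r ξ) (h2 : FinE0 M r ζ)
    {K G : ℝ} (hK : 0 ≤ K) (g1 : E0 M r ξ ≤ G) (g2 : E0 M r ζ ≤ G) {a b : ℝ} (hab : a ≤ b) :
    ∫ x in a..b, K * (E0Integrand M r ξ x + E0Integrand M r ζ x) ≤ K * (2 * G) := by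
  rw [intervalIntegral.integral_const_mul, intervalIntegral.integral_add h1.intervalIntegrable h2.intervalIntegrable]
  have a1 := int_le_E0 hM hr h1 hab
  have a2 := int_le_E0 hM hr h2 hab
  apply mul_le_mul_of_nonneg_left _ hK
  linarith

lemma data_alg1 {D Q q p x m c : ℝ} (hD : 0 < D) (hD1 : D ≤ 1) (hx : x ^ 2 ≤ m) (hc : 0 ≤ c) :
    2 * Q * (-q + 2 * D * x * p) * D⁻¹ - Q ^ 2 * D⁻¹ * c ≤
      2 * (D⁻¹ * Q ^ 2) + D⁻¹ * q ^ 2 + 4 * m * p ^ 2 := by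
  have e : 2 * Q * (-q + 2 * D * x * p) * D⁻¹ = - 2 * Q * q * D⁻¹ + 4 * Q * x * p := by
    field_simp; ring
  have h1 : -2 * Q * q * D⁻¹ ≤ D⁻¹ * Q ^ 2 + D⁻¹ * q ^ 2 := by
    have : 0 ≤ D⁻¹ * (Q + q) ^ 2 := by positivity
    nlinarith
  have h2 : Q ^ 2 ≤ D⁻¹ * Q ^ 2 := le_mul_of_one_le_left (sq_nonneg _) ((one_le_inv₀ hD).2 hD1)
  have h3 : 4 * Q * x * p ≤ Q ^ 2 + 4 * (x ^ 2 * p ^ 2) := by nlinarith [sq_nonneg (Q - 2 * x * p)]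
  have h4 : x ^ 2 * p ^ 2 ≤ m * p ^ 2 := mul_le_mul_of_nonneg_right hx (sq_nonneg _)
  have h5 : 0 ≤ Q ^ 2 * D⁻¹ * c := by positivity
  rw [e]; linarith

lemma data_Q (hM : 0 < M) (hr : IsTortoise M r) (h : IsWaveSol r φ) (h1 : FinE0 M r φ) (h2 : FinE0 M r (pd_t φ))
    {G : ℝ} (g1 : E0 M r φ ≤ G) (g2 : E0 M r (pd_t φ) ≤ G) (σ : ℝ) :
    (dd M r σ)⁻¹ * QQ φ 1 σ ^ 2 ≤ 4 * ((2 + 1 / M ^ 2) * (1 / M ^ 2)) * G := by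
  set K := (2 + 1 / M ^ 2) * (1 / M ^ 2) with hK
  have K0 : 0 ≤ K := by positivity
  have hQ := QQ_sm (wave_sm h)
  have := unit_bound (g := fun s => (dd M r s)⁻¹ * QQ φ 1 s ^ 2)
    (g' := fun s => 2 * QQ φ 1 s * (- QQ (pd_t φ) 1 s + 2 * dd M r s * xx r s * pd_s φ 1 s) * (dd M r s)⁻¹
      - QQ φ 1 s ^ 2 * (dd M r s)⁻¹ * (2 * M * xx r s ^ 2))
    (e := fun x => K * (E0Integrand M r φ x + E0Integrand M r (pd_t φ) x)) (N := K * (2 * G)) ?_ ?_ ?_ ?_ ?_ ?_ σ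
  ·
    linarith
  · intro s
    have hD := dd_pos hM hr s
    have d1 := ((dd_deriv hM hr s).inv hD.ne').mul ((hQ.s 1 s).pow 2)
    rw [QQ_s hM hr h] at d1
    refine d1.congr_deriv ?_
    simp only [Pi.inv_apply, Pi.pow_apply]
    push_cast
    field_simp
    ring
  · intro a b
    exact ((h1.add h2).const_mul K).intervalIntegrable
  · intro x
    have := E0I_nonneg hM hr φ x
    have := E0I_nonneg hM hr (pd_t φ) x
    positivity
  · intro x
    have a1 := E0I_nonneg hM hr φ x
    have a2 := E0I_nonneg hM hr (pd_t φ) x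
    refine (e0_low1 hM hr φ x).trans ?_
    have : 1 / M ^ 2 ≤ K := by
      rw [hK]; apply le_mul_of_one_le_left (by positivity)
      have : 0 ≤ 1 / M ^ 2 := by positivity
      linarith
    calc _ ≤ K * E0Integrand M r φ x := by gcongr
      _ ≤ _ := by gcongr; linarith
  · intro s
    have hD := dd_pos hM hr s
    have hx := xx_pos hM hr s
    have hxl : xx r s ^ 2 ≤ 1 / M ^ 2 * (1 / 4) := by
      have := pow_le_pow_left₀ hx.le (xx_le hM hr s) 2
      refine this.trans (le_of_eq ?_)
      field_simp; norm_num
    refine (data_alg1 hD (dd_le hM hr s) hxl (by positivity)).trans ?_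
    have b1 := e0_low1 hM hr φ s
    have b2 := e0_low1 hM hr (pd_t φ) s
    have b3 := e0_low2 hM hr φ s
    have b4 := sq_nonneg (pd_t φ 1 s)
    have a2 := E0I_nonneg hM hr (pd_t φ) s
    have i0 : 0 ≤ 1 / M ^ 2 := by positivity
    simp only [hK]
    generalize 1 / M ^ 2 = i at *
    have c1 : i * pd_s φ 1 s ^ 2 ≤ i * (i * E0Integrand M r φ s) := by
      apply mul_le_mul_of_nonneg_left _ i0; linarith
    have c2 : 0 ≤ i * E0Integrand M r (pd_t φ) s := by positivity
    have c3 : 0 ≤ i * (i * E0Integrand M r (pd_t φ) s) := by positivity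
    linarith
  · intro a b hab
    exact e_int hM hr h1 h2 K0 g1 g2 hab

lemma data_t (hM : 0 < M) (hr : IsTortoise M r) (h : IsWaveSol r φ) (h1 : FinE0 M r φ) (h2 : FinE0 M r (pd_t φ))
    {G : ℝ} (g1 : E0 M r φ ≤ G) (g2 : E0 M r (pd_t φ) ≤ G) (σ : ℝ) :
    pd_t φ 1 σ ^ 2 ≤ 4 * (1 / M ^ 2) * G := by
  set K := 1 / M ^ 2 with hK
  have K0 : 0 ≤ K := by positivity
  have hs := wave_sm h
  have := unit_bound (g := fun s => pd_t φ 1 s ^ 2)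
    (g' := fun s => 2 * pd_t φ 1 s * pd_s (pd_t φ) 1 s)
    (e := fun x => K * (E0Integrand M r φ x + E0Integrand M r (pd_t φ) x)) (N := K * (2 * G)) ?_ ?_ ?_ ?_ ?_ ?_ σ
  ·
    linarith
  · intro s
    have d1 := (hs.dt.s 1 s).pow 2
    refine d1.congr_deriv ?_
    push_cast
    ring
  · intro a b
    exact ((h1.add h2).const_mul K).intervalIntegrable
  · intro x
    have := E0I_nonneg hM hr φ x
    have := E0I_nonneg hM hr (pd_t φ) x
    positivity
  · intro x
    have a2 := mul_nonneg K0 (E0I_nonneg hM hr (pd_t φ) x)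
    have := e0_low2 hM hr φ x
    rw [← hK] at this
    have := sq_nonneg (pd_s φ 1 x)

    linarith
  · intro x
    have q1 := e0_low2 hM hr φ x
    have q2 := e0_low2 hM hr (pd_t φ) x
    rw [← hK] at q1 q2
    have := sq_nonneg (pd_s φ 1 x)
    have := sq_nonneg (pd_t (pd_t φ) 1 x)
    have := sq_nonneg (pd_t φ 1 x - pd_s (pd_t φ) 1 x)

    linarith
  · intro a b hab
    exact e_int hM hr h1 h2 K0 g1 g2 hab

/-- both data bounds -/
lemma data_bounds (hM : 0 < M) (hr : IsTortoise M r) : ∃ C : ℝ, 0 ≤ C ∧ ∀ φ, IsWaveSol r φ →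
    FinE0 M r φ → FinE0 M r (pd_t φ) → ∀ G, E0 M r φ ≤ G → E0 M r (pd_t φ) ≤ G →
    ∀ σ, |QQ φ 1 σ| ≤ C * √G * √(dd M r σ) ∧ |pd_t φ 1 σ| ≤ C * √G := by
  set K := (2 + 1 / M ^ 2) * (1 / M ^ 2) with hK
  have K0 : 0 ≤ K := by positivity
  have K1 : 1 / M ^ 2 ≤ K := by
    rw [hK]; apply le_mul_of_one_le_left (by positivity)
    have : 0 ≤ 1 / M ^ 2 := by positivity
    linarith
  refine ⟨2 * √K, by positivity, fun φ h h1 h2 G g1 g2 σ => ?_⟩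
  have G0 : 0 ≤ G := (E0_nonneg hM hr φ).trans g1
  have hD := dd_pos hM hr σ
  constructor
  · apply abs_le_of_sq_le_sq _ (by positivity)
    have := data_Q hM hr h h1 h2 g1 g2 σ
    rw [inv_mul_le_iff₀ hD] at this
    rw [mul_pow, mul_pow, mul_pow, Real.sq_sqrt K0, Real.sq_sqrt G0, Real.sq_sqrt hD.le]
    linarith
  · apply abs_le_of_sq_le_sq _ (by positivity)
    have := data_t hM hr h h1 h2 g1 g2 σ
    rw [mul_pow, mul_pow, Real.sq_sqrt K0, Real.sq_sqrt G0]
    have := mul_le_mul_of_nonneg_right K1 G0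
    linarith
end

section
variable {M : ℝ} {r : ℝ → ℝ} {φ : ℝ → ℝ → ℝ}

lemma gam_pos {S : ℝ} (hM : 0 < M) (hS : 0 ≤ S) : 0 < gam M S := by unfold gam; positivity

lemma rm_inv (hM : 0 < M) (hr : IsTortoise M r) (ξ : ℝ → ℝ → ℝ) {t s X : ℝ} (h : |rm r ξ t s| ≤ X) :
    |ξ t s| ≤ 1 / (2 * M) * X := by
  have h1 := xx_le hM hr s
  have h2 := xx_pos hM hr s
  have h3 := r_xx hM hr s
  have e : ξ t s = xx r s * rm r ξ t s := by
    unfold rm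
    have : xx r s * (r s * ξ t s) = r s * xx r s * ξ t s := by ring
    rw [this, h3, one_mul]
  rw [e, abs_mul, abs_of_pos h2]
  exact mul_le_mul h1 h (abs_nonneg _) (by positivity)

lemma svf_alg (hM : 0 < M) (hr : IsTortoise M r) (h : Sm φ) (t s : ℝ) :
    t * pd_t φ t s = xx r s * Svf (rm r φ) t s - s * (xx r s * dd M r s * φ t s + pd_t φ t s - QQ φ t s) := by
  rw [svf_rm hr h]
  have h3 := r_xx hM hr s
  unfold QQ Svf
  have : xx r s * (r s * (t * pd_t φ t s + s * pd_s φ t s) + s * dd M r s * φ t s)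
    = r s * xx r s * (t * pd_t φ t s + s * pd_s φ t s) + xx r s * (s * dd M r s * φ t s) := by ring
  rw [this, h3]; ring

lemma improve_alg {i y u A x D η f p Q E a : ℝ} {t : ℝ} (hi : 0 ≤ i) (hy : 1 ≤ y) (hu : 0 ≤ u) (hA : 0 ≤ A)
    (hE : 0 ≤ E) (ha : |a| ≤ y) (hx0 : 0 ≤ x) (hx : x ≤ i) (hD0 : 0 ≤ D) (hD : D ≤ 1) (h1 : |η| ≤ A * y ^ 2 * u)
    (h2 : |f| ≤ i * (A * y ^ 2 * u)) (h3 : |p| ≤ i * (A * y ^ 2 * u)) (h4 : |Q| ≤ E * A * u)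
    (he : t * p = x * η - a * (x * D * f + p - Q)) (ht : 0 < t) :
    |p| ≤ (2 * i + i ^ 2 + E) * A * y ^ 3 * u * t⁻¹ := by
  have y0 : 0 ≤ y := by linarith
  have Au : 0 ≤ A * u := by positivity
  have m1 : |x * η| ≤ i * (A * y ^ 2 * u) := by
    rw [abs_mul, abs_of_nonneg hx0]; exact mul_le_mul hx h1 (abs_nonneg _) hi
  have m2 : |x * D * f| ≤ i * (i * (A * y ^ 2 * u)) := by
    rw [abs_mul, abs_of_nonneg (by positivity)]
    apply mul_le_mul _ h2 (abs_nonneg _) hi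
    calc x * D ≤ i * 1 := by gcongr
      _ = i := mul_one i
  have m3 : |x * D * f + p - Q| ≤ (i ^ 2 + i + E) * (A * y ^ 2 * u) := by
    have k : E * A * u ≤ E * (A * y ^ 2 * u) := by
      have : E * A * u * 1 ≤ E * A * u * y ^ 2 := by
        gcongr; exact one_le_pow₀ hy
      linarith
    have := abs_sub (x * D * f + p) Q
    have := abs_add_le (x * D * f) p
    linarith
  have m4 : |a * (x * D * f + p - Q)| ≤ y * ((i ^ 2 + i + E) * (A * y ^ 2 * u)) := by
    rw [abs_mul]; exact mul_le_mul ha m3 (abs_nonneg _) y0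
  have m5 : i * (A * y ^ 2 * u) ≤ i * (A * y ^ 3 * u) := by
    have : y ^ 2 ≤ y ^ 3 := pow_le_pow_right₀ hy (by norm_num)
    gcongr
  have m6 : t * |p| ≤ (2 * i + i ^ 2 + E) * A * y ^ 3 * u := by
    have : |t * p| = t * |p| := by rw [abs_mul, abs_of_pos ht]
    rw [← this, he]
    have := abs_sub (x * η) (a * (x * D * f + p - Q))
    linarith
  rw [← div_eq_mul_inv, le_div_iff₀ ht]
  linarith

lemma improve (hM : 0 < M) (hr : IsTortoise M r) {S : ℝ} (hS : 0 ≤ S) :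
    ∃ K : ℝ, 1 ≤ K ∧ ∀ φ, IsWaveSol r φ → ∀ A : ℝ, 0 ≤ A →
    (∀ σ, σ ≤ S → |QQ φ 1 σ| ≤ A * rexp (gam M S * σ)) →
    (∀ t s, 1 ≤ t → |rm r φ t s| ≤ A * (1 + |s|) ^ 2 * uu t) →
    (∀ t s, 1 ≤ t → |rm r (pd_t φ) t s| ≤ A * (1 + |s|) ^ 2 * uu t) →
    (∀ t s, 1 ≤ t → |Svf (rm r φ) t s| ≤ A * (1 + |s|) ^ 2 * uu t) →
    ∀ t s, 1 ≤ t → s ≤ S → |pd_t φ t s| ≤ K * A * (1 + |s|) ^ 3 * uu t ^ 3 ∧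
      |QQ φ t s| ≤ K * A * rexp (gam M S / 2 * s) * uu t ^ 3 := by
  obtain ⟨K1, hK1, T1⟩ := transport hM hr hS 2 1
  obtain ⟨K3, hK3, T3⟩ := transport hM hr hS 3 3
  set i := 1 / (2 * M) with hi
  have i0 : 0 ≤ i := by positivity
  have hγ := gam_pos hM hS
  set E := K1 * (1 + i) * rexp (gam M S / 2 * S) with hE
  have E0 : 0 ≤ E := by positivity
  set L := 1 + (2 * i + i ^ 2 + E) with hL
  have L1 : 1 ≤ L := by rw [hL]; linarith [sq_nonneg i]
  refine ⟨K3 * L, one_le_mul_of_one_le_of_one_le hK3 L1, ?_⟩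
  intro φ h A hA hQ0 hψ hψt hη
  have bQ : ∀ t s, 1 ≤ t → s ≤ S → |QQ φ t s| ≤ E * A * uu t := by
    intro t s ht hs
    have u0 := uu_pos (show 0 < t by linarith)
    have := T1 φ h ((1 + i) * A) (by positivity) (fun σ hσ => by
        refine (hQ0 σ hσ).trans ?_
        have : A ≤ (1 + i) * A := by nlinarith
        gcongr) (fun τ σ hτ hσ => by
        have := rm_inv hM hr _ (hψt τ σ hτ)
        rw [← hi] at this
        have u1 := uu_pos (show 0 < τ by linarith)
        have k : 0 ≤ A * (1 + |σ|) ^ 2 * uu τ := by positivity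
        rw [pow_one]
        linarith) t s ht hs
    rw [pow_one] at this
    refine this.trans ?_
    have : rexp (gam M S / 2 * s) ≤ rexp (gam M S / 2 * S) := by gcongr
    calc K1 * ((1 + i) * A) * rexp (gam M S / 2 * s) * uu t ≤ K1 * ((1 + i) * A) * rexp (gam M S / 2 * S) * uu t := by gcongr
      _ = E * A * uu t := by rw [hE]; ring
  have bt : ∀ t s, 1 ≤ t → s ≤ S → |pd_t φ t s| ≤ L * A * (1 + |s|) ^ 3 * uu t ^ 3 := by
    intro t s ht hs
    have t0 : 0 < t := by linarith
    have u0 := uu_pos t0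
    have := improve_alg (y := 1 + |s|) (a := s) (D := dd M r s) i0 (by linarith [abs_nonneg s]) u0.le hA E0 (by linarith)
      (xx_pos hM hr s).le (xx_le hM hr s) (dd_pos hM hr s).le (dd_le hM hr s) (hη t s ht)
      (rm_inv hM hr _ (hψ t s ht)) (rm_inv hM hr _ (hψt t s ht)) (bQ t s ht hs) (svf_alg hM hr (wave_sm h) t s) t0
    rw [← uu_sq t0] at this
    have e : (2 * i + i ^ 2 + E) * A * (1 + |s|) ^ 3 * uu t * uu t ^ 2 = (2 * i + i ^ 2 + E) * (A * (1 + |s|) ^ 3 * uu t ^ 3) := by ring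
    rw [e] at this
    have k : 0 ≤ A * (1 + |s|) ^ 3 * uu t ^ 3 := by positivity
    have e2 : L * A * (1 + |s|) ^ 3 * uu t ^ 3 = A * (1 + |s|) ^ 3 * uu t ^ 3 + (2 * i + i ^ 2 + E) * (A * (1 + |s|) ^ 3 * uu t ^ 3) := by
      rw [hL]; ring
    linarith
  intro t s ht hs
  have u0 := uu_pos (show 0 < t by linarith)
  constructor
  · refine (bt t s ht hs).trans ?_
    have : L ≤ K3 * L := by nlinarith
    gcongr
  · have := T3 φ h (L * A) (by positivity) (fun σ hσ => by
        refine (hQ0 σ hσ).trans ?_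
        have : A ≤ L * A := by nlinarith
        gcongr) bt t s ht hs
    rw [← mul_assoc] at this
    exact this

lemma uu_le' {a t : ℝ} (ha : 0 < a) (h : a ≤ t) : uu t ≤ uu a := by
  have := uu_le ha le_rfl (by linarith : a ≤ t * 1)
  linarith

/-- integrating along an ingoing null line -/
lemma null_int {S : ℝ} (hM : 0 < M) (hS : 0 ≤ S) (hs : Sm φ) {A w v s b : ℝ} (hA : 0 ≤ A) (hw : 1 ≤ w)
    (hsb : s ≤ b) (hb : b ≤ 0) (hwb : w ≤ v - b)
    (hQ : ∀ t s, 1 ≤ t → s ≤ S → |QQ φ t s| ≤ A * rexp (gam M S / 2 * s) * uu t ^ 3) :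
    |φ (v - s) s| ≤ |φ (v - b) b| + (gam M S / 2)⁻¹ * A * uu w ^ 3 := by
  have hγ : 0 < gam M S / 2 := half_pos (gam_pos hM hS)
  have u0 := uu_pos (show 0 < w by linarith)
  have hd : ∀ σ, HasDerivAt (fun σ => φ (v - σ) σ) (- QQ φ (v - σ) σ) σ := by
    intro σ
    have g1 : HasDerivAt (fun σ => v - σ) (-1) σ := by simpa using (hasDerivAt_id σ).const_sub v
    have := hasDeriv_line (f := φ) (γ₁ := fun σ => v - σ) (γ₂ := fun σ => σ) (hs.diff (v - σ) σ) g1 (hasDerivAt_id σ)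
    refine this.congr_deriv ?_
    unfold QQ; ring
  have hc : Continuous (fun σ => - QQ φ (v - σ) σ) := by
    have := (QQ_sm hs).continuous
    have h2 : Continuous (fun σ : ℝ => ((v - σ, σ) : ℝ × ℝ)) := by fun_prop
    exact (this.comp h2).neg
  have ft := intervalIntegral.integral_eq_sub_of_hasDerivAt (fun σ _ => hd σ) (hc.intervalIntegrable s b)
  have bd : ‖∫ σ in s..b, - QQ φ (v - σ) σ‖ ≤ ∫ σ in s..b, A * uu w ^ 3 * rexp (gam M S / 2 * (0 + σ)) := by
    apply intervalIntegral.norm_integral_le_of_norm_le hsb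
    · refine Filter.Eventually.of_forall fun σ hσ => ?_
      rw [Real.norm_eq_abs, abs_neg]
      have h1 : w ≤ v - σ := by have := hσ.2; linarith
      refine (hQ (v - σ) σ (by linarith) (by have := hσ.2; linarith)).trans ?_
      have h2 := uu_le' (by linarith) h1
      have h3 := uu_pos (show 0 < v - σ by linarith)
      rw [zero_add]
      calc A * rexp (gam M S / 2 * σ) * uu (v - σ) ^ 3 ≤ A * rexp (gam M S / 2 * σ) * uu w ^ 3 := by gcongr
        _ = _ := by ring
    · apply Continuous.intervalIntegrable; fun_prop
  rw [intervalIntegral.integral_const_mul] at bd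
  have b2 := exp_int_le hγ 0 s b
  have b3 : rexp (gam M S / 2 * (0 + b)) ≤ 1 := by
    rw [Real.exp_le_one_iff]; nlinarith
  have b4 : ∫ σ in s..b, rexp (gam M S / 2 * (0 + σ)) ≤ (gam M S / 2)⁻¹ :=
    b2.trans (mul_le_of_le_one_right (by positivity) b3)
  have b5 := bd.trans (mul_le_mul_of_nonneg_left b4 (by positivity))
  rw [ft, Real.norm_eq_abs, abs_sub_comm] at b5
  have := abs_sub_abs_le_abs_sub (φ (v - s) s) (φ (v - b) b)
  linarith

lemma final_decay (hM : 0 < M) {S : ℝ} (hS : 0 ≤ S) :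
    ∃ K : ℝ, 1 ≤ K ∧ ∀ φ, Sm φ → ∀ A : ℝ, 0 ≤ A →
    (∀ σ, |pd_t φ 1 σ| ≤ A) →
    (∀ t s, 1 ≤ t → s ≤ S → |pd_t φ t s| ≤ A * (1 + |s|) ^ 3 * uu t ^ 3) →
    (∀ t s, 1 ≤ t → s ≤ S → |QQ φ t s| ≤ A * rexp (gam M S / 2 * s) * uu t ^ 3) →
    (∀ t s, 1 ≤ t → s ≤ S → |QQ (pd_t φ) t s| ≤ A * rexp (gam M S / 2 * s) * uu t ^ 3) →
    ∀ t s, 1 ≤ t → s ≤ S → |pd_t φ t s| + |pd_s φ t s| ≤ K * A * uu (max ((t + s) / 2) 1) ^ 3 := by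
  have hγ : 0 < gam M S / 2 := half_pos (gam_pos hM hS)
  set g := (gam M S / 2)⁻¹ with hg
  have g0 : 0 ≤ g := by positivity
  set P := (1 + S) ^ 3 * (1 + S) ^ 3 with hP
  have P0 : 0 ≤ P := by positivity
  set T := rexp (gam M S / 2 * S) * (1 + S) ^ 3 with hT
  have T0 : 0 ≤ T := by positivity
  refine ⟨2 * (P + (1 + g)) + T, by linarith, ?_⟩
  intro φ hs A hA h1 h2 h3 h4 t s ht hsS
  set w := max ((t + s) / 2) 1 with hw
  have w1 : 1 ≤ w := le_max_right _ _
  have u0 := uu_pos (show 0 < w by linarith)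
  have ut0 := uu_pos (show 0 < t by linarith)
  have hwt : w ≤ t * (1 + S) := by
    rw [hw]; apply max_le <;> nlinarith
  have hut : uu t ^ 3 ≤ (1 + S) ^ 3 * uu w ^ 3 := by
    rw [← mul_pow]
    exact pow_le_pow_left₀ ut0.le (uu_le (by linarith) (by linarith) hwt) 3
  have X0 : 0 ≤ A * uu w ^ 3 := by positivity
  have key : |pd_t φ t s| ≤ (P + (1 + g)) * (A * uu w ^ 3) := by
    rcases le_or_gt 0 s with hs0 | hs0
    · have := h2 t s ht hsS
      rw [abs_of_nonneg hs0] at this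
      have k : A * (1 + s) ^ 3 * uu t ^ 3 ≤ A * (1 + S) ^ 3 * ((1 + S) ^ 3 * uu w ^ 3) := by
        gcongr
      have e : A * (1 + S) ^ 3 * ((1 + S) ^ 3 * uu w ^ 3) = P * (A * uu w ^ 3) := by rw [hP]; ring
      have : 0 ≤ (1 + g) * (A * uu w ^ 3) := by positivity
      linarith
    · have main : |pd_t φ t s| ≤ A * uu w ^ 3 + g * A * uu w ^ 3 := by
        rcases le_or_gt 1 (t + s) with hv | hv
        · have hwv : w ≤ t + s := by rw [hw]; apply max_le <;> linarith
          have := null_int (v := t + s) (b := 0) (s := s) hM hS hs.dt hA w1 hs0.le le_rfl (by linarith) h4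
          rw [← hg] at this
          have e : t + s - s = t := by ring
          rw [e, sub_zero] at this
          have q := h2 (t + s) 0 hv hS
          have q2 := uu_le' (by linarith) hwv
          have q3 := uu_pos (show 0 < t + s by linarith)
          have q4 : A * (1 + |(0:ℝ)|) ^ 3 * uu (t + s) ^ 3 ≤ A * uu w ^ 3 := by
            rw [abs_zero, add_zero, one_pow, mul_one]
            gcongr
          linarith
        · have hw1 : w = 1 := by rw [hw]; apply max_eq_right; linarith
          have := null_int (v := t + s) (b := t + s - 1) (s := s) hM hS hs.dt hA w1 (by linarith) (by linarith) (by linarith) h4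
          rw [← hg] at this
          have e : t + s - s = t := by ring
          have e2 : t + s - (t + s - 1) = 1 := by ring
          rw [e, e2] at this
          have q := h1 (t + s - 1)
          have e3 : uu w = 1 := by rw [hw1]; unfold uu; simp
          rw [e3] at this ⊢
          linarith
      have : 0 ≤ P * (A * uu w ^ 3) := by positivity
      linarith
  have kQ : |QQ φ t s| ≤ T * (A * uu w ^ 3) := by
    refine (h3 t s ht hsS).trans ?_
    have : rexp (gam M S / 2 * s) ≤ rexp (gam M S / 2 * S) := by gcongr
    calc A * rexp (gam M S / 2 * s) * uu t ^ 3 ≤ A * rexp (gam M S / 2 * S) * ((1 + S) ^ 3 * uu w ^ 3) := by gcongr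
      _ = _ := by rw [hT]; ring
  have ks : |pd_s φ t s| ≤ |pd_t φ t s| + |QQ φ t s| := by
    have e : pd_s φ t s = pd_t φ t s - QQ φ t s := by unfold QQ; ring
    rw [e]; exact abs_sub _ _
  linarith
end

section
variable {M : ℝ} {r : ℝ → ℝ} {φ : ℝ → ℝ → ℝ}

lemma uu_rpow {w δ : ℝ} (hw : 1 ≤ w) (hδ : 0 < δ) : uu w ^ 3 ≤ w ^ (-(3 : ℝ) / 2 + δ) := by
  have w0 : 0 ≤ w := by linarith
  have e : uu w ^ 3 = w ^ (-(3 : ℝ) / 2) := by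
    unfold uu
    rw [Real.sqrt_eq_rpow, ← Real.rpow_neg w0, ← Real.rpow_mul_natCast w0]
    norm_num
  rw [e]
  exact Real.rpow_le_rpow_of_exponent_le hw (by linarith)

/-- pointwise bound for `rφ` and `S(rφ)` -/
lemma point_bounds (hM : 0 < M) (hr : IsTortoise M r) : ∃ C : ℝ, 0 ≤ C ∧ ∀ φ, IsWaveSol r φ →
    FinE0 M r φ → FinE0 M r (Svf φ) → ∀ G, E0 M r φ ≤ G → E0 M r (Svf φ) ≤ G → ∀ t s, 1 ≤ t →
    |rm r φ t s| ≤ C * √G * (1 + |s|) ^ 2 * uu t ∧ |Svf (rm r φ) t s| ≤ C * √G * (1 + |s|) ^ 2 * uu t := by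
  obtain ⟨B, hB⟩ := exists_bg hM hr
  obtain ⟨K, hK, H⟩ := energy_bounds hM hr hB
  have hC := B.C1
  refine ⟨7 * B.C * √K, by positivity, fun φ h f1 f2 G g1 g2 t s ht => ?_⟩
  have H2 := H φ h f1 f2 G g1 g2 t ht
  have hs := rm_sm hM hr (wave_sm h)
  have e : 7 * B.C * √K * √G * (1 + |s|) ^ 2 * uu t = 7 * B.C * (1 + |s|) ^ 2 * √(K * G) * (√t)⁻¹ := by
    rw [Real.sqrt_mul hK]; unfold uu; ring
  rw [e]
  exact ⟨R0 hs ht (fun a b hab => (H2 a b hab).1) s, R0 hs.svf ht (fun a b hab => (H2 a b hab).2) s⟩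

lemma main_bound (hM : 0 < M) (hr : IsTortoise M r) {S : ℝ} (hS : 0 ≤ S) :
    ∃ K : ℝ, 0 < K ∧ ∀ φ, IsWaveSol r φ → FinE2 M r φ → ∀ t s, 1 ≤ t → s ≤ S →
      |pd_t φ t s| + |pd_s φ t s| ≤ K * √(E2 M r φ) * uu (max ((t + s) / 2) 1) ^ 3 := by
  obtain ⟨C1, hC1, D1⟩ := data_bounds hM hr
  obtain ⟨C2, hC2, D2⟩ := point_bounds hM hr
  obtain ⟨K1, hK1, I1⟩ := improve hM hr hS
  obtain ⟨K2, hK2, F1⟩ := final_decay (M := M) hM hS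
  refine ⟨K2 * (K1 * (1 + C1 + C2)), by positivity, fun φ h hfin => ?_⟩
  obtain ⟨⟨f0S, f0, f1⟩, ⟨f1S, -, f2⟩, ⟨f2S, -, f3⟩⟩ := hfin
  set G := E2 M r φ with hG
  have n1 := E0_nonneg hM hr φ
  have n2 := E0_nonneg hM hr (Svf φ)
  have n3 := E0_nonneg hM hr (pd_t φ)
  have n4 := E0_nonneg hM hr (Svf (pd_t φ))
  have n5 := E0_nonneg hM hr (pd_t (pd_t φ))
  have n6 := E0_nonneg hM hr (Svf (pd_t (pd_t φ)))
  have n7 := E0_nonneg hM hr (pd_t (pd_t (pd_t φ)))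
  have hG2 : G = E0 M r (Svf φ) + E0 M r φ + E0 M r (pd_t φ)
      + (E0 M r (Svf (pd_t φ)) + E0 M r (pd_t φ) + E0 M r (pd_t (pd_t φ)))
      + (E0 M r (Svf (pd_t (pd_t φ))) + E0 M r (pd_t (pd_t φ)) + E0 M r (pd_t (pd_t (pd_t φ)))) := rfl
  have g0 : E0 M r φ ≤ G := by linarith
  have g0S : E0 M r (Svf φ) ≤ G := by linarith
  have g1 : E0 M r (pd_t φ) ≤ G := by linarith
  have g1S : E0 M r (Svf (pd_t φ)) ≤ G := by linarith
  have g2 : E0 M r (pd_t (pd_t φ)) ≤ G := by linarith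
  have g2S : E0 M r (Svf (pd_t (pd_t φ))) ≤ G := by linarith
  have h' := wave_dt hM hr h
  have h'' := wave_dt hM hr h'
  have p0 := D2 φ h f0 f0S G g0 g0S
  have p1 := D2 _ h' f1 f1S G g1 g1S
  have p2 := D2 _ h'' f2 f2S G g2 g2S
  have d0 := D1 φ h f0 f1 G g0 g1
  have d1 := D1 _ h' f1 f2 G g1 g2
  set A := (1 + C1 + C2) * √G with hA
  have q0 := Real.sqrt_nonneg G
  have A0 : 0 ≤ A := by positivity
  have A1 : C1 * √G ≤ A := by rw [hA]; gcongr; linarith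
  have A2 : C2 * √G ≤ A := by rw [hA]; gcongr; linarith
  have up : ∀ t s X : ℝ, 1 ≤ t → X ≤ C2 * √G * (1 + |s|) ^ 2 * uu t → X ≤ A * (1 + |s|) ^ 2 * uu t := by
    intro t s X ht hX
    have := uu_pos (show 0 < t by linarith)
    refine hX.trans ?_
    gcongr
  have upQ : ∀ σ X : ℝ, σ ≤ S → X ≤ C1 * √G * √(dd M r σ) → X ≤ A * rexp (gam M S * σ) := by
    intro σ X hσ hX
    exact hX.trans (mul_le_mul A1 (dd_gam hM hr hS hσ) (Real.sqrt_nonneg _) A0)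
  have i0 := I1 φ h A A0 (fun σ hσ => upQ σ _ hσ (d0 σ).1) (fun t s ht => up t s _ ht (p0 t s ht).1)
    (fun t s ht => up t s _ ht (p1 t s ht).1) (fun t s ht => up t s _ ht (p0 t s ht).2)
  have i1 := I1 _ h' A A0 (fun σ hσ => upQ σ _ hσ (d1 σ).1) (fun t s ht => up t s _ ht (p1 t s ht).1)
    (fun t s ht => up t s _ ht (p2 t s ht).1) (fun t s ht => up t s _ ht (p1 t s ht).2)
  have fin := F1 φ (wave_sm h) (K1 * A) (by positivity)
    (fun σ => ((d0 σ).2.trans A1).trans (by nlinarith))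
    (fun t s ht hs => (i0 t s ht hs).1) (fun t s ht hs => (i0 t s ht hs).2) (fun t s ht hs => (i1 t s ht hs).2)
  intro t s ht hs
  refine (fin t s ht hs).trans (le_of_eq ?_)
  rw [hA]; ring
end

/-- Main Theorem 1, part 2 (spherically symmetric case): pointwise decay of the
derivatives of `φ` in any region `r ≤ R`, including along the event horizon. -/
theorem pointwise_decay_of_derivatives
    (M : ℝ) (hM : 0 < M) (r : ℝ → ℝ) (hr : IsTortoise M r)
    (δ R : ℝ) (hδ0 : 0 < δ) (hδ1 : δ < 1) (hR : 2 * M < R) :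
    ∃ C : ℝ, 0 < C ∧
      ∀ φ : ℝ → ℝ → ℝ, IsWaveSol r φ → FinE2 M r φ → FinE2 M r (pd_t φ) →
        ∀ t s : ℝ, 1 ≤ t → r s ≤ R →
          |pd_t φ t s| + |pd_s φ t s|
            ≤ C * (max ((t + s) / 2) 1) ^ (-(3 : ℝ) / 2 + δ)
              * (Real.sqrt (E2 M r φ) + Real.sqrt (E2 M r (pd_t φ))) := by
  have hS : 0 ≤ 3 * R := by linarith
  obtain ⟨K, hK, H⟩ := main_bound hM hr hS
  refine ⟨K, hK, fun φ h f1 _ t s ht hs => ?_⟩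
  have hsS : s ≤ 3 * R := by
    rcases le_total 0 s with h0 | h0
    · have := r_ge hM hr h0
      linarith
    · linarith
  have w1 : 1 ≤ max ((t + s) / 2) 1 := le_max_right _ _
  have b := H φ h f1 t s ht hsS
  have u := uu_rpow w1 hδ0
  have u0 := uu_pos (show 0 < max ((t + s) / 2) 1 by linarith)
  have q := Real.sqrt_nonneg (E2 M r (pd_t φ))
  calc _ ≤ _ := b
    _ = K * uu (max ((t + s) / 2) 1) ^ 3 * √(E2 M r φ) := by ring
    _ ≤ _ := by
      gcongr
      linarith
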